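/- arXiv:0904.0973 — 2 statements merged into one kernel-verified Lean document; each statement's English description precedes it below -/
import Mathlib

section
/- Let V be an optimal computer and let T ∈ (0,1). If the statistical mechanical entropy S_V(T) = (E_V(T) − F_V(T))/T is a computable real, then T is Chaitin T-random and T-compressible. -/
open Filter Topology

/-- A set of finite binary strings is prefix-free if no string in it is a
proper prefix of another string in it. -/
def PrefixFree (S : Set (List Bool)) : Prop :=
  ∀ p ∈ S, ∀ q ∈ S, p <+: q → p = q

/-- A computer: a partial recursive function from finite binary strings to
finite binary strings whose domain is a nonempty prefix-free set. -/
structure Computer where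
  f : List Bool →. List Bool
  partrec : Partrec f
  dom_nonempty : f.Dom.Nonempty
  dom_prefixFree : PrefixFree f.Dom

/-- A computer `U` is optimal if for each computer `C` there is `d ∈ ℕ` such
that every `p ∈ Dom C` admits `q` with `U(q) = C(p)` and `|q| ≤ |p| + d`. -/
def Optimal (U : Computer) : Prop :=
  ∀ C : Computer, ∃ d : ℕ, ∀ p ∈ C.f.Dom,
    ∃ q : List Bool, U.f q = C.f p ∧ q.length ≤ p.length + d

/-- `H_C(s)`: the length of a shortest program for `C` printing `s`. -/
noncomputable def complexity (C : Computer) (s : List Bool) : ℕ :=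
  sInf {n | ∃ p : List Bool, s ∈ C.f p ∧ p.length = n}

/-- The `i`-th bit (for `i = 0, 1, 2, …`) of the base-two expansion of
`α - ⌊α⌋` with infinitely many zeros. -/
noncomputable def bitOf (α : ℝ) (i : ℕ) : Bool :=
  decide (⌊(α - ⌊α⌋) * 2 ^ (i + 1)⌋ % 2 = 1)

/-- `α↾n`: the first `n` bits of the base-two expansion of `α - ⌊α⌋`
with infinitely many zeros. -/
noncomputable def firstBits (α : ℝ) (n : ℕ) : List Bool :=
  (List.range n).map (bitOf α)

/-- A real `α` is computable if some total recursive `f : ℕ⁺ → ℚ` satisfies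
`|α - f n| < 1/n` for all `n ≥ 1`. -/
def ComputableReal (α : ℝ) : Prop :=
  ∃ f : ℕ → ℚ, Computable f ∧ ∀ n : ℕ, 0 < n → |α - (f n : ℝ)| < 1 / n

/-- `α` is weakly Chaitin `T`-random (w.r.t. the computer `U`). -/
def WeaklyChaitinTRandom (U : Computer) (T α : ℝ) : Prop :=
  ∃ c : ℕ, ∀ n : ℕ, 0 < n → T * n - c ≤ (complexity U (firstBits α n) : ℝ)

/-- `α` is Chaitin `T`-random (w.r.t. the computer `U`). -/
def ChaitinTRandom (U : Computer) (T α : ℝ) : Prop :=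
  Tendsto (fun n : ℕ => (complexity U (firstBits α n) : ℝ) - T * n) atTop atTop

/-- `α` is `T`-compressible (w.r.t. the computer `U`): `H(α↾n) ≤ Tn + o(n)`. -/
def TCompressible (U : Computer) (T α : ℝ) : Prop :=
  ∃ g : ℕ → ℝ, Tendsto (fun n : ℕ => g n / n) atTop (nhds 0) ∧
    ∀ n : ℕ, 0 < n → (complexity U (firstBits α n) : ℝ) ≤ T * n + g n

/-- The Boltzmann factor `2^(-|p|/T)` of a program `p`. -/
noncomputable def boltzmann (T : ℝ) (p : List Bool) : ℝ :=
  (2 : ℝ) ^ (-(p.length : ℝ) / T)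

/-- Partition function `Z_C(T) = Σ_{p ∈ Dom C} 2^(-|p|/T)`. -/
noncomputable def Zfun (C : Computer) (T : ℝ) : ℝ :=
  ∑' p : C.f.Dom, boltzmann T p.1

/-- Free energy `F_C(T) = -T log₂ Z_C(T)`. -/
noncomputable def Ffun (C : Computer) (T : ℝ) : ℝ :=
  -T * Real.logb 2 (Zfun C T)

/-- Energy `E_C(T) = Z_C(T)⁻¹ Σ_{p ∈ Dom C} |p| 2^(-|p|/T)`. -/
noncomputable def Efun (C : Computer) (T : ℝ) : ℝ :=
  (Zfun C T)⁻¹ * ∑' p : C.f.Dom, (p.1.length : ℝ) * boltzmann T p.1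

/-- Statistical mechanical entropy `S_C(T) = (E_C(T) - F_C(T))/T`. -/
noncomputable def Sfun (C : Computer) (T : ℝ) : ℝ :=
  (Efun C T - Ffun C T) / T

/-- `𝒵(V)`: the set of `T ∈ (0,1)` with `Z_V(T)` computable. -/
def setZ (V : Computer) : Set ℝ := {T | T ∈ Set.Ioo 0 1 ∧ ComputableReal (Zfun V T)}

/-- `ℱ(V)`: the set of `T ∈ (0,1)` with `F_V(T)` computable. -/
def setF (V : Computer) : Set ℝ := {T | T ∈ Set.Ioo 0 1 ∧ ComputableReal (Ffun V T)}

/-- `ℰ(V)`: the set of `T ∈ (0,1)` with `E_V(T)` computable. -/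
def setE (V : Computer) : Set ℝ := {T | T ∈ Set.Ioo 0 1 ∧ ComputableReal (Efun V T)}

/-- `𝒮(V)`: the set of `T ∈ (0,1)` with `S_V(T)` computable. -/
def setS (V : Computer) : Set ℝ := {T | T ∈ Set.Ioo 0 1 ∧ ComputableReal (Sfun V T)}

/-- `FP_w` (w.r.t. the optimal computer `U` fixing `H`): the set of `T ∈ (0,1)`
that are weakly Chaitin `T`-random and `T`-compressible. -/
def FPw (U : Computer) : Set ℝ :=
  {T | T ∈ Set.Ioo 0 1 ∧ WeaklyChaitinTRandom U T T ∧ TCompressible U T T}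

/-- `FP` (w.r.t. the optimal computer `U` fixing `H`): the set of `T ∈ (0,1)`
that are Chaitin `T`-random and `T`-compressible. -/
def FP (U : Computer) : Set ℝ :=
  {T | T ∈ Set.Ioo 0 1 ∧ ChaitinTRandom U T T ∧ TCompressible U T T}

/-- A computer is physically reasonable if its domain contains two strings of
different lengths. -/
def PhysicallyReasonable (C : Computer) : Prop :=
  ∃ p ∈ C.f.Dom, ∃ q ∈ C.f.Dom, p.length ≠ q.length

/-- A computable measure machine: `Z_C(1)` is a computable real. -/
def ComputableMeasureMachine (C : Computer) : Prop :=
  ComputableReal (Zfun C 1)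

/-- `D` is the composition `C₀ ⊘ C₁ ⊘ ⋯ ⊘ C_{N-1}`: its domain consists of the
concatenations `p₀p₁⋯p_{N-1}` with each `pᵢ ∈ Dom Cᵢ`, and on such a
concatenation it returns `C₀(p₀)`. -/
def IsComposition {N : ℕ} (C : Fin N → Computer) (hN : 0 < N) (D : Computer) : Prop :=
  (∀ l, l ∈ D.f.Dom ↔
      ∃ ps : Fin N → List Bool, (∀ i, ps i ∈ (C i).f.Dom) ∧ l = (List.ofFn ps).flatten) ∧
  (∀ ps : Fin N → List Bool, (∀ i, ps i ∈ (C i).f.Dom) →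
      D.f ((List.ofFn ps).flatten) = (C ⟨0, hN⟩).f (ps ⟨0, hN⟩))

/-- A sequence of computers is recursive if a single partial recursive function
uniformly computes all of them. -/
def RecursiveSeq (V : ℕ → Computer) : Prop :=
  ∃ F : ℕ × List Bool →. List Bool, Partrec F ∧ ∀ n p, (V n).f p = F (n, p)
namespace RatComp
open Encodable Primrec

/-- the raw encoding of a rational -/
def re (q : ℚ) : ℕ := @encode ℚ Rat.instEncodable q

/-- the encoding used by `Primcodable` -/
def pe (q : ℚ) : ℕ := @encode ℚ Denumerable.toEncodable q

theorem pe_primrec : Primrec pe := Primrec.encode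

theorem pe_injective : Function.Injective pe := fun _ _ h => @encode_injective ℚ Denumerable.toEncodable _ _ h

def natAbsOf (x : ℕ) : ℕ := (x + 1) / 2

def inR (x : ℕ) : Prop :=
  0 < x.unpair.2 ∧ ∀ y ∈ List.range (x.unpair.2 + 1),
    natAbsOf x.unpair.1 % y = 0 → x.unpair.2 % y = 0 → y = 1

theorem re_eq (q : ℚ) : re q = Nat.pair (Equiv.intEquivNat q.num) q.den := rfl

theorem intEquivNat_ofNat (n : ℕ) : Equiv.intEquivNat (Int.ofNat n) = 2 * n := by
  have : Equiv.intEquivNat (Int.ofNat n) = Nat.bit false n := rfl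
  rw [this]; simp

theorem intEquivNat_negSucc (n : ℕ) : Equiv.intEquivNat (Int.negSucc n) = 2 * n + 1 := by
  simp [Equiv.intEquivNat, Equiv.intEquivNatSumNat, Equiv.natSumNatEquivNat]

theorem natAbsOf_eq (z : ℤ) : natAbsOf (Equiv.intEquivNat z) = z.natAbs := by
  cases z with
  | ofNat n => rw [intEquivNat_ofNat]; simp [natAbsOf]; omega
  | negSucc n => rw [intEquivNat_negSucc]; simp [natAbsOf]; omega

theorem toNat_eq (z : ℤ) :
    z.toNat = if (Equiv.intEquivNat z) % 2 = 0 then (Equiv.intEquivNat z) / 2 else 0 := by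
  cases z with
  | ofNat n => rw [intEquivNat_ofNat]; simp
  | negSucc n => rw [intEquivNat_negSucc]; simp

theorem inR_iff (x : ℕ) : inR x ↔ x ∈ Set.range re := by
  constructor
  · rintro ⟨h0, h⟩
    obtain ⟨z, hz⟩ := Equiv.intEquivNat.surjective x.unpair.1
    have hc : z.natAbs.Coprime x.unpair.2 := by
      have := h (Nat.gcd z.natAbs x.unpair.2)
        (by
          have := Nat.le_of_dvd h0 (Nat.gcd_dvd_right z.natAbs x.unpair.2)
          simp; omega)
      rw [← hz, natAbsOf_eq] at this
      exact this (Nat.mod_eq_zero_of_dvd (Nat.gcd_dvd_left _ _))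
        (Nat.mod_eq_zero_of_dvd (Nat.gcd_dvd_right _ _))
    refine ⟨⟨z, x.unpair.2, h0.ne', hc⟩, ?_⟩
    rw [re_eq, hz, Nat.pair_unpair]
  · rintro ⟨q, rfl⟩
    rw [re_eq]
    unfold inR
    rw [Nat.unpair_pair]
    refine ⟨q.pos, fun y _ h1 h2 => ?_⟩
    simp only [natAbsOf_eq] at h1 h2
    have := Nat.dvd_gcd (Nat.dvd_of_mod_eq_zero h1) (Nat.dvd_of_mod_eq_zero h2)
    rw [q.reduced] at this
    exact Nat.dvd_one.1 this

theorem inR_primrec : PrimrecPred inR := by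
  unfold inR natAbsOf
  have hu1 : Primrec (fun x : ℕ => x.unpair.1) := Primrec.fst.comp Primrec.unpair
  have hu2 : Primrec (fun x : ℕ => x.unpair.2) := Primrec.snd.comp Primrec.unpair
  refine PrimrecPred.and (Primrec.nat_lt.comp (Primrec.const 0) hu2) ?_
  have hR : PrimrecRel (fun (y x : ℕ) => (x.unpair.1 + 1) / 2 % y = 0 → x.unpair.2 % y = 0 → y = 1) := by
    have a1 : PrimrecPred (fun p : ℕ × ℕ => (p.2.unpair.1 + 1) / 2 % p.1 = 0) :=
      Primrec.eq.comp (Primrec.nat_mod.comp (Primrec.nat_div.comp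
        (Primrec.succ.comp (hu1.comp Primrec.snd)) (Primrec.const 2)) Primrec.fst) (Primrec.const 0)
    have a2 : PrimrecPred (fun p : ℕ × ℕ => p.2.unpair.2 % p.1 = 0) :=
      Primrec.eq.comp (Primrec.nat_mod.comp (hu2.comp Primrec.snd) Primrec.fst) (Primrec.const 0)
    have a3 : PrimrecPred (fun p : ℕ × ℕ => p.1 = 1) :=
      Primrec.eq.comp Primrec.fst (Primrec.const 1)
    refine PrimrecPred.of_eq ((a1.not).or ((a2.not).or a3)) (fun p => ?_)
    dsimp only
    tauto
  exact (hR.forall_mem_list.comp (Primrec.list_range.comp (Primrec.succ.comp hu2)) Primrec.id)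

instance : DecidablePred inR := fun x => by unfold inR; infer_instance

theorem encode_eq (q : ℚ) :
    pe q = ((List.range (re q)).filter (fun x => inR x)).length := by
  have : pe q = (List.range (re q)).countP (fun x => @decide (x ∈ Set.range re)
    (Encodable.decidableRangeEncode ℚ x)) := rfl
  rw [this, List.countP_eq_length_filter]
  congr 2
  funext x
  exact decide_eq_decide.2 (inR_iff x).symm

theorem re_computable : Computable re := by
  have hcp : Primrec (fun m : ℕ => ((List.range m).filter (fun x => inR x)).length) :=
    Primrec.list_length.comp ((Primrec.listFilter inR_primrec).comp Primrec.list_range)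
  have hP : PrimrecPred (fun p : ℚ × ℕ => inR p.2 ∧
      pe p.1 = ((List.range p.2).filter (fun x => inR x)).length) :=
    (inR_primrec.comp Primrec.snd).and
      (Primrec.eq.comp (pe_primrec.comp Primrec.fst) (hcp.comp Primrec.snd))
  have hdec : Computable₂ (fun (q : ℚ) (m : ℕ) => decide (inR m ∧
      pe q = ((List.range m).filter (fun x => inR x)).length)) :=
    hP.decide.to_comp
  have := Partrec.rfind hdec.partrec₂
  refine Partrec.of_eq this (fun q => ?_)
  change _ = Part.some (re q)
  rw [Part.eq_some_iff]
  have uniq : ∀ m, inR m → pe q = ((List.range m).filter (fun x => inR x)).length →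
      m = re q := by
    intro m hm he
    obtain ⟨q', rfl⟩ := (inR_iff m).1 hm
    rw [← encode_eq] at he
    rw [pe_injective he]
  apply Nat.mem_rfind.2
  constructor
  · simp
    exact ⟨(inR_iff _).2 ⟨q, rfl⟩, encode_eq q⟩
  · intro m hm
    simp
    intro h1 h2
    have := uniq m h1 h2
    omega

theorem den_computable : Computable (fun q : ℚ => q.den) := by
  refine ((Primrec.snd.comp Primrec.unpair).to_comp.comp re_computable).of_eq (fun q => ?_)
  rw [re_eq, Nat.unpair_pair]

theorem num_computable : Computable (fun q : ℚ => q.num.toNat) := by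
  have h : Primrec (fun x : ℕ => if x.unpair.1 % 2 = 0 then x.unpair.1 / 2 else 0) := by
    have hu1 : Primrec (fun x : ℕ => x.unpair.1) := Primrec.fst.comp Primrec.unpair
    exact Primrec.ite (Primrec.eq.comp (Primrec.nat_mod.comp hu1 (Primrec.const 2)) (Primrec.const 0))
      (Primrec.nat_div.comp hu1 (Primrec.const 2)) (Primrec.const 0)
  refine (h.to_comp.comp re_computable).of_eq (fun q => ?_)
  rw [re_eq, Nat.unpair_pair, toNat_eq]

end RatComp

theorem primrec_pow : Primrec₂ (fun a b : ℕ => a ^ b) := by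
  have := Primrec.nat_iff.2 Nat.Primrec.pow
  refine (this.comp (Primrec₂.natPair.comp Primrec.fst Primrec.snd)).of_eq (fun p => ?_)
  simp [Nat.unpaired]

/-- Natural-number approximations of a nonnegative computable real. -/
theorem exists_nat_approx {s : ℝ} (hs : ComputableReal s) (h0 : 0 ≤ s) :
    ∃ g : ℕ → ℕ, Computable g ∧ ∀ N, |s * 2 ^ N - g N| < 2 := by
  obtain ⟨f, hf, hfs⟩ := hs
  have hp : Primrec (fun N : ℕ => 2 ^ N) := primrec_pow.comp (Primrec.const 2) Primrec.id
  have hf' : Computable (fun N => f (2 ^ N)) := hf.comp hp.to_comp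
  refine ⟨fun N => (f (2 ^ N)).num.toNat * 2 ^ N / (f (2 ^ N)).den, ?_, ?_⟩
  · exact Primrec.nat_div.to_comp.comp
      (Primrec.nat_mul.to_comp.comp (RatComp.num_computable.comp hf') hp.to_comp)
      (RatComp.den_computable.comp hf')
  · intro N
    have h := hfs (2 ^ N) (by positivity)
    set q := f (2 ^ N)
    have hP : (0:ℝ) < 2 ^ N := by positivity
    have h2 : |s * 2 ^ N - q * 2 ^ N| < 1 := by
      rw [← sub_mul, abs_mul, abs_of_pos hP]
      push_cast at h
      rwa [lt_div_iff₀ hP] at h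
    have hd : (0:ℝ) < q.den := by exact_mod_cast q.pos
    rw [abs_lt] at h2 ⊢
    dsimp only
    rcases le_or_gt 0 q.num with hn | hn
    · have hq : (q : ℝ) = (q.num.toNat : ℝ) / q.den := by
        have h1 : ((q.num.toNat : ℤ)) = q.num := Int.toNat_of_nonneg hn
        have h3 : ((q.num.toNat : ℝ)) = (q.num : ℝ) := by exact_mod_cast congrArg (Int.cast : ℤ → ℝ) h1
        rw [h3]; exact Rat.cast_def q
      have e1 : (q:ℝ) * 2 ^ N = ((q.num.toNat * 2 ^ N : ℕ) : ℝ) / q.den := by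
        rw [hq]; push_cast; ring
      have l1 : ((q.num.toNat * 2 ^ N / q.den : ℕ) : ℝ) ≤ (q:ℝ) * 2 ^ N := by
        rw [e1]; exact Nat.cast_div_le
      have l2 : (q:ℝ) * 2 ^ N < ((q.num.toNat * 2 ^ N / q.den : ℕ) : ℝ) + 1 := by
        rw [e1, div_lt_iff₀ hd]
        have := Nat.lt_div_mul_add (a := q.num.toNat * 2 ^ N) q.pos
        have h4 : q.num.toNat * 2 ^ N < (q.num.toNat * 2 ^ N / q.den + 1) * q.den := by
          rw [add_mul, one_mul]; exact this
        exact_mod_cast h4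
      constructor <;> linarith
    · have e0 : q.num.toNat = 0 := Int.toNat_of_nonpos hn.le
      rw [e0]
      have : (q:ℝ) * 2 ^ N ≤ 0 := by
        apply mul_nonpos_of_nonpos_of_nonneg _ hP.le
        exact_mod_cast (Rat.num_nonpos.1 hn.le)
      have : 0 ≤ s * 2 ^ N := by positivity
      simp
      constructor <;> linarith

/-- Uniformization of a computable relation. -/
theorem exists_selector {α β : Type} [Primcodable α] [Primcodable β] {R : α × β → Bool}
    (hR : Computable R) :
    ∃ φ : α →. β, Partrec φ ∧ (∀ a b, b ∈ φ a → R (a, b) = true) ∧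
      (∀ a b, R (a, b) = true → (φ a).Dom) := by
  let P : α → ℕ → Bool := fun a n => Option.casesOn (Encodable.decode (α := β) n) false (fun b => R (a, b))
  have hP : Computable₂ P := by
    have : Computable (fun p : α × ℕ => (Option.casesOn (Encodable.decode (α := β) p.2) false
        (fun b => R (p.1, b)) : Bool)) := by
      refine Computable.option_casesOn (o := fun p : α × ℕ => Encodable.decode (α := β) p.2)
        (f := fun _ => false) (g := fun p b => R (p.1, b)) ?_ (Computable.const _) ?_
      · exact Computable.decode.comp Computable.snd
      · exact hR.comp (Computable.pair (Computable.fst.comp Computable.fst) Computable.snd)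
    exact this
  let φ : α →. β := fun a => (Nat.rfind (P a)).bind (fun n => ((Encodable.decode (α := β) n : Option β) : Part β))
  refine ⟨φ, ?_, ?_, ?_⟩
  · refine Partrec.bind (Partrec.rfind hP.partrec₂) ?_
    exact Computable.ofOption (Computable.decode.comp Computable.snd)
  · intro a b hb
    obtain ⟨n, hn, hb⟩ := Part.mem_bind_iff.1 hb
    have h1 := Nat.rfind_spec hn
    simp only [Part.mem_ofOption, Option.mem_def] at hb
    simp [P, hb] at h1
    exact h1
  · intro a b h
    have hd : (Nat.rfind (P a)).Dom := by
      rw [Nat.rfind_dom]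
      refine ⟨Encodable.encode b, ?_, fun _ => trivial⟩
      simp [P, h]
    refine ⟨hd, ?_⟩
    have h1 := Nat.rfind_spec (Part.get_mem hd)
    dsimp only
    revert h1
    generalize (Nat.rfind (P a)).get hd = n
    intro h1
    cases hx : (Encodable.decode (α := β) n) with
    | none => simp [P, hx] at h1
    | some b' => trivial

theorem exists_stages (V : Computer) :
    ∃ (D : ℕ → List (List Bool)) (x : ℕ → List Bool), Computable D ∧ Computable x ∧
      (∀ k, (D k).Nodup) ∧ (∀ k, ∀ p ∈ D k, p ∈ V.f.Dom) ∧
      (∀ k k', k ≤ k' → ∀ p ∈ D k, p ∈ D k') ∧ (∀ p ∈ V.f.Dom, ∃ k, p ∈ D k) ∧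
      (∀ k, ∀ p ∈ D k, x k ∉ V.f p) := by
  obtain ⟨c, hc⟩ := Nat.Partrec.Code.exists_code.1 V.partrec
  have hev : Primrec (fun a : ℕ × ℕ => Nat.Partrec.Code.evaln a.1 c a.2) :=
    Nat.Partrec.Code.primrec_evaln.comp
      (Primrec.pair (Primrec.pair Primrec.fst (Primrec.const c)) Primrec.snd)
  let F : ℕ → ℕ → Option (List Bool) := fun k i =>
    (Encodable.decode (α := List Bool) i).bind
      (fun p => if Encodable.encode p = i ∧ (Nat.Partrec.Code.evaln k c i).isSome = true then some p else none)
  let G : ℕ → ℕ → Option (List Bool) := fun k i =>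
    (Nat.Partrec.Code.evaln k c i).bind (fun v => Encodable.decode (α := List Bool) v)
  have hF : Primrec₂ F := by
    refine Primrec.option_bind (Primrec.decode.comp Primrec.snd) ?_
    refine Primrec.ite (PrimrecPred.and ?_ ?_) (Primrec.option_some.comp Primrec.snd) (Primrec.const none)
    · exact Primrec.eq.comp (Primrec.encode.comp Primrec.snd) (Primrec.snd.comp Primrec.fst)
    · exact Primrec.eq.comp (Primrec.option_isSome.comp (hev.comp Primrec.fst)) (Primrec.const true)
  have hG : Primrec₂ G :=
    Primrec.option_bind hev (Primrec.decode.comp Primrec.snd)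
  have hFm : ∀ k i p, F k i = some p ↔ Encodable.encode p = i ∧
      (Nat.Partrec.Code.evaln k c i).isSome = true := by
    intro k i p
    simp only [F, Option.bind_eq_some_iff]
    constructor
    · rintro ⟨a, h1, h2⟩
      split_ifs at h2 with h3
      simp at h2; subst h2; exact h3
    · rintro ⟨rfl, h2⟩
      exact ⟨p, Encodable.encodek p, by simp [h2]⟩
  have heval : ∀ p v, v ∈ c.eval (Encodable.encode p) ↔ ∃ y ∈ V.f p, Encodable.encode y = v := by
    intro p v
    rw [hc]
    simp
  have hD : ∀ k p, p ∈ (List.range k).filterMap (F k) ↔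
      (Nat.Partrec.Code.evaln k c (Encodable.encode p)).isSome = true := by
    intro k p
    simp only [List.mem_filterMap, hFm, List.mem_range]
    constructor
    · rintro ⟨i, _, rfl, h⟩; exact h
    · intro h
      obtain ⟨v, hv⟩ := Option.isSome_iff_exists.1 h
      exact ⟨_, Nat.Partrec.Code.evaln_bound hv, rfl, h⟩
  refine ⟨fun k => (List.range k).filterMap (F k),
    fun k => ((List.range k).filterMap (G k)).flatten ++ [true], ?_, ?_, ?_, ?_, ?_, ?_, ?_⟩
  · exact (Primrec.listFilterMap Primrec.list_range hF).to_comp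
  · exact (Primrec.list_append.comp (Primrec.list_flatten.comp
      (Primrec.listFilterMap Primrec.list_range hG)) (Primrec.const [true])).to_comp
  · intro k
    refine List.Nodup.filterMap ?_ List.nodup_range
    intro i i' p h h'
    rw [Option.mem_def, hFm] at h h'
    rw [← h.1, ← h'.1]
  · intro k p hp
    rw [hD] at hp
    obtain ⟨v, hv⟩ := Option.isSome_iff_exists.1 hp
    obtain ⟨y, hy, _⟩ := (heval p v).1 (Nat.Partrec.Code.evaln_sound hv)
    exact (PFun.mem_dom _ _).2 ⟨y, hy⟩
  · intro k k' hk p hp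
    simp only [hD] at hp ⊢
    obtain ⟨v, hv⟩ := Option.isSome_iff_exists.1 hp
    exact Option.isSome_iff_exists.2 ⟨v, Nat.Partrec.Code.evaln_mono hk hv⟩
  · intro p hp
    obtain ⟨y, hy⟩ := (PFun.mem_dom _ _).1 hp
    have := (heval p _).2 ⟨y, hy, rfl⟩
    obtain ⟨k, hk⟩ := Nat.Partrec.Code.evaln_complete.1 this
    exact ⟨k, (hD k p).2 (Option.isSome_iff_exists.2 ⟨_, hk⟩)⟩
  · intro k p hp hx
    rw [hD] at hp
    obtain ⟨v, hv⟩ := Option.isSome_iff_exists.1 hp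
    obtain ⟨y, hy, he⟩ := (heval p v).1 (Nat.Partrec.Code.evaln_sound hv)
    have hyx := Part.mem_unique hy hx
    have hm : y ∈ (List.range k).filterMap (G k) := by
      rw [List.mem_filterMap]
      refine ⟨Encodable.encode p, List.mem_range.2 (Nat.Partrec.Code.evaln_bound hv), ?_⟩
      have hv' : Nat.Partrec.Code.evaln k c (Encodable.encode p) = some v := hv
      simp [G, hv', ← he]
    have hl := (List.sublist_flatten_of_mem hm).length_le
    have := congrArg List.length hyx
    simp at this
    simp at hl
    omega

/-- Kraft inequality for prefix-free finite sets. -/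
theorem kraft (A : Finset (List Bool)) (h : PrefixFree (A : Set (List Bool))) :
    ∑ p ∈ A, (2:ℝ)⁻¹ ^ p.length ≤ 1 := by
  by_cases he : [] ∈ A
  · have : A = {[]} := by
      ext q
      simp only [Finset.mem_singleton]
      constructor
      · intro hq; exact (h [] he q hq (List.nil_prefix)).symm
      · rintro rfl; exact he
    rw [this]; simp
  · have hu : InformationTheory.UniquelyDecodable (A : Set (List Bool)) := by
      intro l1
      induction l1 with
      | nil =>
        intro l2 _ h2 hf
        cases l2 with
        | nil => rfl
        | cons b l =>
          simp at hf
          have := h2 b (by simp)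
          rw [hf.1] at this
          exact absurd this he
      | cons a l ih =>
        intro l2 h1 h2 hf
        cases l2 with
        | nil =>
          simp at hf
          have := h1 a (by simp)
          rw [hf.1] at this
          exact absurd this he
        | cons b l' =>
          simp only [List.flatten_cons] at hf
          have ha := h1 a (by simp)
          have hb := h2 b (by simp)
          have hab : a = b := by
            rcases List.prefix_or_prefix_of_prefix (List.prefix_append a l.flatten)
              (hf ▸ List.prefix_append b l'.flatten) with h3 | h3
            · exact h a ha b hb h3
            · exact (h b hb a ha h3).symm
          subst hab
          rw [List.append_cancel_left_eq] at hf
          rw [ih l' (fun w hw => h1 w (by simp [hw])) (fun w hw => h2 w (by simp [hw])) hf]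
    have := InformationTheory.kraft_mcmillan_inequality hu
    simpa using this

noncomputable def bw (β : ℝ) (l : ℕ) : ℝ := (2:ℝ) ^ (-(β * l))
noncomputable def Zs (A : Finset (List Bool)) (β : ℝ) : ℝ := ∑ p ∈ A, bw β p.length
noncomputable def Ys (A : Finset (List Bool)) (β : ℝ) : ℝ := ∑ p ∈ A, (p.length : ℝ) * bw β p.length
noncomputable def Qs (A : Finset (List Bool)) (β : ℝ) : ℝ := ∑ p ∈ A, (p.length : ℝ) ^ 2 * bw β p.length
noncomputable def Ss (A : Finset (List Bool)) (β : ℝ) : ℝ :=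
  Real.logb 2 (Zs A β) + β * (Ys A β / Zs A β)

theorem bw_pos (β : ℝ) (l : ℕ) : 0 < bw β l := Real.rpow_pos_of_pos (by norm_num) _

theorem bw_one (l : ℕ) : bw 1 l = (2:ℝ)⁻¹ ^ l := by
  unfold bw
  rw [Real.rpow_neg (by norm_num), one_mul, Real.rpow_natCast, inv_pow]

theorem bw_anti {β β' : ℝ} (h : β' ≤ β) (l : ℕ) : bw β l ≤ bw β' l := by
  unfold bw
  apply Real.rpow_le_rpow_of_exponent_le (by norm_num)
  have : β' * l ≤ β * l := mul_le_mul_of_nonneg_right h (by positivity)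
  linarith

theorem bw_add (β γ : ℝ) (l : ℕ) : bw (β + γ) l = bw β l * bw γ l := by
  unfold bw
  rw [← Real.rpow_add (by norm_num)]
  congr 1; ring

theorem bw_le_one {β : ℝ} (h : 0 ≤ β) (l : ℕ) : bw β l ≤ 1 := by
  unfold bw
  apply Real.rpow_le_one_of_one_le_of_nonpos (by norm_num)
  have : 0 ≤ β * l := by positivity
  linarith

theorem Zs_pos {A : Finset (List Bool)} (hA : A.Nonempty) (β : ℝ) : 0 < Zs A β :=
  Finset.sum_pos (fun _ _ => bw_pos _ _) hA

theorem Ys_nonneg (A : Finset (List Bool)) (β : ℝ) : 0 ≤ Ys A β :=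
  Finset.sum_nonneg (fun _ _ => mul_nonneg (by positivity) (bw_pos _ _).le)

theorem bw_le_Zs {A : Finset (List Bool)} {p : List Bool} (hp : p ∈ A) (β : ℝ) :
    bw β p.length ≤ Zs A β :=
  Finset.single_le_sum (f := fun p : List Bool => bw β p.length) (fun _ _ => (bw_pos _ _).le) hp

theorem hasDerivAt_bw (β : ℝ) (l : ℕ) :
    HasDerivAt (fun β => bw β l) (-(Real.log 2 * l * bw β l)) β := by
  unfold bw
  have h : HasDerivAt (fun β : ℝ => -(β * (l:ℝ))) (-(1 * (l:ℝ))) β :=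
    ((hasDerivAt_id β).mul_const (l:ℝ)).neg
  have := h.const_rpow (a := 2) (by norm_num)
  convert this using 1
  ring

theorem hasDerivAt_Zs (A : Finset (List Bool)) (β : ℝ) :
    HasDerivAt (Zs A) (-(Real.log 2 * Ys A β)) β := by
  have : HasDerivAt (fun β => ∑ p ∈ A, bw β p.length)
      (∑ p ∈ A, -(Real.log 2 * p.length * bw β p.length)) β :=
    HasDerivAt.fun_sum (fun p _ => hasDerivAt_bw β p.length)
  refine this.congr_deriv ?_
  rw [Ys, Finset.mul_sum, ← Finset.sum_neg_distrib]
  exact Finset.sum_congr rfl (fun _ _ => by ring)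

theorem hasDerivAt_Ys (A : Finset (List Bool)) (β : ℝ) :
    HasDerivAt (Ys A) (-(Real.log 2 * Qs A β)) β := by
  have : HasDerivAt (fun β => ∑ p ∈ A, (p.length:ℝ) * bw β p.length)
      (∑ p ∈ A, (p.length:ℝ) * -(Real.log 2 * p.length * bw β p.length)) β :=
    HasDerivAt.fun_sum (fun p _ => (hasDerivAt_bw β p.length).const_mul _)
  refine this.congr_deriv ?_
  rw [Qs, Finset.mul_sum, ← Finset.sum_neg_distrib]
  exact Finset.sum_congr rfl (fun _ _ => by ring)

noncomputable def Var (A : Finset (List Bool)) (β : ℝ) : ℝ := Qs A β / Zs A β - (Ys A β / Zs A β) ^ 2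

theorem hasDerivAt_Ss {A : Finset (List Bool)} (hA : A.Nonempty) (β : ℝ) :
    HasDerivAt (Ss A) (-(β * Real.log 2 * Var A β)) β := by
  have hz := Zs_pos hA β
  have hl : Real.log 2 ≠ 0 := (Real.log_pos (by norm_num)).ne'
  have h1 : HasDerivAt (fun β => Real.logb 2 (Zs A β))
      (-(Real.log 2 * Ys A β) / Zs A β / Real.log 2) β :=
    ((hasDerivAt_Zs A β).log hz.ne').div_const _
  have h2 := (hasDerivAt_id β).mul ((hasDerivAt_Ys A β).div (hasDerivAt_Zs A β) hz.ne')
  have := h1.add h2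
  refine HasDerivAt.congr_deriv this ?_
  unfold Var
  simp only [id, Pi.div_apply]
  field_simp
  ring

theorem Var_eq {A : Finset (List Bool)} (hA : A.Nonempty) (β : ℝ) :
    Zs A β * Var A β = ∑ p ∈ A, ((p.length : ℝ) - Ys A β / Zs A β) ^ 2 * bw β p.length := by
  have hz := (Zs_pos hA β).ne'
  set μ := Ys A β / Zs A β with hμ
  have hY : Ys A β = μ * Zs A β := by rw [hμ]; field_simp
  have : ∑ p ∈ A, ((p.length : ℝ) - μ) ^ 2 * bw β p.length
      = Qs A β - 2 * μ * Ys A β + μ ^ 2 * Zs A β := by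
    unfold Qs Ys Zs
    rw [Finset.mul_sum, Finset.mul_sum, ← Finset.sum_sub_distrib, ← Finset.sum_add_distrib]
    exact Finset.sum_congr rfl (fun _ _ => by ring)
  rw [this, hY]
  unfold Var
  rw [← hμ]
  field_simp
  ring

theorem Var_nonneg {A : Finset (List Bool)} (hA : A.Nonempty) (β : ℝ) : 0 ≤ Var A β := by
  have h := Var_eq hA β
  have h2 : 0 ≤ Zs A β * Var A β := by
    rw [h]; exact Finset.sum_nonneg (fun _ _ => mul_nonneg (sq_nonneg _) (bw_pos _ _).le)
  exact nonneg_of_mul_nonneg_right h2 (Zs_pos hA β)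

theorem Var_lower {A : Finset (List Bool)} {p q : List Bool} (hp : p ∈ A) (hq : q ∈ A)
    (hpq : p.length ≠ q.length) {β m : ℝ} (hmp : m ≤ bw β p.length) (hmq : m ≤ bw β q.length)
    (hm : 0 ≤ m) : m / 2 ≤ Zs A β * Var A β := by
  have hA : A.Nonempty := ⟨p, hp⟩
  rw [Var_eq hA]
  set μ := Ys A β / Zs A β
  have hne : p ≠ q := fun h => hpq (by rw [h])
  have h1 : ∑ r ∈ ({p, q} : Finset (List Bool)), ((r.length : ℝ) - μ) ^ 2 * bw β r.length
      ≤ ∑ r ∈ A, ((r.length : ℝ) - μ) ^ 2 * bw β r.length := by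
    apply Finset.sum_le_sum_of_subset_of_nonneg
    · intro r hr; simp at hr; rcases hr with rfl | rfl <;> assumption
    · intro r _ _; exact mul_nonneg (sq_nonneg _) (bw_pos _ _).le
  rw [Finset.sum_pair hne] at h1
  refine le_trans ?_ h1
  have h2 : (1:ℝ) ≤ ((p.length:ℝ) - q.length) ^ 2 := by
    rw [one_le_sq_iff_one_le_abs]
    have : (1:ℤ) ≤ |(p.length:ℤ) - q.length| := by
      apply Int.one_le_abs; omega
    exact_mod_cast this
  have h3 : ((p.length:ℝ) - μ) ^ 2 * m ≤ ((p.length:ℝ) - μ) ^ 2 * bw β p.length := by gcongr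
  have h4 : ((q.length:ℝ) - μ) ^ 2 * m ≤ ((q.length:ℝ) - μ) ^ 2 * bw β q.length := by gcongr
  have h5 : (1:ℝ)/2 ≤ ((p.length:ℝ) - μ) ^ 2 + ((q.length:ℝ) - μ) ^ 2 := by
    nlinarith [sq_nonneg (((p.length:ℝ) - μ) + ((q.length:ℝ) - μ))]
  nlinarith

theorem Ss_antitone {A : Finset (List Bool)} (hA : A.Nonempty) : AntitoneOn (Ss A) (Set.Ioi 0) := by
  apply antitoneOn_of_deriv_nonpos (convex_Ioi 0)
  · exact fun x _ => (hasDerivAt_Ss hA x).continuousAt.continuousWithinAt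
  · exact fun x _ => (hasDerivAt_Ss hA x).differentiableAt.differentiableWithinAt
  · intro x hx
    rw [interior_Ioi] at hx
    rw [(hasDerivAt_Ss hA x).deriv]
    have := mul_nonneg (mul_nonneg (le_of_lt hx) (Real.log_pos (by norm_num : (1:ℝ) < 2)).le) (Var_nonneg hA x)
    linarith

theorem Ss_strictAnti {A : Finset (List Bool)} {p q : List Bool} (hp : p ∈ A) (hq : q ∈ A)
    (hpq : p.length ≠ q.length) : StrictAntiOn (Ss A) (Set.Ioi 0) := by
  have hA : A.Nonempty := ⟨p, hp⟩
  apply strictAntiOn_of_deriv_neg (convex_Ioi 0)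
  · exact fun x _ => (hasDerivAt_Ss hA x).continuousAt.continuousWithinAt
  · intro x hx
    rw [interior_Ioi] at hx
    rw [(hasDerivAt_Ss hA x).deriv]
    have h1 := Var_lower hp hq hpq (min_le_left (bw x p.length) (bw x q.length)) (min_le_right _ _)
      (le_min (bw_pos _ _).le (bw_pos _ _).le)
    have h2 : 0 < min (bw x p.length) (bw x q.length) := lt_min (bw_pos _ _) (bw_pos _ _)
    have h3 : 0 < Var A x := pos_of_mul_pos_right (a := Zs A x) (by linarith) (Zs_pos hA x).le
    have := mul_pos (mul_pos hx (Real.log_pos (by norm_num : (1:ℝ) < 2))) h3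
    linarith

theorem exists_poly_bound {δ : ℝ} (hδ : 0 < δ) :
    ∃ C : ℝ, 0 < C ∧ ∀ l : ℕ, (l:ℝ) ^ 2 * bw δ l ≤ C := by
  have h := tendsto_pow_const_mul_const_pow_of_abs_lt_one 2 (r := (2:ℝ) ^ (-δ))
    (by rw [abs_of_pos (by positivity)]; exact Real.rpow_lt_one_of_one_lt_of_neg (by norm_num) (by linarith))
  obtain ⟨C, hC⟩ := h.bddAbove_range
  refine ⟨max C 1, by positivity, fun l => le_trans ?_ (le_max_left _ _)⟩
  have := hC ⟨l, rfl⟩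
  convert this using 2
  unfold bw
  rw [← Real.rpow_natCast, ← Real.rpow_mul (by norm_num)]
  congr 1; ring

def Kr (A : Finset (List Bool)) : Prop := ∑ p ∈ A, (2:ℝ)⁻¹ ^ p.length ≤ 1

theorem Zs_le_one {A : Finset (List Bool)} (hA : Kr A) {β : ℝ} (hβ : 1 ≤ β) : Zs A β ≤ 1 := by
  refine le_trans (Finset.sum_le_sum fun p _ => ?_) hA
  rw [← bw_one]; exact bw_anti hβ _

theorem nat_le_sq (l : ℕ) : (l:ℝ) ≤ (l:ℝ) ^ 2 := by
  exact_mod_cast Nat.le_self_pow (by norm_num) l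

/-- Uniform bound for second moments. -/
theorem Qs_bound {β₀ : ℝ} (h : 1 < β₀) :
    ∃ C : ℝ, 0 < C ∧ ∀ A, Kr A → ∀ β, β₀ ≤ β → Qs A β ≤ C := by
  obtain ⟨C, hC, hb⟩ := exists_poly_bound (sub_pos.2 h)
  refine ⟨C, hC, fun A hA β hβ => ?_⟩
  calc Qs A β ≤ ∑ p ∈ A, C * (2:ℝ)⁻¹ ^ p.length := by
        refine Finset.sum_le_sum fun p _ => ?_
        have h1 : bw β p.length ≤ bw (β₀ - 1) p.length * (2:ℝ)⁻¹ ^ p.length := by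
          rw [← bw_one, ← bw_add]; exact bw_anti (by linarith) _
        calc (p.length:ℝ) ^ 2 * bw β p.length
            ≤ (p.length:ℝ) ^ 2 * (bw (β₀ - 1) p.length * (2:ℝ)⁻¹ ^ p.length) := by gcongr
          _ = ((p.length:ℝ) ^ 2 * bw (β₀ - 1) p.length) * (2:ℝ)⁻¹ ^ p.length := by ring
          _ ≤ _ := by
            apply mul_le_mul_of_nonneg_right (hb _) (by positivity)
    _ = C * ∑ p ∈ A, (2:ℝ)⁻¹ ^ p.length := by rw [Finset.mul_sum]
    _ ≤ C * 1 := by apply mul_le_mul_of_nonneg_left hA hC.le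
    _ = C := mul_one C

theorem Ys_le_Qs (A : Finset (List Bool)) (β : ℝ) : Ys A β ≤ Qs A β :=
  Finset.sum_le_sum fun p _ => mul_le_mul_of_nonneg_right (nat_le_sq _) (bw_pos _ _).le

/-- Temperature dependence. -/
theorem Ss_lip {p q : List Bool} (hpq : p.length ≠ q.length) {β₀ β₁ : ℝ} (h0 : 1 < β₀) (h1 : β₀ ≤ β₁) :
    ∃ c₁ c₂ : ℝ, 0 < c₁ ∧ 0 < c₂ ∧ ∀ A, Kr A → p ∈ A → q ∈ A → ∀ β ∈ Set.Icc β₀ β₁,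
      c₁ * (β₁ - β) ≤ Ss A β - Ss A β₁ ∧ Ss A β - Ss A β₁ ≤ c₂ * (β₁ - β) := by
  obtain ⟨C, hC, hb⟩ := Qs_bound h0
  set m := min (bw β₁ p.length) (bw β₁ q.length) with hm
  have hm0 : 0 < m := lt_min (bw_pos _ _) (bw_pos _ _)
  have hl : 0 < Real.log 2 := Real.log_pos (by norm_num)
  have hβ₀ : 0 < β₀ := by linarith
  have hβ₁ : 0 < β₁ := by linarith
  refine ⟨β₀ * Real.log 2 * (m / 2), β₁ * Real.log 2 * (C / m), by positivity, by positivity, ?_⟩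
  intro A hA hp hq β hβ
  have hAn : A.Nonempty := ⟨p, hp⟩
  have hmp : ∀ x ≤ β₁, m ≤ bw x p.length := fun x hx => (min_le_left _ _).trans (bw_anti hx _)
  have hmq : ∀ x ≤ β₁, m ≤ bw x q.length := fun x hx => (min_le_right _ _).trans (bw_anti hx _)
  have hder : ∀ x ∈ Set.Icc β₀ β₁, m / 2 ≤ Var A x ∧ Var A x ≤ C / m := by
    intro x hx
    have hz := Zs_pos hAn x
    have hz1 := Zs_le_one hA (h0.le.trans hx.1)
    have hV := Var_nonneg hAn x
    constructor
    · have := Var_lower hp hq hpq (hmp x hx.2) (hmq x hx.2) hm0.le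
      nlinarith
    · have h3 : Var A x ≤ Qs A x / Zs A x := by
        unfold Var; have := sq_nonneg (Ys A x / Zs A x); linarith
      refine h3.trans ?_
      have h4 := hb A hA x hx.1
      have h5 : m ≤ Zs A x := (hmp x hx.2).trans (bw_le_Zs hp x)
      exact div_le_div₀ hC.le h4 hm0 h5
  have hcont : ContinuousOn (Ss A) (Set.Icc β₀ β₁) :=
    fun x _ => (hasDerivAt_Ss hAn x).continuousAt.continuousWithinAt
  have hdiff : DifferentiableOn ℝ (Ss A) (interior (Set.Icc β₀ β₁)) :=
    fun x _ => (hasDerivAt_Ss hAn x).differentiableAt.differentiableWithinAt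
  constructor
  · have := (convex_Icc β₀ β₁).image_sub_le_mul_sub_of_deriv_le (C := -(β₀ * Real.log 2 * (m / 2)))
      hcont hdiff (fun x hx => by
        have hx' := interior_subset hx
        rw [(hasDerivAt_Ss hAn x).deriv]
        obtain ⟨a1, a2⟩ := hder x hx'
        have : β₀ * Real.log 2 * (m / 2) ≤ x * Real.log 2 * Var A x := by
          have := hx'.1
          have hx0 : 0 < x := by linarith
          gcongr
        linarith) β hβ β₁ ⟨h1, le_rfl⟩ hβ.2
    linarith
  · have := (convex_Icc β₀ β₁).mul_sub_le_image_sub_of_le_deriv (C := -(β₁ * Real.log 2 * (C / m)))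
      hcont hdiff (fun x hx => by
        have hx' := interior_subset hx
        rw [(hasDerivAt_Ss hAn x).deriv]
        obtain ⟨a1, a2⟩ := hder x hx'
        have : x * Real.log 2 * Var A x ≤ β₁ * Real.log 2 * (C / m) := by
          have := hx'.2
          have hx0 : 0 < x := by linarith [hx'.1]
          have := Var_nonneg hAn x
          gcongr
        linarith) β hβ β₁ ⟨h1, le_rfl⟩ hβ.2
    linarith

/-- Effect of adding states. -/
theorem Ss_add {p : List Bool} {β : ℝ} (hβ : 1 < β) :
    ∃ (c₃ c₄ : ℝ) (M : ℕ), 0 < c₃ ∧ 0 < c₄ ∧ ∀ A B : Finset (List Bool), A ⊆ B → Kr B → p ∈ A →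
      (∀ r ∈ B \ A, M ≤ r.length) →
      c₃ * Ys (B \ A) β ≤ Ss B β - Ss A β ∧ Ss B β - Ss A β ≤ c₄ * Ys (B \ A) β := by
  obtain ⟨C, hC, hb⟩ := Qs_bound hβ
  set w := bw β p.length with hw
  have hw0 : 0 < w := bw_pos _ _
  obtain ⟨M, hM⟩ := exists_nat_ge (2 * (C / w) + 1)
  have hl : 0 < Real.log 2 := Real.log_pos (by norm_num)
  refine ⟨β / 2, 1 / w / Real.log 2 + β / w, M, by positivity, by positivity, ?_⟩
  intro A B hAB hB hp hlen
  have hAn : A.Nonempty := ⟨p, hp⟩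
  have hA : Kr A := le_trans (Finset.sum_le_sum_of_subset_of_nonneg hAB (fun _ _ _ => by positivity)) hB
  have hZ : Zs B β = Zs A β + Zs (B \ A) β := by
    unfold Zs; rw [add_comm]; exact (Finset.sum_sdiff hAB).symm
  have hY : Ys B β = Ys A β + Ys (B \ A) β := by
    unfold Ys; rw [add_comm]; exact (Finset.sum_sdiff hAB).symm
  have hz := Zs_pos hAn β
  have hzB : Zs B β ≤ 1 := Zs_le_one hB hβ.le
  have hwz : w ≤ Zs A β := bw_le_Zs hp β
  set z := Zs A β
  set y := Ys A β
  set dz := Zs (B \ A) β with hdz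
  set dy := Ys (B \ A) β with hdy
  have hdz0 : 0 ≤ dz := Finset.sum_nonneg (fun _ _ => (bw_pos _ _).le)
  have hdy0 : 0 ≤ dy := Ys_nonneg _ _
  have hy0 : 0 ≤ y := Ys_nonneg _ _
  have hE : y / z ≤ C / w := by
    exact div_le_div₀ hC.le ((Ys_le_Qs A β).trans (hb A hA β le_rfl)) hw0 hwz
  have hMdz : (M:ℝ) * dz ≤ dy := by
    rw [hdz, hdy, Zs, Ys, Finset.mul_sum]
    refine Finset.sum_le_sum fun r hr => ?_
    apply mul_le_mul_of_nonneg_right _ (bw_pos _ _).le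
    exact_mod_cast hlen r hr
  have hCw : 0 < C / w := by positivity
  have hdzdy : dz ≤ dy := by nlinarith
  have hEdz : y / z * dz ≤ dy / 2 := by nlinarith
  have hdiff : Ss B β - Ss A β = Real.logb 2 (1 + dz / z) + β * ((dy - y / z * dz) / (z + dz)) := by
    unfold Ss
    rw [hZ, hY]
    have e1 : z + dz = z * (1 + dz / z) := by field_simp
    have hpos : 0 < 1 + dz / z := by positivity
    have e2 : Real.logb 2 (z + dz) = Real.logb 2 z + Real.logb 2 (1 + dz / z) := by
      rw [e1, Real.logb_mul hz.ne' hpos.ne']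
    change Real.logb 2 (z + dz) + β * ((y + dy) / (z + dz)) - (Real.logb 2 z + β * (y / z)) = _
    rw [e2]
    have : z + dz ≠ 0 := by positivity
    field_simp
    ring
  rw [hdiff]
  have hlog0 : 0 ≤ Real.logb 2 (1 + dz / z) := by
    apply Real.logb_nonneg (by norm_num)
    have : 0 ≤ dz / z := by positivity
    linarith
  constructor
  · have h1 : dy / 2 ≤ (dy - y / z * dz) / (z + dz) := by
      rw [le_div_iff₀ (by positivity)]
      have : z + dz ≤ 1 := by rw [← hZ]; exact hzB
      nlinarith
    have : β * (dy / 2) ≤ β * ((dy - y / z * dz) / (z + dz)) := by gcongr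
    linarith
  · have h1 : (dy - y / z * dz) / (z + dz) ≤ dy / w := by
      apply div_le_div₀ hdy0 _ hw0 (by linarith)
      have : 0 ≤ y / z * dz := by positivity
      linarith
    have h2 : Real.logb 2 (1 + dz / z) ≤ dy / w / Real.log 2 := by
      unfold Real.logb
      have h3 : Real.log (1 + dz / z) ≤ dz / z := by
        have := Real.log_le_sub_one_of_pos (show 0 < 1 + dz / z by positivity)
        linarith
      have h4 : dz / z ≤ dy / w := div_le_div₀ hdy0 hdzdy hw0 hwz
      gcongr
      linarith
    have h5 : β * ((dy - y / z * dz) / (z + dz)) ≤ β * (dy / w) := by gcongr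
    calc _ ≤ dy / w / Real.log 2 + β * (dy / w) := by linarith
      _ = _ := by ring

theorem Ss_nonneg {A : Finset (List Bool)} (hA : A.Nonempty) (β : ℝ) : 0 ≤ Ss A β := by
  have hz := Zs_pos hA β
  have h : 0 ≤ ∑ p ∈ A, bw β p.length * (Real.logb 2 (Zs A β) + β * p.length) := by
    refine Finset.sum_nonneg fun p hp => mul_nonneg (bw_pos _ _).le ?_
    have h1 := Real.logb_le_logb_of_le (by norm_num : (1:ℝ) < 2) (bw_pos _ _) (bw_le_Zs hp β)
    unfold bw at h1
    rw [Real.logb_rpow (by norm_num) (by norm_num)] at h1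
    linarith
  have e : ∑ p ∈ A, bw β p.length * (Real.logb 2 (Zs A β) + β * p.length) = Zs A β * Ss A β := by
    have : Zs A β * Ss A β = Zs A β * Real.logb 2 (Zs A β) + β * Ys A β := by
      unfold Ss; field_simp
    rw [this]
    simp only [mul_add, Finset.sum_add_distrib]
    rw [← Finset.sum_mul]
    congr 1
    rw [Ys, Finset.mul_sum]
    exact Finset.sum_congr rfl fun _ _ => by ring
  rw [e] at h
  exact nonneg_of_mul_nonneg_right h hz

theorem boltzmann_eq (T : ℝ) (p : List Bool) : boltzmann T p = bw (1 / T) p.length := by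
  unfold boltzmann bw
  congr 1; ring

theorem Kr_of_dom (V : Computer) (A : Finset (List Bool)) (hA : ∀ p ∈ A, p ∈ V.f.Dom) : Kr A :=
  kraft A (fun p hp q hq h => V.dom_prefixFree p (hA p hp) q (hA q hq) h)

theorem tendsto_sum_stages (V : Computer) (D : ℕ → Finset (List Bool))
    (hsub : ∀ k, ∀ p ∈ D k, p ∈ V.f.Dom) (hmono : Monotone D)
    (hex : ∀ p ∈ V.f.Dom, ∃ k, p ∈ D k) (F : List Bool → ℝ) (hF : ∀ p, 0 ≤ F p)
    (C : ℝ) (hC : ∀ A : Finset (List Bool), Kr A → ∑ p ∈ A, F p ≤ C) :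
    Tendsto (fun k => ∑ p ∈ D k, F p) atTop (𝓝 (∑' p : V.f.Dom, F p.1)) := by
  classical
  have hs : Summable (fun p : V.f.Dom => F p.1) := by
    refine summable_of_sum_le (c := C) (fun p => hF _) (fun u => ?_)
    have := hC (u.map (Function.Embedding.subtype _)) (Kr_of_dom V _ (by
      intro p hp; simp only [Finset.mem_map, Function.Embedding.coe_subtype] at hp
      obtain ⟨a, _, rfl⟩ := hp; exact a.2))
    simpa using this
  let D' : ℕ → Finset V.f.Dom := fun k => (D k).subtype (fun p => p ∈ V.f.Dom)
  have hD' : Tendsto D' atTop atTop := by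
    apply tendsto_atTop_finset_of_monotone
    · intro a b hab p hp
      simp only [D', Finset.mem_subtype] at hp ⊢
      exact hmono hab hp
    · intro p
      obtain ⟨k, hk⟩ := hex p.1 p.2
      exact ⟨k, by simpa only [D', Finset.mem_subtype] using hk⟩
  have := hs.hasSum.comp hD'
  refine this.congr (fun k => ?_)
  simp only [Function.comp, D']
  exact Finset.sum_subtype_of_mem F (fun p hp => hsub k p hp)

theorem tendsto_Ss (V : Computer) (D : ℕ → Finset (List Bool))
    (hsub : ∀ k, ∀ p ∈ D k, p ∈ V.f.Dom) (hmono : Monotone D)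
    (hex : ∀ p ∈ V.f.Dom, ∃ k, p ∈ D k) {T : ℝ} (hT : T ∈ Set.Ioo (0:ℝ) 1) :
    Tendsto (fun k => Ss (D k) (1 / T)) atTop (𝓝 (Sfun V T)) := by
  obtain ⟨hT0, hT1⟩ := hT
  have hβ : 1 < 1 / T := by rw [lt_div_iff₀ hT0]; linarith
  obtain ⟨C, hC, hb⟩ := Qs_bound hβ
  have hZ : Tendsto (fun k => Zs (D k) (1 / T)) atTop (𝓝 (Zfun V T)) := by
    have := tendsto_sum_stages V D hsub hmono hex (fun p => boltzmann T p)
      (fun p => by rw [boltzmann_eq]; exact (bw_pos _ _).le) 1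
      (fun A hA => by simp only [boltzmann_eq]; exact Zs_le_one hA hβ.le)
    refine this.congr fun k => ?_
    simp only [boltzmann_eq]; rfl
  have hY : Tendsto (fun k => Ys (D k) (1 / T)) atTop (𝓝 (∑' p : V.f.Dom, (p.1.length : ℝ) * boltzmann T p.1)) := by
    have := tendsto_sum_stages V D hsub hmono hex (fun p => (p.length:ℝ) * boltzmann T p)
      (fun p => by rw [boltzmann_eq]; exact mul_nonneg (by positivity) (bw_pos _ _).le) C
      (fun A hA => by simp only [boltzmann_eq]; exact (Ys_le_Qs A _).trans (hb A hA _ le_rfl))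
    refine this.congr fun k => ?_
    simp only [boltzmann_eq]; rfl
  have hZpos : 0 < Zfun V T := by
    obtain ⟨p, hp⟩ := V.dom_nonempty
    obtain ⟨k, hk⟩ := hex p hp
    have h1 : bw (1 / T) p.length ≤ Zfun V T := by
      refine ge_of_tendsto hZ ?_
      filter_upwards [eventually_ge_atTop k] with k' hk'
      exact bw_le_Zs (hmono hk' hk) _
    exact (bw_pos _ _).trans_le h1
  have h1 := (Real.continuousAt_log hZpos.ne').tendsto.comp hZ
  have h2 := (h1.div_const (Real.log 2)).add ((hY.div hZ hZpos.ne').const_mul (1 / T))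
  have e : Sfun V T = Real.log (Zfun V T) / Real.log 2 +
      1 / T * ((∑' p : V.f.Dom, (p.1.length : ℝ) * boltzmann T p.1) / Zfun V T) := by
    unfold Sfun Efun Ffun Real.logb
    field_simp
    ring
  rw [e]
  exact h2.congr fun k => rfl

def ufun (l a j N : ℕ) : ℕ := Nat.findGreatest (fun u => u ^ j * 2 ^ (l * a) ≤ 2 ^ (N * j)) (2 ^ N)

theorem ufun_spec (l a : ℕ) {j : ℕ} (N : ℕ) (hj : 0 < j) :
    (ufun l a j N : ℝ) ≤ 2 ^ N * bw (a / j) l ∧ 2 ^ N * bw (a / j) l < ufun l a j N + 1 := by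
  have hjR : (0:ℝ) < j := by exact_mod_cast hj
  have key : ∀ u : ℕ, u ^ j * 2 ^ (l * a) ≤ 2 ^ (N * j) ↔ (u:ℝ) ≤ 2 ^ N * bw (a / j) l := by
    intro u
    have hb : 0 ≤ (2:ℝ) ^ N * bw (a / j) l := mul_nonneg (by positivity) (bw_pos _ _).le
    have h1 : (2 ^ N * bw (a / j) l) ^ j * (2:ℝ) ^ (l * a) = 2 ^ (N * j) := by
      have : bw (a / j) l ^ j * (2:ℝ) ^ (l * a) = 1 := by
        unfold bw
        rw [← Real.rpow_natCast, ← Real.rpow_mul (by norm_num), ← Real.rpow_natCast,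
          ← Real.rpow_add (by norm_num)]
        have : -((a:ℝ) / j * l) * j + ((l * a : ℕ) : ℝ) = 0 := by
          push_cast; field_simp; ring
        rw [this, Real.rpow_zero]
      rw [mul_pow, mul_assoc, this, mul_one, pow_mul]
    rw [← pow_le_pow_iff_left₀ (by positivity) hb hj.ne',
      ← mul_le_mul_iff_left₀ (show (0:ℝ) < 2 ^ (l * a) by positivity), h1]
    exact_mod_cast Iff.rfl
  constructor
  · rw [← key]
    exact Nat.findGreatest_spec (P := fun u => u ^ j * 2 ^ (l * a) ≤ 2 ^ (N * j)) (Nat.zero_le _)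
      (by simp [hj.ne'])
  · by_contra hcon
    rw [not_lt] at hcon
    have h2 : ((ufun l a j N + 1 : ℕ) : ℝ) ≤ 2 ^ N * bw (a / j) l := by push_cast; exact hcon
    have h3 : (ufun l a j N + 1 : ℕ) ≤ 2 ^ N := by
      have : ((ufun l a j N + 1 : ℕ) : ℝ) ≤ ((2 ^ N : ℕ) : ℝ) := by
        push_cast
        push_cast at h2
        refine h2.trans ?_
        have := bw_le_one (show (0:ℝ) ≤ a / j by positivity) l
        have h4 : (0:ℝ) < 2 ^ N := by positivity
        nlinarith
      exact_mod_cast this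
    have := Nat.le_findGreatest (P := fun u => u ^ j * 2 ^ (l * a) ≤ 2 ^ (N * j)) h3 ((key _).2 h2)
    have h5 : ufun l a j N + 1 ≤ ufun l a j N := this
    omega

def ZL (L : List ℕ) (a j N : ℕ) : ℕ := (L.map (fun l => ufun l a j N)).sum
def YL (L : List ℕ) (a j N : ℕ) : ℕ := (L.map (fun l => l * ufun l a j N)).sum

/-- certifies `s < S` -/
def test1 (L : List ℕ) (a j N g : ℕ) : Bool :=
  decide (2 ^ (N * (j * (ZL L a j N + L.length)) * 2 ^ N + (g + 2) * (j * (ZL L a j N + L.length))) <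
    ZL L a j N ^ (j * (ZL L a j N + L.length) * 2 ^ N) * 2 ^ (a * YL L a j N * 2 ^ N))

/-- certifies `S < s` -/
def test2 (L : List ℕ) (a j N g : ℕ) : Bool :=
  decide (0 < ZL L a j N ∧
    (ZL L a j N + L.length) ^ (j * ZL L a j N * 2 ^ N) *
      2 ^ (a * (YL L a j N + L.sum) * 2 ^ N + 2 * (j * ZL L a j N)) <
    2 ^ (N * (j * ZL L a j N) * 2 ^ N + g * (j * ZL L a j N)))

theorem list_sum_primrec : Primrec (List.sum : List ℕ → ℕ) := by
  refine (Primrec.list_foldr (f := fun l : List ℕ => l) (g := fun _ => 0)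
    (h := fun _ p => p.1 + p.2) Primrec.id (Primrec.const 0)
    (Primrec.nat_add.comp (Primrec.fst.comp Primrec.snd) (Primrec.snd.comp Primrec.snd))).of_eq ?_
  intro l
  induction l with
  | nil => rfl
  | cons a l ih => simp at ih ⊢; omega

section
variable {α : Type} [Primcodable α]

theorem ufun_primrec {l a j N : α → ℕ} (hl : Primrec l) (ha : Primrec a) (hj : Primrec j)
    (hN : Primrec N) : Primrec (fun x => ufun (l x) (a x) (j x) (N x)) := by
  unfold ufun
  refine Primrec.nat_findGreatest (primrec_pow.comp (Primrec.const 2) hN) ?_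
  have s : ∀ {f : α → ℕ}, Primrec f → Primrec (fun p : α × ℕ => f p.1) := fun h => h.comp Primrec.fst
  exact Primrec.nat_le.comp
    (Primrec.nat_mul.comp (primrec_pow.comp Primrec.snd (s hj))
      (primrec_pow.comp (Primrec.const 2) (Primrec.nat_mul.comp (s hl) (s ha))))
    (primrec_pow.comp (Primrec.const 2) (Primrec.nat_mul.comp (s hN) (s hj)))

theorem ZL_primrec {L : α → List ℕ} {a j N : α → ℕ} (hL : Primrec L) (ha : Primrec a) (hj : Primrec j)
    (hN : Primrec N) : Primrec (fun x => ZL (L x) (a x) (j x) (N x)) := by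
  unfold ZL
  refine list_sum_primrec.comp (Primrec.list_map hL ?_)
  exact ufun_primrec Primrec.snd (ha.comp Primrec.fst) (hj.comp Primrec.fst) (hN.comp Primrec.fst)

theorem YL_primrec {L : α → List ℕ} {a j N : α → ℕ} (hL : Primrec L) (ha : Primrec a) (hj : Primrec j)
    (hN : Primrec N) : Primrec (fun x => YL (L x) (a x) (j x) (N x)) := by
  unfold YL
  refine list_sum_primrec.comp (Primrec.list_map hL ?_)
  exact Primrec.nat_mul.comp Primrec.snd
    (ufun_primrec Primrec.snd (ha.comp Primrec.fst) (hj.comp Primrec.fst) (hN.comp Primrec.fst))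

theorem test1_primrec {L : α → List ℕ} {a j N g : α → ℕ} (hL : Primrec L) (ha : Primrec a)
    (hj : Primrec j) (hN : Primrec N) (hg : Primrec g) :
    Primrec (fun x => test1 (L x) (a x) (j x) (N x) (g x)) := by
  unfold test1
  have hZ := ZL_primrec hL ha hj hN
  have hY := YL_primrec hL ha hj hN
  have h2 : Primrec (fun x => 2 ^ N x) := primrec_pow.comp (Primrec.const 2) hN
  have hD : Primrec (fun x => j x * (ZL (L x) (a x) (j x) (N x) + (L x).length)) :=
    Primrec.nat_mul.comp hj (Primrec.nat_add.comp hZ (Primrec.list_length.comp hL))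
  exact (Primrec.nat_lt.comp
    (primrec_pow.comp (Primrec.const 2) (Primrec.nat_add.comp
      (Primrec.nat_mul.comp (Primrec.nat_mul.comp hN hD) h2)
      (Primrec.nat_mul.comp (Primrec.nat_add.comp hg (Primrec.const 2)) hD)))
    (Primrec.nat_mul.comp (primrec_pow.comp hZ (Primrec.nat_mul.comp hD h2))
      (primrec_pow.comp (Primrec.const 2) (Primrec.nat_mul.comp (Primrec.nat_mul.comp ha hY) h2)))).decide

theorem test2_primrec {L : α → List ℕ} {a j N g : α → ℕ} (hL : Primrec L) (ha : Primrec a)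
    (hj : Primrec j) (hN : Primrec N) (hg : Primrec g) :
    Primrec (fun x => test2 (L x) (a x) (j x) (N x) (g x)) := by
  unfold test2
  have hZ := ZL_primrec hL ha hj hN
  have hY := YL_primrec hL ha hj hN
  have h2 : Primrec (fun x => 2 ^ N x) := primrec_pow.comp (Primrec.const 2) hN
  have hD : Primrec (fun x => j x * ZL (L x) (a x) (j x) (N x)) :=
    Primrec.nat_mul.comp hj hZ
  refine PrimrecPred.decide (PrimrecPred.and (Primrec.nat_lt.comp (Primrec.const 0) hZ)
    (Primrec.nat_lt.comp ?_ ?_))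
  · exact Primrec.nat_mul.comp
      (primrec_pow.comp (Primrec.nat_add.comp hZ (Primrec.list_length.comp hL)) (Primrec.nat_mul.comp hD h2))
      (primrec_pow.comp (Primrec.const 2) (Primrec.nat_add.comp (Primrec.nat_mul.comp
        (Primrec.nat_mul.comp ha (Primrec.nat_add.comp hY (list_sum_primrec.comp hL))) h2)
        (Primrec.nat_mul.comp (Primrec.const 2) hD)))
  · exact primrec_pow.comp (Primrec.const 2) (Primrec.nat_add.comp
      (Primrec.nat_mul.comp (Primrec.nat_mul.comp hN hD) h2)
      (Primrec.nat_mul.comp hg hD))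
end

/-! Correctness of the tests -/

theorem pow_lt_iff_log {z e1 e2 : ℕ} (m : ℕ) (hz : 0 < z) :
    2 ^ e1 < z ^ m * 2 ^ e2 ↔ (e1:ℝ) < m * Real.logb 2 z + e2 := by
  have hzR : (0:ℝ) < z := by exact_mod_cast hz
  have h : (2 ^ e1 < z ^ m * 2 ^ e2) ↔ ((2:ℝ) ^ e1 < (z:ℝ) ^ m * 2 ^ e2) := by exact_mod_cast Iff.rfl
  rw [h, ← Real.logb_lt_logb_iff (b := 2) (by norm_num) (by positivity) (by positivity),
    Real.logb_mul (by positivity) (by positivity), Real.logb_pow, Real.logb_pow, Real.logb_pow,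
    Real.logb_self_eq_one (by norm_num)]
  simp

theorem log_lt_iff_pow {z e1 e2 : ℕ} (m : ℕ) (hz : 0 < z) :
    z ^ m * 2 ^ e2 < 2 ^ e1 ↔ m * Real.logb 2 z + e2 < (e1:ℝ) := by
  have hzR : (0:ℝ) < z := by exact_mod_cast hz
  have h : (z ^ m * 2 ^ e2 < 2 ^ e1) ↔ ((z:ℝ) ^ m * 2 ^ e2 < (2:ℝ) ^ e1) := by exact_mod_cast Iff.rfl
  rw [h, ← Real.logb_lt_logb_iff (b := 2) (by norm_num) (by positivity) (by positivity),
    Real.logb_mul (by positivity) (by positivity), Real.logb_pow, Real.logb_pow, Real.logb_pow,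
    Real.logb_self_eq_one (by norm_num)]
  simp

theorem test1_iff (L : List ℕ) (a N g : ℕ) {j : ℕ} (hj : 0 < j) (hL : L ≠ []) :
    test1 L a j N g = true ↔ 0 < ZL L a j N ∧ ((g:ℝ) + 2) / 2 ^ N <
      Real.logb 2 ((ZL L a j N : ℝ) / 2 ^ N) +
        (a / j : ℝ) * ((YL L a j N : ℝ) / (ZL L a j N + L.length)) := by
  have hlen : 0 < L.length := List.length_pos_iff.2 hL
  rw [test1, decide_eq_true_eq]
  rcases Nat.eq_zero_or_pos (ZL L a j N) with h0 | hz
  · simp only [h0]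
    constructor
    · intro h
      rw [zero_pow (by positivity)] at h
      simp at h
    · intro h; exact absurd h.1 (lt_irrefl _)
  · rw [pow_lt_iff_log _ hz]
    have hzR : (0:ℝ) < ZL L a j N := by exact_mod_cast hz
    have hjR : (0:ℝ) < j := by exact_mod_cast hj
    have hlR : (0:ℝ) < L.length := by exact_mod_cast hlen
    rw [Real.logb_div hzR.ne' (by positivity), Real.logb_pow, Real.logb_self_eq_one (by norm_num)]
    generalize Real.logb 2 (ZL L a j N : ℝ) = lg
    push_cast
    generalize (ZL L a j N : ℝ) = z at *
    generalize (YL L a j N : ℝ) = y at *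
    have h2 : (0:ℝ) < 2 ^ N := by positivity
    generalize (2:ℝ) ^ N = P at *
    rw [and_iff_right hz, div_lt_iff₀ h2]
    have hd : (0:ℝ) < j * (z + L.length) := by positivity
    rw [← mul_lt_mul_iff_left₀ hd (b := (g:ℝ) + 2)]
    have e : (lg - N * 1 + (a / j : ℝ) * (y / (z + L.length))) * P * (j * (z + L.length))
        = (j * (z + L.length)) * P * lg + a * y * P - N * (j * (z + L.length)) * P := by
      field_simp
      ring
    rw [e]
    constructor <;> intro h <;> linarith

theorem test2_iff (L : List ℕ) (a N g : ℕ) {j : ℕ} (hj : 0 < j) :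
    test2 L a j N g = true ↔ 0 < ZL L a j N ∧
      Real.logb 2 (((ZL L a j N : ℝ) + L.length) / 2 ^ N) +
        (a / j : ℝ) * (((YL L a j N : ℝ) + L.sum) / ZL L a j N) < ((g:ℝ) - 2) / 2 ^ N := by
  rw [test2, decide_eq_true_eq]
  refine and_congr_right fun hz => ?_
  rw [log_lt_iff_pow _ (by omega)]
  have hzR : (0:ℝ) < ZL L a j N := by exact_mod_cast hz
  have hjR : (0:ℝ) < j := by exact_mod_cast hj
  rw [Real.logb_div (by positivity) (by positivity), Real.logb_pow, Real.logb_self_eq_one (by norm_num)]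
  rw [show ((ZL L a j N + L.length : ℕ) : ℝ) = (ZL L a j N : ℝ) + L.length by push_cast; rfl]
  generalize Real.logb 2 ((ZL L a j N : ℝ) + L.length) = lg
  push_cast
  generalize (ZL L a j N : ℝ) = z at *
  generalize (YL L a j N : ℝ) = y at *
  generalize hS : (List.map (Nat.cast : ℕ → ℝ) L).sum = sm at *
  have h2 : (0:ℝ) < 2 ^ N := by positivity
  generalize (2:ℝ) ^ N = P at *
  rw [lt_div_iff₀ h2]
  have hd : (0:ℝ) < j * z := by positivity
  rw [← mul_lt_mul_iff_left₀ hd (c := (g:ℝ) - 2)]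
  have e : (lg - N * 1 + (a / j : ℝ) * ((y + sm) / z)) * P * (j * z)
      = (j * z) * P * lg + a * (y + sm) * P - N * (j * z) * P := by
    field_simp
    ring
  rw [e]
  constructor <;> intro h <;> linarith

noncomputable def zl (L : List ℕ) (β : ℝ) : ℝ := (L.map (bw β)).sum
noncomputable def yl (L : List ℕ) (β : ℝ) : ℝ := (L.map (fun l : ℕ => (l:ℝ) * bw β l)).sum

theorem ZL_bounds (L : List ℕ) (a N : ℕ) {j : ℕ} (hj : 0 < j) :
    (ZL L a j N : ℝ) ≤ 2 ^ N * zl L (a / j) ∧ 2 ^ N * zl L (a / j) ≤ ZL L a j N + L.length := by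
  induction L with
  | nil => simp [ZL, zl]
  | cons l L ih =>
    obtain ⟨h1, h2⟩ := ufun_spec l a N hj
    simp only [ZL, zl, List.map_cons, List.sum_cons, List.length_cons] at ih ⊢
    push_cast at ih ⊢
    constructor <;> rw [mul_add] <;> linarith [ih.1, ih.2]

theorem YL_bounds (L : List ℕ) (a N : ℕ) {j : ℕ} (hj : 0 < j) :
    (YL L a j N : ℝ) ≤ 2 ^ N * yl L (a / j) ∧ 2 ^ N * yl L (a / j) ≤ YL L a j N + L.sum := by
  induction L with
  | nil => simp [YL, yl]
  | cons l L ih =>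
    obtain ⟨h1, h2⟩ := ufun_spec l a N hj
    have hl : (0:ℝ) ≤ l := Nat.cast_nonneg _
    simp only [YL, yl, List.map_cons, List.sum_cons] at ih ⊢
    push_cast at ih ⊢
    have h3 := mul_le_mul_of_nonneg_left h1 hl
    have h4 := mul_le_mul_of_nonneg_left h2.le hl
    have e : (2:ℝ) ^ N * (l * bw (a / j) l) = l * (2 ^ N * bw (a / j) l) := by ring
    constructor <;> rw [mul_add, e] <;> linarith [ih.1, ih.2]

theorem zl_pos {L : List ℕ} (hL : L ≠ []) (β : ℝ) : 0 < zl L β := by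
  unfold zl
  refine List.sum_pos _ ?_ (by simpa using hL)
  intro x hx
  obtain ⟨l, _, rfl⟩ := List.mem_map.1 hx
  exact bw_pos _ _

theorem yl_nonneg (L : List ℕ) (β : ℝ) : 0 ≤ yl L β := by
  unfold yl
  refine List.sum_nonneg ?_
  intro x hx
  obtain ⟨l, _, rfl⟩ := List.mem_map.1 hx
  exact mul_nonneg (Nat.cast_nonneg _) (bw_pos _ _).le

theorem Ss_eq_list {L : List (List Bool)} (hL : L.Nodup) (β : ℝ) :
    Ss L.toFinset β = Real.logb 2 (zl (L.map List.length) β) +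
      β * (yl (L.map List.length) β / zl (L.map List.length) β) := by
  have h1 : Zs L.toFinset β = zl (L.map List.length) β := by
    unfold Zs zl
    rw [List.sum_toFinset _ hL, List.map_map]; rfl
  have h2 : Ys L.toFinset β = yl (L.map List.length) β := by
    unfold Ys yl
    rw [List.sum_toFinset _ hL, List.map_map]; rfl
  rw [Ss, h1, h2]

theorem test1_sound {L : List ℕ} (hL : L ≠ []) (a N g : ℕ) {j : ℕ} (hj : 0 < j) {s : ℝ}
    (hg : |s * 2 ^ N - g| < 2) (h : test1 L a j N g = true) :
    s < Real.logb 2 (zl L (a / j)) + (a / j : ℝ) * (yl L (a / j) / zl L (a / j)) := by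
  rw [test1_iff L a N g hj hL] at h
  obtain ⟨hz, h⟩ := h
  have hzR : (0:ℝ) < ZL L a j N := by exact_mod_cast hz
  obtain ⟨z1, z2⟩ := ZL_bounds L a N hj
  obtain ⟨y1, y2⟩ := YL_bounds L a N hj
  have hp : (0:ℝ) < 2 ^ N := by positivity
  have hs : s < ((g:ℝ) + 2) / 2 ^ N := by
    rw [lt_div_iff₀ hp]; linarith [(abs_lt.1 hg).2]
  refine hs.trans (h.trans_le (add_le_add ?_ ?_))
  · refine Real.logb_le_logb_of_le (by norm_num) (by positivity) ?_
    rw [div_le_iff₀ hp]; linarith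
  · refine mul_le_mul_of_nonneg_left ?_ (by positivity)
    have : yl L (a / j) / zl L (a / j) = (2 ^ N * yl L (a / j)) / (2 ^ N * zl L (a / j)) := by
      rw [mul_div_mul_left _ _ hp.ne']
    rw [this]
    have := zl_pos hL (a / j)
    exact div_le_div₀ (mul_nonneg hp.le (yl_nonneg _ _)) y1 (by positivity) z2

theorem test2_sound {L : List ℕ} (hL : L ≠ []) (a N g : ℕ) {j : ℕ} (hj : 0 < j) {s : ℝ}
    (hg : |s * 2 ^ N - g| < 2) (h : test2 L a j N g = true) :
    Real.logb 2 (zl L (a / j)) + (a / j : ℝ) * (yl L (a / j) / zl L (a / j)) < s := by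
  rw [test2_iff L a N g hj] at h
  obtain ⟨hz, h⟩ := h
  have hzR : (0:ℝ) < ZL L a j N := by exact_mod_cast hz
  obtain ⟨z1, z2⟩ := ZL_bounds L a N hj
  obtain ⟨y1, y2⟩ := YL_bounds L a N hj
  have hp : (0:ℝ) < 2 ^ N := by positivity
  have hs : ((g:ℝ) - 2) / 2 ^ N < s := by
    rw [div_lt_iff₀ hp]; linarith [(abs_lt.1 hg).1]
  refine lt_of_le_of_lt (add_le_add ?_ ?_) (h.trans hs)
  · refine Real.logb_le_logb_of_le (by norm_num) (zl_pos hL _) ?_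
    rw [le_div_iff₀ hp]; linarith
  · refine mul_le_mul_of_nonneg_left ?_ (by positivity)
    have : yl L (a / j) / zl L (a / j) = (2 ^ N * yl L (a / j)) / (2 ^ N * zl L (a / j)) := by
      rw [mul_div_mul_left _ _ hp.ne']
    rw [this]
    exact div_le_div₀ (by positivity) y2 hzR z1

theorem tendsto_const_div_two_pow (c : ℝ) : Tendsto (fun N : ℕ => c / 2 ^ N) atTop (𝓝 0) :=
  tendsto_const_nhds.div_atTop (tendsto_pow_atTop_atTop_of_one_lt (by norm_num))

theorem tendsto_approx {F : ℕ → ℝ} {x c : ℝ} (h : ∀ N, |F N - 2 ^ N * x| ≤ c) :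
    Tendsto (fun N => F N / 2 ^ N) atTop (𝓝 x) := by
  rw [tendsto_iff_dist_tendsto_zero]
  refine squeeze_zero (fun _ => dist_nonneg) (fun N => ?_) (tendsto_const_div_two_pow c)
  have hp : (0:ℝ) < 2 ^ N := by positivity
  rw [Real.dist_eq, show F N / 2 ^ N - x = (F N - 2 ^ N * x) / 2 ^ N by field_simp, abs_div,
    abs_of_pos hp]
  exact div_le_div_of_nonneg_right (h N) hp.le

theorem tests_complete {L : List ℕ} (hL : L ≠ []) (a : ℕ) {g : ℕ → ℕ} {j : ℕ} (hj : 0 < j) {s : ℝ}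
    (hg : ∀ N, |s * 2 ^ N - g N| < 2) :
    (s < Real.logb 2 (zl L (a / j)) + (a / j : ℝ) * (yl L (a / j) / zl L (a / j)) →
      ∀ᶠ N in atTop, test1 L a j N (g N) = true) ∧
    (Real.logb 2 (zl L (a / j)) + (a / j : ℝ) * (yl L (a / j) / zl L (a / j)) < s →
      ∀ᶠ N in atTop, test2 L a j N (g N) = true) := by
  have z0 := zl_pos hL (a / j)
  have hz : Tendsto (fun N => (ZL L a j N : ℝ) / 2 ^ N) atTop (𝓝 (zl L (a / j))) :=
    tendsto_approx (c := L.length) (fun N => by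
      obtain ⟨z1, z2⟩ := ZL_bounds L a N hj
      rw [abs_le]; constructor <;> linarith [(Nat.cast_nonneg L.length : (0:ℝ) ≤ _)])
  have hz' : Tendsto (fun N => ((ZL L a j N : ℝ) + L.length) / 2 ^ N) atTop (𝓝 (zl L (a / j))) := by
    have := hz.add (tendsto_const_div_two_pow (L.length : ℝ))
    simpa [add_div] using this
  have hy : Tendsto (fun N => (YL L a j N : ℝ) / 2 ^ N) atTop (𝓝 (yl L (a / j))) :=
    tendsto_approx (c := L.sum) (fun N => by
      obtain ⟨z1, z2⟩ := YL_bounds L a N hj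
      rw [abs_le]; constructor <;> linarith [(Nat.cast_nonneg L.sum : (0:ℝ) ≤ _)])
  have hy' : Tendsto (fun N => ((YL L a j N : ℝ) + L.sum) / 2 ^ N) atTop (𝓝 (yl L (a / j))) := by
    have := hy.add (tendsto_const_div_two_pow (L.sum : ℝ))
    simpa [add_div] using this
  have hs : Tendsto (fun N => (g N : ℝ) / 2 ^ N) atTop (𝓝 s) :=
    tendsto_approx (c := 2) (fun N => by
      have := (hg N).le
      rw [abs_sub_comm] at this
      rwa [mul_comm s] at this)
  have hs1 : Tendsto (fun N => ((g N : ℝ) + 2) / 2 ^ N) atTop (𝓝 s) := by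
    have := hs.add (tendsto_const_div_two_pow 2)
    simpa [add_div] using this
  have hs2 : Tendsto (fun N => ((g N : ℝ) - 2) / 2 ^ N) atTop (𝓝 s) := by
    have := hs.sub (tendsto_const_div_two_pow 2)
    simpa [sub_div] using this
  have hpos : ∀ᶠ N in atTop, 0 < ZL L a j N := by
    filter_upwards [hz.eventually (lt_mem_nhds z0)] with N hN
    by_contra h0
    have : ZL L a j N = 0 := by omega
    simp [this] at hN
  have e : ∀ (N : ℕ) (x y : ℝ), x / 2 ^ N / (y / 2 ^ N) = x / y := fun N x y =>
    div_div_div_cancel_right₀ (by positivity) _ _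
  constructor
  · intro h
    have hlim := ((hz.logb z0.ne' (b := 2)).add ((hy.div hz' z0.ne').const_mul (a / j : ℝ)))
    filter_upwards [hpos, hs1.eventually_lt hlim h] with N h1 h2
    rw [test1_iff L a N _ hj hL]
    simp only [e, Pi.div_apply] at h2
    exact ⟨h1, h2⟩
  · intro h
    have hlim := ((hz'.logb z0.ne' (b := 2)).add ((hy'.div hz z0.ne').const_mul (a / j : ℝ)))
    filter_upwards [hpos, hlim.eventually_lt hs2 h] with N h1 h2
    rw [test2_iff L a N _ hj]
    simp only [e, Pi.div_apply] at h2
    exact ⟨h1, h2⟩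

/-- combined form for stages -/
theorem tests_spec {D : List (List Bool)} (hD : D.Nodup) (hne : D ≠ []) (a : ℕ) {g : ℕ → ℕ} {j : ℕ}
    (hj : 0 < j) {s : ℝ} (hg : ∀ N, |s * 2 ^ N - g N| < 2) :
    (∀ N, test1 (D.map List.length) a j N (g N) = true → s < Ss D.toFinset (a / j)) ∧
    (∀ N, test2 (D.map List.length) a j N (g N) = true → Ss D.toFinset (a / j) < s) ∧
    (s < Ss D.toFinset (a / j) → ∀ᶠ N in atTop, test1 (D.map List.length) a j N (g N) = true) ∧
    (Ss D.toFinset (a / j) < s → ∀ᶠ N in atTop, test2 (D.map List.length) a j N (g N) = true) := by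
  have hL : D.map List.length ≠ [] := by simpa using hne
  rw [Ss_eq_list hD]
  exact ⟨fun N h => test1_sound hL a N _ hj (hg N) h, fun N h => test2_sound hL a N _ hj (hg N) h,
    (tests_complete hL a hj hg).1, (tests_complete hL a hj hg).2⟩

def bval (s : List Bool) : ℕ := s.foldl (fun a b => 2 * a + b.toNat) 0

theorem bval_primrec : Primrec bval := by
  unfold bval
  refine Primrec.list_foldl (f := fun s : List Bool => s) (g := fun _ => (0:ℕ))
    (h := fun _ p => 2 * p.1 + p.2.toNat) Primrec.id (Primrec.const 0) ?_
  refine Primrec.nat_add.comp (Primrec.nat_mul.comp (Primrec.const 2) (Primrec.fst.comp Primrec.snd)) ?_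
  exact (Primrec.dom_finite Bool.toNat).comp (Primrec.snd.comp Primrec.snd)

theorem bval_append_singleton (s : List Bool) (b : Bool) : bval (s ++ [b]) = 2 * bval s + b.toNat := by
  simp [bval]

theorem bval_lt (s : List Bool) : bval s < 2 ^ s.length := by
  induction s using List.reverseRecOn with
  | nil => simp [bval]
  | append_singleton s b ih =>
    rw [bval_append_singleton, List.length_append, List.length_singleton, pow_succ]
    have := Bool.toNat_le b
    omega

theorem bval_inj {s s' : List Bool} (hl : s.length = s'.length) (h : bval s = bval s') : s = s' := by
  induction s using List.reverseRecOn generalizing s' with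
  | nil => exact (List.length_eq_zero_iff.1 hl.symm).symm
  | append_singleton s b ih =>
    rcases List.eq_nil_or_concat' s' with rfl | ⟨t, c, rfl⟩
    · simp at hl
    · rw [bval_append_singleton, bval_append_singleton] at h
      simp only [List.length_append, List.length_singleton, Nat.add_right_cancel_iff] at hl
      have hb := Bool.toNat_le b
      have hc := Bool.toNat_le c
      have h1 : bval s = bval t := by omega
      have h2 : b.toNat = c.toNat := by omega
      have h3 : b = c := by cases b <;> cases c <;> simp_all
      rw [ih hl h1, h3]

theorem exists_bval (n v : ℕ) (hv : v < 2 ^ n) : ∃ s : List Bool, s.length = n ∧ bval s = v := by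
  induction n generalizing v with
  | zero => exact ⟨[], rfl, by simp at hv; simp [bval, hv]⟩
  | succ n ih =>
    rw [pow_succ] at hv
    obtain ⟨s, hs, hv'⟩ := ih (v / 2) (by omega)
    refine ⟨s ++ [decide (v % 2 = 1)], by simp [hs], ?_⟩
    rw [bval_append_singleton, hv']
    rcases Nat.mod_two_eq_zero_or_one v with h | h <;> simp [h] <;> omega

theorem firstBits_length (α : ℝ) (n : ℕ) : (firstBits α n).length = n := by simp [firstBits]

theorem bval_firstBits {α : ℝ} (h0 : 0 ≤ α) (h1 : α < 1) (n : ℕ) :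
    bval (firstBits α n) = ⌊α * 2 ^ n⌋₊ := by
  have hf : ⌊α⌋ = 0 := Int.floor_eq_zero_iff.2 ⟨h0, h1⟩
  induction n with
  | zero =>
    simp only [firstBits, bval, List.range_zero, List.map_nil, List.foldl_nil, pow_zero, mul_one]
    exact (Nat.floor_eq_zero.2 h1).symm
  | succ n ih =>
    have e : firstBits α (n + 1) = firstBits α n ++ [bitOf α n] := by
      simp [firstBits, List.range_succ]
    rw [e, bval_append_singleton, ih]
    have hx : 0 ≤ α * 2 ^ n := by positivity
    have hx' : α * 2 ^ (n + 1) = 2 * (α * 2 ^ n) := by rw [pow_succ]; ring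
    have hb : bitOf α n = decide (⌊α * 2 ^ (n + 1)⌋₊ % 2 = 1) := by
      unfold bitOf
      rw [hf, Int.cast_zero, sub_zero, ← Int.natCast_floor_eq_floor (by positivity)]
      congr 1
      apply propext
      omega
    rw [hb, hx']
    have a1 := Nat.floor_le hx
    have a2 := Nat.lt_floor_add_one (α * 2 ^ n)
    set m := ⌊α * 2 ^ n⌋₊
    have b1 : 2 * m ≤ ⌊2 * (α * 2 ^ n)⌋₊ := Nat.le_floor (by push_cast; linarith)
    have b2 : ⌊2 * (α * 2 ^ n)⌋₊ < 2 * m + 2 := (Nat.floor_lt (by positivity)).2 (by push_cast; linarith)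
    set m' := ⌊2 * (α * 2 ^ n)⌋₊
    rcases Nat.mod_two_eq_zero_or_one m' with h | h <;> simp [h] <;> omega

theorem complexity_spec {U : Computer} {s : List Bool} (h : ∃ p, s ∈ U.f p) :
    ∃ p, s ∈ U.f p ∧ p.length = complexity U s := by
  have : {n | ∃ p : List Bool, s ∈ U.f p ∧ p.length = n}.Nonempty := by
    obtain ⟨p, hp⟩ := h; exact ⟨_, p, hp, rfl⟩
  exact Nat.sInf_mem this

theorem complexity_le {U : Computer} {s p : List Bool} (h : s ∈ U.f p) : complexity U s ≤ p.length :=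
  Nat.sInf_le ⟨p, h, rfl⟩

/-- A machine with one program `w` printing `s`. -/
theorem optimal_outputs {U : Computer} (hU : Optimal U) (s : List Bool) : ∃ p, s ∈ U.f p := by
  let C : Computer :=
    { f := fun p => if p = [] then Part.some s else Part.none
      partrec := by
        have := Partrec.cond (c := fun p : List Bool => decide (p = []))
          (f := fun _ => Part.some s) (g := fun _ => Part.none)
          (Primrec.eq.decide.to_comp.comp Computable.id (Computable.const []))
          (Computable.const s).partrec Partrec.none
        refine this.of_eq fun p => ?_
        by_cases h : p = [] <;> simp [h]
      dom_nonempty := ⟨[], by simp [PFun.Dom]⟩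
      dom_prefixFree := by
        intro p hp q hq _
        have : ∀ p : List Bool, p ∈ PFun.Dom (fun p : List Bool => if p = [] then Part.some s else Part.none) → p = [] := by
          intro p hp
          by_contra h
          simp [PFun.Dom, h] at hp
        rw [this p hp, this q hq] }
  obtain ⟨d, hd⟩ := hU C
  obtain ⟨q, hq, _⟩ := hd [] (by simp [C, PFun.Dom])
  exact ⟨q, by rw [hq]; simp [C]⟩

theorem optimal_two_lengths {V : Computer} (hV : Optimal V) :
    ∃ p ∈ V.f.Dom, ∃ q ∈ V.f.Dom, p.length ≠ q.length := by
  by_contra hcon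
  push Not at hcon
  obtain ⟨p0, hp0⟩ := V.dom_nonempty
  choose F hF using fun s => optimal_outputs hV s
  have hdom : ∀ s, F s ∈ V.f.Dom := fun s => Part.dom_iff_mem.2 ⟨s, hF s⟩
  have hinj : Function.Injective F := by
    intro a b hab
    have h1 := hF a
    rw [hab] at h1
    exact Part.mem_unique h1 (hF b)
  have hfin : (Set.range F).Finite := by
    refine (List.finite_length_eq Bool p0.length).subset ?_
    rintro _ ⟨s, rfl⟩
    exact hcon _ (hdom s) _ hp0
  have := Set.infinite_range_of_injective hinj
  exact this hfin

structure StageData (V : Computer) (T : ℝ) where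
  D : ℕ → List (List Bool)
  x : ℕ → List Bool
  g : ℕ → ℕ
  β₀ : ℝ
  c₁ : ℝ
  c₂ : ℝ
  c₃ : ℝ
  c₄ : ℝ
  K : ℕ
  compD : Computable D
  compx : Computable x
  compg : Computable g
  hg : ∀ N, |Sfun V T * 2 ^ N - g N| < 2
  nodup : ∀ k, (D k).Nodup
  dom : ∀ k, ∀ p ∈ D k, p ∈ V.f.Dom
  mono : ∀ k k', k ≤ k' → ∀ p ∈ D k, p ∈ D k'
  exh : ∀ p ∈ V.f.Dom, ∃ k, p ∈ D k
  fresh : ∀ k, ∀ p ∈ D k, x k ∉ V.f p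
  hβ1 : 1 < β₀
  hβ2 : β₀ < 1 / T
  h₁ : 0 < c₁
  h₂ : 0 < c₂
  h₃ : 0 < c₃
  h₄ : 0 < c₄
  ne : ∀ k, K ≤ k → D k ≠ []
  anti : ∀ k, K ≤ k → StrictAntiOn (Ss (D k).toFinset) (Set.Ioi 0)
  lip : ∀ k, K ≤ k → ∀ β ∈ Set.Icc β₀ (1 / T),
    c₁ * (1 / T - β) ≤ Ss (D k).toFinset β - Ss (D k).toFinset (1 / T) ∧
    Ss (D k).toFinset β - Ss (D k).toFinset (1 / T) ≤ c₂ * (1 / T - β)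
  addL : ∀ k, K ≤ k → ∀ q ∈ V.f.Dom, q ∉ D k → 1 ≤ q.length ∧
    c₃ * (q.length * bw (1 / T) q.length) ≤ Sfun V T - Ss (D k).toFinset (1 / T)
  addU : ∀ k, K ≤ k → ∀ C : ℝ, (∀ k', k ≤ k' → Ys ((D k').toFinset \ (D k).toFinset) (1 / T) ≤ C) →
    Sfun V T - Ss (D k).toFinset (1 / T) ≤ c₄ * C
  le : ∀ k, K ≤ k → Ss (D k).toFinset (1 / T) ≤ Sfun V T
  big : ∀ k, K ≤ k → Sfun V T < Ss (D k).toFinset β₀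
  lim : Tendsto (fun k => Ss (D k).toFinset (1 / T)) atTop (𝓝 (Sfun V T))

theorem exists_stageData {V : Computer} (hV : Optimal V) {T : ℝ} (hT : T ∈ Set.Ioo (0:ℝ) 1)
    (hS : ComputableReal (Sfun V T)) : Nonempty (StageData V T) := by
  obtain ⟨D, x, compD, compx, nodup, dom, mono, exh, fresh⟩ := exists_stages V
  obtain ⟨p, hp, q, hq, hpq⟩ := optimal_two_lengths hV
  have hβT : 1 < 1 / T := by rw [lt_div_iff₀ hT.1]; linarith [hT.2]
  obtain ⟨β₀, hβ1, hβ2⟩ := exists_between hβT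
  obtain ⟨c₁, c₂, h₁, h₂, lip⟩ := Ss_lip hpq hβ1 hβ2.le
  obtain ⟨c₃, c₄, M, h₃, h₄, add⟩ := Ss_add (p := p) hβT
  set E : ℕ → Finset (List Bool) := fun k => (D k).toFinset with hE
  have Emono : Monotone E := by
    intro k k' h r hr
    simp only [hE, List.mem_toFinset] at hr ⊢
    exact mono k k' h r hr
  have Edom : ∀ k, ∀ r ∈ E k, r ∈ V.f.Dom := fun k r hr => dom k r (List.mem_toFinset.1 hr)
  have Eexh : ∀ r ∈ V.f.Dom, ∃ k, r ∈ E k := fun r hr => by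
    obtain ⟨k, hk⟩ := exh r hr; exact ⟨k, List.mem_toFinset.2 hk⟩
  have EKr : ∀ k, Kr (E k) := fun k => Kr_of_dom V _ (Edom k)
  have lim := tendsto_Ss V E Edom Emono Eexh hT
  obtain ⟨kp, hkp⟩ := Eexh p hp
  obtain ⟨kq, hkq⟩ := Eexh q hq
  have hfin : ({r : List Bool | r.length < M + 1} ∩ V.f.Dom).Finite :=
    (List.finite_length_lt Bool (M + 1)).inter_of_left _
  have hK0 : ∃ K0, ∀ k, K0 ≤ k → ∀ r ∈ V.f.Dom, r.length < M + 1 → r ∈ E k := by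
    have : ∀ᶠ k in atTop, ∀ r ∈ ({r : List Bool | r.length < M + 1} ∩ V.f.Dom), r ∈ E k := by
      rw [Filter.eventually_all_finite hfin]
      intro r hr
      obtain ⟨K, hK⟩ := Eexh r hr.2
      exact eventually_atTop.2 ⟨K, fun k hk => Emono hk hK⟩
    obtain ⟨K0, h⟩ := eventually_atTop.1 this
    exact ⟨K0, fun k hk r hr hl => h k hk r ⟨hl, hr⟩⟩
  obtain ⟨K0, hK0⟩ := hK0
  have hdiff : ∀ k k', K0 ≤ k → ∀ r ∈ E k' \ E k, M ≤ r.length := by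
    intro k k' hk r hr
    rw [Finset.mem_sdiff] at hr
    by_contra h
    exact hr.2 (hK0 k hk r (Edom _ _ hr.1) (by omega))
  have hK1 : ∃ K1, ∀ k, K1 ≤ k → Sfun V T - c₁ * (1 / T - β₀) < Ss (E k) (1 / T) := by
    refine eventually_atTop.1 (lim.eventually (lt_mem_nhds ?_))
    have := mul_pos h₁ (sub_pos.2 hβ2)
    linarith
  obtain ⟨K1, hK1⟩ := hK1
  set K := max (max kp kq) (max K0 K1) with hKdef
  have hkp' : ∀ k, K ≤ k → p ∈ E k := fun k hk => Emono (by omega) hkp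
  have hkq' : ∀ k, K ≤ k → q ∈ E k := fun k hk => Emono (by omega) hkq
  have hadd : ∀ k k', K ≤ k → k ≤ k' → c₃ * Ys (E k' \ E k) (1 / T) ≤ Ss (E k') (1 / T) - Ss (E k) (1 / T) ∧
      Ss (E k') (1 / T) - Ss (E k) (1 / T) ≤ c₄ * Ys (E k' \ E k) (1 / T) := fun k k' hk hk' =>
    add (E k) (E k') (Emono hk') (EKr k') (hkp' k hk) (hdiff k k' (by omega))
  have hle' : ∀ k k', K ≤ k → k ≤ k' → Ss (E k) (1 / T) ≤ Ss (E k') (1 / T) := by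
    intro k k' hk hk'
    have := (hadd k k' hk hk').1
    have := mul_nonneg h₃.le (Ys_nonneg (E k' \ E k) (1 / T))
    linarith
  have hle : ∀ k, K ≤ k → Ss (E k) (1 / T) ≤ Sfun V T := fun k hk =>
    ge_of_tendsto lim (eventually_atTop.2 ⟨k, fun k' hk' => hle' k k' hk hk'⟩)
  have hlip : ∀ k, K ≤ k → ∀ β ∈ Set.Icc β₀ (1 / T),
    c₁ * (1 / T - β) ≤ Ss (E k) β - Ss (E k) (1 / T) ∧
    Ss (E k) β - Ss (E k) (1 / T) ≤ c₂ * (1 / T - β) := fun k hk β hβ =>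
      lip (E k) (EKr k) (hkp' k hk) (hkq' k hk) β hβ
  have hs0 : 0 ≤ Sfun V T := (Ss_nonneg ⟨p, hkp' K le_rfl⟩ _).trans (hle K le_rfl)
  obtain ⟨g, compg, hg⟩ := exists_nat_approx hS hs0
  refine ⟨⟨D, x, g, β₀, c₁, c₂, c₃, c₄, K, compD, compx, compg, hg, nodup, dom, mono, exh, fresh,
    hβ1, hβ2, h₁, h₂, h₃, h₄, ?_, ?_, hlip, ?_, ?_, hle, ?_, lim⟩⟩
  · intro k hk h
    have := List.mem_toFinset.1 (hkp' k hk)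
    simp [h] at this
  · exact fun k hk => Ss_strictAnti (hkp' k hk) (hkq' k hk) hpq
  · intro k hk r hr hrk
    have hrk' : r ∉ E k := fun h => hrk (List.mem_toFinset.1 h)
    constructor
    · by_contra h
      exact hrk' (hK0 k (by omega) r hr (by omega))
    · obtain ⟨k', hk'⟩ := Eexh r hr
      have hm : r ∈ E (max k k') := Emono (le_max_right _ _) hk'
      have h1 := (hadd k (max k k') hk (le_max_left _ _)).1
      have h2 := hle (max k k') (hk.trans (le_max_left _ _))
      have h3 : (r.length : ℝ) * bw (1 / T) r.length ≤ Ys (E (max k k') \ E k) (1 / T) :=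
        Finset.single_le_sum (f := fun p : List Bool => (p.length : ℝ) * bw (1 / T) p.length)
          (fun i _ => mul_nonneg (Nat.cast_nonneg _) (bw_pos _ _).le)
          (Finset.mem_sdiff.2 ⟨hm, hrk'⟩)
      have h4 := mul_le_mul_of_nonneg_left h3 h₃.le
      show _ ≤ Sfun V T - Ss (E k) (1 / T)
      linarith
  · intro k hk C hC
    have : Sfun V T ≤ Ss (E k) (1 / T) + c₄ * C := by
      refine le_of_tendsto lim (eventually_atTop.2 ⟨k, fun k' hk' => ?_⟩)
      have h1 := (hadd k k' hk hk').2
      have h2 := mul_le_mul_of_nonneg_left (hC k' hk') h₄.le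
      linarith
    show Sfun V T - Ss (E k) (1 / T) ≤ _
    linarith
  · intro k hk
    have h1 := (hlip k hk β₀ ⟨le_rfl, hβ2.le⟩).1
    have h2 := hK1 k (by omega)
    show _ < Ss (E k) β₀
    linarith

section
variable {α : Type} [Primcodable α]

def tt1 (t : List ℕ × ℕ × ℕ × ℕ × ℕ) : Bool := test1 t.1 t.2.1 t.2.2.1 t.2.2.2.1 t.2.2.2.2

theorem test1_comp {L : α → List ℕ} {a j N g : α → ℕ} (hL : Computable L) (ha : Computable a)
    (hj : Computable j) (hN : Computable N) (hg : Computable g) :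
    Computable (fun x => test1 (L x) (a x) (j x) (N x) (g x)) := by
  have h : Primrec tt1 :=
    test1_primrec Primrec.fst (Primrec.fst.comp Primrec.snd)
      (Primrec.fst.comp (Primrec.snd.comp Primrec.snd))
      (Primrec.fst.comp (Primrec.snd.comp (Primrec.snd.comp Primrec.snd)))
      (Primrec.snd.comp (Primrec.snd.comp (Primrec.snd.comp Primrec.snd)))
  have h' := h.to_comp.comp (hL.pair (ha.pair (hj.pair (hN.pair hg))))
  exact h'

def tt2 (t : List ℕ × ℕ × ℕ × ℕ × ℕ) : Bool := test2 t.1 t.2.1 t.2.2.1 t.2.2.2.1 t.2.2.2.2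

theorem test2_comp {L : α → List ℕ} {a j N g : α → ℕ} (hL : Computable L) (ha : Computable a)
    (hj : Computable j) (hN : Computable N) (hg : Computable g) :
    Computable (fun x => test2 (L x) (a x) (j x) (N x) (g x)) := by
  have h : Primrec tt2 :=
    test2_primrec Primrec.fst (Primrec.fst.comp Primrec.snd)
      (Primrec.fst.comp (Primrec.snd.comp Primrec.snd))
      (Primrec.fst.comp (Primrec.snd.comp (Primrec.snd.comp Primrec.snd)))
      (Primrec.snd.comp (Primrec.snd.comp (Primrec.snd.comp Primrec.snd)))
  have h' := h.to_comp.comp (hL.pair (ha.pair (hj.pair (hN.pair hg))))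
  exact h'

theorem lengths_comp {D : α → List (List Bool)} (hD : Computable D) :
    Computable (fun x => (D x).map List.length) := by
  have h : Primrec (fun l : List (List Bool) => l.map List.length) :=
    Primrec.list_map Primrec.id (Primrec.list_length.comp Primrec.snd)
  exact h.to_comp.comp hD

theorem pow_comp {f g : α → ℕ} (hf : Computable f) (hg : Computable g) :
    Computable (fun x => f x ^ g x) := primrec_pow.to_comp.comp hf hg

theorem le_comp {f g : α → ℕ} (hf : Computable f) (hg : Computable g) :
    Computable (fun x => decide (f x ≤ g x)) := Primrec.nat_le.decide.to_comp.comp hf hg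

theorem eq_comp {β : Type} [Primcodable β] [DecidableEq β] {f g : α → β} (hf : Computable f) (hg : Computable g) :
    Computable (fun x => decide (f x = g x)) := Primrec.eq.decide.to_comp.comp hf hg

theorem and_comp {f g : α → Bool} (hf : Computable f) (hg : Computable g) :
    Computable (fun x => f x && g x) := Primrec.and.to_comp.comp hf hg
end

theorem beta_bounds {T : ℝ} (hT : T ∈ Set.Ioo (0:ℝ) 1) (n : ℕ) {w : ℝ} (h1 : T * 2 ^ n < w)
    {c : ℝ} (h2 : w ≤ T * 2 ^ n + c) :
    0 < 1 / T - 2 ^ n / w ∧ 1 / T - 2 ^ n / w ≤ c / T ^ 2 / 2 ^ n := by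
  have hp : (0:ℝ) < 2 ^ n := by positivity
  have hT0 := hT.1
  have hw : 0 < w := lt_trans (by positivity) h1
  have e : 1 / T - 2 ^ n / w = (w - T * 2 ^ n) / (T * w) := by field_simp
  rw [e]
  refine ⟨div_pos (by linarith) (by positivity), ?_⟩
  rw [div_div]
  refine div_le_div₀ (by linarith) (by linarith) (by positivity) ?_
  have : T * (T * 2 ^ n) ≤ T * w := mul_le_mul_of_nonneg_left h1.le hT0.le
  nlinarith

theorem partA {U V : Computer} (hU : Optimal U) (hV : Optimal V) {T : ℝ}
    (hT : T ∈ Set.Ioo (0:ℝ) 1) (S : StageData V T) : ChaitinTRandom U T T := by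
  have hT0 := hT.1
  set R : List Bool × (ℕ × ℕ) → Bool := fun z =>
    decide (S.K ≤ z.2.1) &&
      test1 ((S.D z.2.1).map List.length) (2 ^ z.1.length) (bval z.1 + 1) z.2.2 (S.g z.2.2) with hRdef
  have hk : Computable (fun z : List Bool × (ℕ × ℕ) => z.2.1) := Computable.fst.comp Computable.snd
  have hN : Computable (fun z : List Bool × (ℕ × ℕ) => z.2.2) := Computable.snd.comp Computable.snd
  have hR : Computable R := by
    refine and_comp (le_comp (Computable.const _) hk) (test1_comp (lengths_comp (S.compD.comp hk))
      (pow_comp (Computable.const 2) (Primrec.list_length.to_comp.comp Computable.fst))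
      (Computable.succ.comp (bval_primrec.to_comp.comp Computable.fst)) hN (S.compg.comp hN))
  obtain ⟨φ, hφ, hφ1, hφ2⟩ := exists_selector hR
  -- geometry
  have htest : ∀ n k N, S.K ≤ k → test1 ((S.D k).map List.length) (2 ^ n) (bval (firstBits T n) + 1) N (S.g N) = true →
      Sfun V T < Ss (S.D k).toFinset (2 ^ n / (bval (firstBits T n) + 1)) := by
    intro n k N hk h
    have := (tests_spec (S.nodup k) (S.ne k hk) (2 ^ n) (Nat.succ_pos (bval (firstBits T n))) S.hg).1 N h
    push_cast at this
    exact this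
  have hval : ∀ n, T * 2 ^ n < (bval (firstBits T n) : ℝ) + 1 ∧ (bval (firstBits T n) : ℝ) + 1 ≤ T * 2 ^ n + 1 := by
    intro n
    rw [bval_firstBits hT0.le hT.2]
    exact ⟨Nat.lt_floor_add_one _, by linarith [Nat.floor_le (show 0 ≤ T * 2 ^ n by positivity)]⟩
  have hlarge : ∀ᶠ n : ℕ in atTop, (1:ℝ) / T ^ 2 / 2 ^ n < 1 / T - S.β₀ :=
    (tendsto_const_div_two_pow _).eventually (gt_mem_nhds (sub_pos.2 S.hβ2))
  obtain ⟨n0, hn0⟩ := eventually_atTop.1 hlarge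
  have hβ : ∀ n, n0 ≤ n → (2:ℝ) ^ n / (bval (firstBits T n) + 1) ∈ Set.Icc S.β₀ (1 / T) := by
    intro n hn
    obtain ⟨b1, b2⟩ := beta_bounds hT n (hval n).1 (hval n).2
    have := hn0 n hn
    constructor <;> linarith
  have hdom : ∀ n, n0 ≤ n → (φ (firstBits T n)).Dom := by
    intro n hn
    obtain ⟨b1, b2⟩ := beta_bounds hT n (hval n).1 (hval n).2
    set β := (2:ℝ) ^ n / (bval (firstBits T n) + 1) with hβdef
    have h1 : ∀ᶠ k in atTop, Sfun V T - S.c₁ * (1 / T - β) < Ss (S.D k).toFinset (1 / T) := by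
      refine S.lim.eventually (lt_mem_nhds ?_)
      have := mul_pos S.h₁ b1
      linarith
    obtain ⟨k, hk1, hk2⟩ := (h1.and (eventually_ge_atTop S.K)).exists
    have h2 : Sfun V T < Ss (S.D k).toFinset β := by
      have := (S.lip k hk2 β (hβ n hn)).1
      linarith
    have h3 := (tests_spec (S.nodup k) (S.ne k hk2) (2 ^ n) (Nat.succ_pos (bval (firstBits T n))) S.hg).2.2.1
    push_cast at h3
    obtain ⟨N, hN⟩ := (h3 h2).exists
    refine hφ2 _ (k, N) ?_
    simp only [hRdef, firstBits_length, Bool.and_eq_true, decide_eq_true_eq]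
    exact ⟨hk2, hN⟩
  -- the machine
  have hxc : Partrec (fun s => (φ s).map (fun z => S.x z.1)) :=
    hφ.map (S.compx.comp (Computable.fst.comp Computable.snd)).to₂
  let C : Computer :=
    { f := fun p => (U.f p).bind (fun s => (φ s).map (fun z => S.x z.1))
      partrec := U.partrec.bind (hxc.comp Computable.snd).to₂
      dom_nonempty := by
        obtain ⟨p, hp⟩ := optimal_outputs hU (firstBits T n0)
        refine ⟨p, ?_⟩
        obtain ⟨z, hz⟩ := Part.dom_iff_mem.1 (hdom n0 le_rfl)
        exact Part.dom_iff_mem.2 ⟨S.x z.1, Part.mem_bind hp (Part.mem_map _ hz)⟩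
      dom_prefixFree := by
        intro p hp q hq h
        have aux : ∀ p, p ∈ PFun.Dom (fun p => (U.f p).bind (fun s => (φ s).map (fun z => S.x z.1))) → p ∈ U.f.Dom := by
          intro p hp
          obtain ⟨y, hy⟩ := Part.dom_iff_mem.1 hp
          obtain ⟨s, hs, _⟩ := Part.mem_bind_iff.1 hy
          exact Part.dom_iff_mem.2 ⟨s, hs⟩
        exact U.dom_prefixFree p (aux p hp) q (aux q hq) h }
  obtain ⟨d, hd⟩ := hV C
  have key : ∀ n, n0 ≤ n → ∃ l : ℕ, 1 ≤ l ∧ l ≤ complexity U (firstBits T n) + d ∧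
      S.c₃ * (l * bw (1 / T) l) ≤ S.c₂ * (1 / T ^ 2 / 2 ^ n) := by
    intro n hn
    obtain ⟨p, hp, hpl⟩ := complexity_spec (optimal_outputs hU (firstBits T n))
    obtain ⟨⟨k, N⟩, hz⟩ := Part.dom_iff_mem.1 (hdom n hn)
    have hmem : S.x k ∈ C.f p := Part.mem_bind hp (Part.mem_map _ hz)
    obtain ⟨q, hq, hql⟩ := hd p (Part.dom_iff_mem.2 ⟨_, hmem⟩)
    rw [← hq] at hmem
    have hRz := hφ1 _ _ hz
    simp only [hRdef, firstBits_length, Bool.and_eq_true, decide_eq_true_eq] at hRz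
    obtain ⟨hkK, ht⟩ := hRz
    have hlt := htest n k N hkK ht
    have hqd : q ∈ V.f.Dom := Part.dom_iff_mem.2 ⟨_, hmem⟩
    have hqn : q ∉ S.D k := fun h => S.fresh k q h hmem
    obtain ⟨a1, a2⟩ := S.addL k hkK q hqd hqn
    refine ⟨q.length, a1, by omega, a2.trans ?_⟩
    obtain ⟨b1, b2⟩ := beta_bounds hT n (hval n).1 (hval n).2
    have h5 := (S.lip k hkK _ (hβ n hn)).2
    have h6 := mul_le_mul_of_nonneg_left b2 S.h₂.le
    linarith
  -- conclude
  unfold ChaitinTRandom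
  rw [tendsto_atTop]
  intro B
  set c' := S.c₂ * (1 / T ^ 2) / S.c₃ with hc'
  have key2 : ∀ n, n0 ≤ n → ∃ l : ℕ, 1 ≤ l ∧ l ≤ complexity U (firstBits T n) + d ∧
      (l:ℝ) * (2:ℝ) ^ ((n:ℝ) - l / T) ≤ c' := by
    intro n hn
    obtain ⟨l, h1, h2, h3⟩ := key n hn
    refine ⟨l, h1, h2, ?_⟩
    have e : (2:ℝ) ^ ((n:ℝ) - l / T) = 2 ^ n * bw (1 / T) l := by
      rw [sub_eq_add_neg, Real.rpow_add (by norm_num), Real.rpow_natCast, bw]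
      congr 2; ring
    rw [e, hc', le_div_iff₀ S.h₃]
    have hp : (0:ℝ) < 2 ^ n := by positivity
    have := mul_le_mul_of_nonneg_left h3 hp.le
    have e2 : (2:ℝ) ^ n * (S.c₂ * (1 / T ^ 2 / 2 ^ n)) = S.c₂ * (1 / T ^ 2) := by field_simp
    rw [e2] at this
    calc _ = (2:ℝ) ^ n * (S.c₃ * (l * bw (1 / T) l)) := by ring
      _ ≤ _ := this
  have hc'0 : 0 ≤ c' := by
    have := S.h₂; have := S.h₃; positivity
  set M := c' * (2:ℝ) ^ ((B + d) / T) with hM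
  have hbig : ∀ᶠ n : ℕ in atTop, c' * (2:ℝ) ^ (M / T) < (2:ℝ) ^ n :=
    (tendsto_pow_atTop_atTop_of_one_lt (by norm_num : (1:ℝ) < 2)).eventually_gt_atTop _
  filter_upwards [hbig, eventually_ge_atTop n0] with n hn1 hn2
  by_contra hcon
  rw [not_le] at hcon
  obtain ⟨l, h1, h2, h3⟩ := key2 n hn2
  have h1R : (1:ℝ) ≤ l := by exact_mod_cast h1
  have h2R : (l:ℝ) ≤ complexity U (firstBits T n) + d := by exact_mod_cast h2
  have hlM : (l:ℝ) ≤ M := by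
    have h4 : -((B + d) / T) ≤ (n:ℝ) - l / T := by
      have : (l:ℝ) / T ≤ (T * n + (B + d)) / T := div_le_div_of_nonneg_right (by linarith) hT0.le
      rw [add_div, mul_div_cancel_left₀ _ hT0.ne'] at this
      linarith
    have h5 : (2:ℝ) ^ (-((B + d) / T)) ≤ (2:ℝ) ^ ((n:ℝ) - l / T) :=
      Real.rpow_le_rpow_of_exponent_le (by norm_num) h4
    rw [Real.rpow_neg (by norm_num)] at h5
    have h6 := (mul_le_mul_of_nonneg_left h5 (by linarith : (0:ℝ) ≤ l)).trans h3
    have h7 : (0:ℝ) < (2:ℝ) ^ ((B + d) / T) := Real.rpow_pos_of_pos (by norm_num) _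
    rw [← div_eq_mul_inv, div_le_iff₀ h7] at h6
    exact h6
  have h8 : (2:ℝ) ^ ((n:ℝ) - l / T) ≤ c' := by
    have : 0 < (2:ℝ) ^ ((n:ℝ) - l / T) := Real.rpow_pos_of_pos (by norm_num) _
    nlinarith
  rw [Real.rpow_sub (by norm_num), Real.rpow_natCast, div_le_iff₀ (Real.rpow_pos_of_pos (by norm_num) _)] at h8
  have h9 : (2:ℝ) ^ ((l:ℝ) / T) ≤ (2:ℝ) ^ (M / T) :=
    Real.rpow_le_rpow_of_exponent_le (by norm_num) (div_le_div_of_nonneg_right hlM hT0.le)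
  have h10 := mul_le_mul_of_nonneg_left h9 hc'0
  linarith

def trues (n : ℕ) : List Bool := (List.range n).map (fun _ => true)

theorem trues_zero : trues 0 = [] := rfl
theorem trues_succ (n : ℕ) : trues (n + 1) = true :: trues n := by
  simp [trues, List.range_succ_eq_map]

theorem trues_length (n : ℕ) : (trues n).length = n := by simp [trues]

def blk (n : ℕ) (y : List Bool) : List Bool := trues n ++ false :: y

theorem blk_primrec : Primrec₂ blk := by
  unfold blk trues
  exact Primrec.list_append.comp
    (Primrec.list_map (Primrec.list_range.comp Primrec.fst) (Primrec.const true).to₂)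
    (Primrec.list_cons.comp (Primrec.const false) Primrec.snd)

theorem blk_cancel {n m : ℕ} {y z : List Bool} (h : blk n y <+: blk m z) : n = m ∧ y <+: z := by
  induction n generalizing m with
  | zero =>
    cases m with
    | zero => simpa [blk, trues_zero] using h
    | succ m => simp [blk, trues_zero, trues_succ] at h
  | succ n ih =>
    cases m with
    | zero => simp [blk, trues_zero, trues_succ] at h
    | succ m =>
      have : blk n y <+: blk m z := by simpa [blk, trues_succ] using h
      obtain ⟨h1, h2⟩ := ih this
      exact ⟨by rw [h1], h2⟩

theorem blk_length (n : ℕ) (y : List Bool) : (blk n y).length = n + 1 + y.length := by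
  simp [blk, trues_length]; omega

theorem tail_bound {T t : ℝ} (hT : 0 < T) (hTt : T < t) (ht : t < 1) :
    ∃ C : ℝ, 0 < C ∧ ∀ (n : ℕ) (A : Finset (List Bool)),
      ∑ p ∈ A, (2:ℝ)⁻¹ ^ p.length ≤ (2:ℝ) ^ (-(t * n)) → Ys A (1 / T) ≤ C / 2 ^ n := by
  have ht0 : 0 < t := hT.trans hTt
  have hδ : 0 < 1 / T - 1 / t := sub_pos.2 (one_div_lt_one_div_of_lt hT hTt)
  obtain ⟨C, hC, hb⟩ := exists_poly_bound hδ
  refine ⟨C, hC, fun n A hA => ?_⟩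
  have h1t : 0 < 1 / t - 1 := by
    rw [sub_pos, lt_div_iff₀ ht0]; linarith
  have hterm : ∀ p ∈ A, (p.length : ℝ) * bw (1 / T) p.length ≤
      C * (2:ℝ) ^ (-((1 - t) * n)) * (2:ℝ)⁻¹ ^ p.length := by
    intro p hp
    set l := p.length
    have h1 : (2:ℝ)⁻¹ ^ l ≤ (2:ℝ) ^ (-(t * n)) :=
      (Finset.single_le_sum (f := fun p : List Bool => (2:ℝ)⁻¹ ^ p.length)
        (fun _ _ => by positivity) hp).trans hA
    have h2 : t * n ≤ l := by
      rw [← bw_one, bw, Real.rpow_le_rpow_left_iff (by norm_num)] at h1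
      linarith
    have h3 : bw (1 / t - 1) l ≤ (2:ℝ) ^ (-((1 - t) * n)) := by
      unfold bw
      refine Real.rpow_le_rpow_of_exponent_le (by norm_num) (neg_le_neg ?_)
      calc (1 - t) * n = (1 / t - 1) * (t * n) := by field_simp
        _ ≤ (1 / t - 1) * l := mul_le_mul_of_nonneg_left h2 h1t.le
    have e : bw (1 / T) l = bw (1 / T - 1 / t) l * (bw (1 / t - 1) l * (2:ℝ)⁻¹ ^ l) := by
      rw [← bw_one, ← bw_add, ← bw_add]; congr 1; ring
    have h4 : (l:ℝ) * bw (1 / T - 1 / t) l ≤ C :=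
      (mul_le_mul_of_nonneg_right (nat_le_sq l) (bw_pos _ _).le).trans (hb l)
    rw [e, ← mul_assoc, ← mul_assoc]
    refine mul_le_mul_of_nonneg_right ?_ (by positivity)
    exact mul_le_mul h4 h3 (bw_pos _ _).le hC.le
  calc Ys A (1 / T) ≤ ∑ p ∈ A, C * (2:ℝ) ^ (-((1 - t) * n)) * (2:ℝ)⁻¹ ^ p.length :=
        Finset.sum_le_sum hterm
    _ = C * (2:ℝ) ^ (-((1 - t) * n)) * ∑ p ∈ A, (2:ℝ)⁻¹ ^ p.length := by rw [Finset.mul_sum]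
    _ ≤ C * (2:ℝ) ^ (-((1 - t) * n)) * (2:ℝ) ^ (-(t * n)) :=
        mul_le_mul_of_nonneg_left hA (mul_nonneg hC.le (Real.rpow_pos_of_pos (by norm_num) _).le)
    _ = C / 2 ^ n := by
        rw [mul_assoc, ← Real.rpow_add (by norm_num),
          show -((1 - t) * (n:ℝ)) + -(t * n) = -(n:ℝ) by ring, Real.rpow_neg (by norm_num),
          Real.rpow_natCast, div_eq_mul_inv]

/-- Soundness of the window search. -/
theorem window_sound {V : Computer} {T : ℝ} (hT : T ∈ Set.Ioo (0:ℝ) 1) (S : StageData V T) {C : ℝ}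
    (hC : 0 < C) {n k w : ℕ} (hk : S.K ≤ k) (hw : 2 ≤ w)
    (htail : Sfun V T - Ss (S.D k).toFinset (1 / T) ≤ S.c₄ * (C / 2 ^ n))
    (h1 : Sfun V T < Ss (S.D k).toFinset (2 ^ n / ((w + 1 : ℕ) : ℝ)))
    (h2 : Ss (S.D k).toFinset (2 ^ n / ((w - 1 : ℕ) : ℝ)) < Sfun V T) :
    ⌊T * 2 ^ n⌋₊ ≤ w ∧ w ≤ ⌊T * 2 ^ n⌋₊ + (⌈S.c₄ * C / S.c₁⌉₊ + 2) := by
  have hT0 := hT.1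
  have hp : (0:ℝ) < 2 ^ n := by positivity
  have hβT : (0:ℝ) < 1 / T := by positivity
  have hanti := S.anti k hk
  have hX0 : 0 ≤ S.c₄ * C / S.c₁ := by
    have := S.h₄; have := S.h₁; positivity
  have hX := Nat.le_ceil (S.c₄ * C / S.c₁)
  have hfl := Nat.lt_floor_add_one (T * 2 ^ n)
  constructor
  · have h3 : (2:ℝ) ^ n / ((w + 1 : ℕ) : ℝ) < 1 / T := by
      rw [← hanti.lt_iff_gt (Set.mem_Ioi.2 hβT) (Set.mem_Ioi.2 (by positivity))]
      exact (S.le k hk).trans_lt h1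
    rw [div_lt_div_iff₀ (by positivity) hT0] at h3
    have : ⌊T * 2 ^ n⌋₊ < w + 1 := (Nat.floor_lt (by positivity)).2 (by linarith)
    omega
  · have hw1 : ((w - 1 : ℕ) : ℝ) = (w:ℝ) - 1 := by
      rw [Nat.cast_sub (by omega)]; simp
    have hwR : (2:ℝ) ≤ w := by exact_mod_cast hw
    rw [hw1] at h2
    set u : ℝ := (w:ℝ) - 1 with hu
    have hu0 : 0 < u := by linarith
    have h4 : S.β₀ < 2 ^ n / u := by
      rw [← hanti.lt_iff_gt (Set.mem_Ioi.2 (by positivity)) (Set.mem_Ioi.2 (by linarith [S.hβ1]))]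
      exact h2.trans (S.big k hk)
    have h5 : u ≤ T * 2 ^ n + S.c₄ * C / S.c₁ := by
      rcases le_or_gt u (T * 2 ^ n) with h | h
      · linarith
      · have h6 : 2 ^ n / u ≤ 1 / T := by
          rw [div_le_div_iff₀ hu0 hT0]; linarith
        have h7 := (S.lip k hk _ ⟨h4.le, h6⟩).1
        have e : 1 / T - 2 ^ n / u = (u - T * 2 ^ n) / (T * u) := by field_simp
        have h8 : S.c₁ * ((u - T * 2 ^ n) / (T * u)) ≤ S.c₄ * (C / 2 ^ n) := by
          rw [← e]; linarith
        have h9 : u ≤ 2 ^ n := by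
          have : 1 < 2 ^ n / u := S.hβ1.trans h4
          rw [lt_div_iff₀ hu0] at this; linarith
        have h10 : (u - T * 2 ^ n) / 2 ^ n ≤ (u - T * 2 ^ n) / (T * u) := by
          refine div_le_div_of_nonneg_left (by linarith) (by positivity) ?_
          nlinarith [hT.2]
        have h11 := (mul_le_mul_of_nonneg_left h10 S.h₁.le).trans h8
        rw [← mul_div_assoc, ← mul_div_assoc, div_le_div_iff_of_pos_right hp] at h11
        have h12 : u - T * 2 ^ n ≤ S.c₄ * C / S.c₁ := by
          rw [le_div_iff₀ S.h₁]; linarith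
        linarith
    have : (w:ℝ) < ((⌊T * 2 ^ n⌋₊ + (⌈S.c₄ * C / S.c₁⌉₊ + 2) : ℕ) : ℝ) := by
      push_cast; linarith
    exact (Nat.cast_lt.1 this).le

/-- Existence of a window. -/
theorem window_exists {V : Computer} {T : ℝ} (hT : T ∈ Set.Ioo (0:ℝ) 1) (S : StageData V T)
    {n k : ℕ} (hk : S.K ≤ k) (hn : 3 ≤ T * 2 ^ n) :
    ∃ w : ℕ, 2 ≤ w ∧ Sfun V T < Ss (S.D k).toFinset (2 ^ n / ((w + 1 : ℕ) : ℝ)) ∧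
      Ss (S.D k).toFinset (2 ^ n / ((w - 1 : ℕ) : ℝ)) < Sfun V T := by
  classical
  have hT0 := hT.1
  have hp : (0:ℝ) < 2 ^ n := by positivity
  have hβT : (0:ℝ) < 1 / T := by positivity
  have hanti := S.anti k hk
  have hβ0 : 0 < S.β₀ := by linarith [S.hβ1]
  have hex : ∃ j : ℕ, 0 < j ∧ Sfun V T < Ss (S.D k).toFinset (2 ^ n / (j : ℝ)) := by
    have hc := Nat.le_ceil ((2:ℝ) ^ n / S.β₀)
    have hc0 : 0 < ⌈(2:ℝ) ^ n / S.β₀⌉₊ := Nat.ceil_pos.2 (by positivity)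
    have hc0R : (0:ℝ) < ⌈(2:ℝ) ^ n / S.β₀⌉₊ := by exact_mod_cast hc0
    refine ⟨_, hc0, (S.big k hk).trans_le ?_⟩
    refine hanti.antitoneOn (Set.mem_Ioi.2 (by positivity)) (Set.mem_Ioi.2 hβ0) ?_
    rw [div_le_iff₀ hβ0] at hc
    rw [div_le_iff₀ hc0R]; linarith
  obtain ⟨hj0, hj⟩ := Nat.find_spec hex
  have hmin := fun {m} => Nat.find_min hex (m := m)
  set j := Nat.find hex with hjdef
  have hj0R : (0:ℝ) < j := by exact_mod_cast hj0
  have hj3 : T * 2 ^ n < j := by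
    have h3 : (2:ℝ) ^ n / (j : ℝ) < 1 / T := by
      rw [← hanti.lt_iff_gt (Set.mem_Ioi.2 hβT) (Set.mem_Ioi.2 (by positivity))]
      exact (S.le k hk).trans_lt hj
    rw [div_lt_div_iff₀ (by positivity) hT0] at h3
    linarith
  have hj3' : 3 < j := by
    have : (3:ℝ) < j := by linarith
    exact_mod_cast this
  refine ⟨j - 1, by omega, ?_, ?_⟩
  · rwa [Nat.sub_add_cancel (by omega)]
  · have h1 : Ss (S.D k).toFinset (2 ^ n / ((j - 1 : ℕ) : ℝ)) ≤ Sfun V T := by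
      by_contra h
      exact hmin (m := j - 1) (by omega) ⟨by omega, not_le.1 h⟩
    refine lt_of_lt_of_le ?_ h1
    have a1 : (0:ℝ) < ((j - 1 - 1 : ℕ) : ℝ) := by
      have : 0 < j - 1 - 1 := by omega
      exact_mod_cast this
    have a2 : ((j - 1 - 1 : ℕ) : ℝ) < ((j - 1 : ℕ) : ℝ) := by
      have : j - 1 - 1 < j - 1 := by omega
      exact_mod_cast this
    have a3 : (0:ℝ) < ((j - 1 : ℕ) : ℝ) := a1.trans a2
    refine hanti (Set.mem_Ioi.2 (by positivity)) (Set.mem_Ioi.2 (by positivity)) ?_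
    exact div_lt_div_of_pos_left hp a1 a2

def omN (Ls : List ℕ) (N : ℕ) : ℕ := (Ls.map (fun l => 2 ^ N / 2 ^ l)).sum

theorem omN_comp {α : Type} [Primcodable α] {L : α → List ℕ} {N : α → ℕ} (hL : Computable L)
    (hN : Computable N) : Computable (fun x => omN (L x) (N x)) := by
  have h : Primrec (fun t : List ℕ × ℕ => omN t.1 t.2) := by
    unfold omN
    refine list_sum_primrec.comp (Primrec.list_map Primrec.fst ?_)
    exact Primrec.nat_div.comp
      (primrec_pow.comp (Primrec.const 2) (Primrec.snd.comp Primrec.fst))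
      (primrec_pow.comp (Primrec.const 2) Primrec.snd)
  have h' := h.to_comp.comp (hL.pair hN)
  exact h'

theorem omN_le (D : List (List Bool)) (N : ℕ) :
    (omN (D.map List.length) N : ℝ) ≤ 2 ^ N * (D.map (fun p => (2:ℝ)⁻¹ ^ p.length)).sum := by
  induction D with
  | nil => simp [omN]
  | cons p D ih =>
    simp only [omN, List.map_cons, List.sum_cons] at ih ⊢
    rw [Nat.cast_add, mul_add]
    refine add_le_add ?_ ih
    refine (Nat.cast_div_le).trans ?_
    push_cast
    rw [inv_pow, div_eq_mul_inv]

theorem omN_eq (D : List (List Bool)) :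
    ∀ᶠ N in atTop, (omN (D.map List.length) N : ℝ) = 2 ^ N * (D.map (fun p => (2:ℝ)⁻¹ ^ p.length)).sum := by
  induction D with
  | nil => simp [omN]
  | cons p D ih =>
    filter_upwards [ih, eventually_ge_atTop p.length] with N hN hp
    simp only [omN, List.map_cons, List.sum_cons] at hN ⊢
    rw [Nat.cast_add, mul_add, hN]
    congr 1
    rw [Nat.cast_div (pow_dvd_pow 2 hp) (by positivity)]
    push_cast
    rw [inv_pow, div_eq_mul_inv]

theorem omega_bits {V : Computer} {T : ℝ} (S : StageData V T) (L : ℕ) :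
    ∃ m : ℕ, m < 2 ^ L ∧
      (∀ k N, m * 2 ^ N ≤ 2 ^ L * omN ((S.D k).map List.length) N → ∀ k', k ≤ k' →
        ∑ p ∈ (S.D k').toFinset \ (S.D k).toFinset, (2:ℝ)⁻¹ ^ p.length ≤ (2:ℝ)⁻¹ ^ L) ∧
      (∀ᶠ k in atTop, ∀ᶠ N in atTop, m * 2 ^ N ≤ 2 ^ L * omN ((S.D k).map List.length) N) := by
  set om : ℕ → ℝ := fun k => ∑ p ∈ (S.D k).toFinset, (2:ℝ)⁻¹ ^ p.length with hom
  have hlist : ∀ k, ((S.D k).map (fun p => (2:ℝ)⁻¹ ^ p.length)).sum = om k := fun k =>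
    (List.sum_toFinset _ (S.nodup k)).symm
  have hsub : ∀ k k', k ≤ k' → (S.D k).toFinset ⊆ (S.D k').toFinset := by
    intro k k' h r hr
    rw [List.mem_toFinset] at hr ⊢
    exact S.mono k k' h r hr
  have hdiff : ∀ k k', k ≤ k' →
      ∑ p ∈ (S.D k').toFinset \ (S.D k).toFinset, (2:ℝ)⁻¹ ^ p.length = om k' - om k := by
    intro k k' h
    have := Finset.sum_sdiff (f := fun p : List Bool => (2:ℝ)⁻¹ ^ p.length) (hsub k k' h)
    simp only [hom]; linarith
  have hmono : Monotone om := by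
    intro k k' h
    have h1 := hdiff k k' h
    have : 0 ≤ ∑ p ∈ (S.D k').toFinset \ (S.D k).toFinset, (2:ℝ)⁻¹ ^ p.length :=
      Finset.sum_nonneg fun _ _ => by positivity
    linarith
  have hle1 : ∀ k, om k ≤ 1 := fun k => Kr_of_dom V _ (fun p hp => S.dom k p (List.mem_toFinset.1 hp))
  have hbdd : BddAbove (Set.range om) := ⟨1, by rintro _ ⟨k, rfl⟩; exact hle1 k⟩
  have hlim := tendsto_atTop_ciSup hmono hbdd
  set Ω := ⨆ k, om k
  have hΩ1 : Ω ≤ 1 := ciSup_le hle1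
  have hΩ : ∀ k, om k ≤ Ω := fun k => le_ciSup hbdd k
  have hΩ0 : 0 < Ω := by
    refine lt_of_lt_of_le ?_ (hΩ S.K)
    refine Finset.sum_pos (fun _ _ => by positivity) ?_
    obtain ⟨r, hr⟩ := List.exists_mem_of_ne_nil _ (S.ne S.K le_rfl)
    exact ⟨r, List.mem_toFinset.2 hr⟩
  have hp : (0:ℝ) < 2 ^ L := by positivity
  have hcp : 0 < ⌈Ω * 2 ^ L⌉₊ := Nat.ceil_pos.2 (by positivity)
  have hmc : ((⌈Ω * 2 ^ L⌉₊ - 1 : ℕ) : ℝ) = (⌈Ω * 2 ^ L⌉₊ : ℝ) - 1 := by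
    rw [Nat.cast_sub (by omega)]; simp
  have hm1 : ((⌈Ω * 2 ^ L⌉₊ - 1 : ℕ) : ℝ) < Ω * 2 ^ L := by
    rw [hmc]; linarith [Nat.ceil_lt_add_one (show 0 ≤ Ω * 2 ^ L by positivity)]
  have hm2 : Ω * 2 ^ L - 1 ≤ ((⌈Ω * 2 ^ L⌉₊ - 1 : ℕ) : ℝ) := by
    rw [hmc]; linarith [Nat.le_ceil (Ω * 2 ^ L)]
  generalize (⌈Ω * 2 ^ L⌉₊ - 1 : ℕ) = m at hm1 hm2
  refine ⟨m, ?_, ?_, ?_⟩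
  · have : (m:ℝ) < ((2 ^ L : ℕ) : ℝ) := by
      push_cast
      nlinarith
    exact_mod_cast this
  · intro k N h k' hk'
    rw [hdiff k k' hk']
    have h1 : (m:ℝ) * 2 ^ N ≤ 2 ^ L * omN ((S.D k).map List.length) N := by exact_mod_cast h
    have h2 := omN_le (S.D k) N
    rw [hlist] at h2
    have hN : (0:ℝ) < 2 ^ N := by positivity
    have h3 : (m:ℝ) * 2 ^ N ≤ (2 ^ L * om k) * 2 ^ N := by
      calc _ ≤ _ := h1
        _ ≤ 2 ^ L * (2 ^ N * om k) := mul_le_mul_of_nonneg_left h2 hp.le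
        _ = _ := by ring
    have h4 := le_of_mul_le_mul_right h3 hN
    rw [inv_pow, inv_eq_one_div, le_div_iff₀ hp]
    have h5 := mul_le_mul_of_nonneg_right (hΩ k') hp.le
    nlinarith
  · have hml : (m:ℝ) / 2 ^ L < Ω := by rw [div_lt_iff₀ hp]; exact hm1
    filter_upwards [hlim.eventually (lt_mem_nhds hml)] with k hk
    filter_upwards [omN_eq (S.D k)] with N hN
    rw [hlist] at hN
    rw [div_lt_iff₀ hp] at hk
    have : (m:ℝ) * 2 ^ N ≤ 2 ^ L * omN ((S.D k).map List.length) N := by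
      rw [hN]
      have hNp : (0:ℝ) < 2 ^ N := by positivity
      have := mul_le_mul_of_nonneg_right hk.le hNp.le
      linarith
    exact_mod_cast this

theorem partB_step {U V : Computer} (hU : Optimal U) {T : ℝ}
    (hT : T ∈ Set.Ioo (0:ℝ) 1) (S : StageData V T) (a b : ℕ) (hb : 0 < b)
    (hat : T < (a:ℝ) / b) (hat1 : (a:ℝ) / b < 1) :
    ∃ c n0 : ℕ, ∀ n, n0 ≤ n →
      complexity U (firstBits T n) ≤ 3 * Nat.sqrt n + c + n * a / b := by
  have hT0 := hT.1
  obtain ⟨C, hC, htail⟩ := tail_bound hT0 hat hat1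
  set Cc := ⌈S.c₄ * C / S.c₁⌉₊ + 2 with hCc
  -- witnesses: ((q, e, ρ, y), (k, N, s, w))
  let W := (ℕ × ℕ × ℕ × List Bool) × (ℕ × ℕ × List Bool × ℕ)
  let P : List Bool × W → Bool := fun z =>
    decide (z.1 = blk z.2.1.1 (blk z.2.1.2.1 (blk z.2.1.2.2.1 z.2.1.2.2.2))) &&
    (decide (z.2.2.2.2.1.length = z.2.1.1 * z.2.1.1 + z.2.1.2.1) &&
    (decide (z.2.1.2.2.2.length = (z.2.1.1 * z.2.1.1 + z.2.1.2.1) * a / b + 1) &&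
    (decide (S.K ≤ z.2.2.1) &&
    (decide (bval z.2.1.2.2.2 * 2 ^ z.2.2.2.1 ≤
      2 ^ z.2.1.2.2.2.length * omN ((S.D z.2.2.1).map List.length) z.2.2.2.1) &&
    (decide (2 ≤ z.2.2.2.2.2) &&
    (test1 ((S.D z.2.2.1).map List.length) (2 ^ z.2.2.2.2.1.length) (z.2.2.2.2.2 + 1) z.2.2.2.1 (S.g z.2.2.2.1) &&
    (test2 ((S.D z.2.2.1).map List.length) (2 ^ z.2.2.2.2.1.length) (z.2.2.2.2.2 - 1) z.2.2.2.1 (S.g z.2.2.2.1) &&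
    (decide (bval z.2.2.2.2.1 ≤ z.2.2.2.2.2) &&
    (decide (z.2.2.2.2.2 ≤ bval z.2.2.2.2.1 + Cc) &&
    decide (bval z.2.2.2.2.1 % (Cc + 1) = z.2.1.2.2.1))))))))))
  have cq : Computable (fun z : List Bool × W => z.2.1.1) :=
    Computable.fst.comp (Computable.fst.comp Computable.snd)
  have ce : Computable (fun z : List Bool × W => z.2.1.2.1) :=
    Computable.fst.comp (Computable.snd.comp (Computable.fst.comp Computable.snd))
  have cr : Computable (fun z : List Bool × W => z.2.1.2.2.1) :=
    Computable.fst.comp (Computable.snd.comp (Computable.snd.comp (Computable.fst.comp Computable.snd)))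
  have cy : Computable (fun z : List Bool × W => z.2.1.2.2.2) :=
    Computable.snd.comp (Computable.snd.comp (Computable.snd.comp (Computable.fst.comp Computable.snd)))
  have ck : Computable (fun z : List Bool × W => z.2.2.1) :=
    Computable.fst.comp (Computable.snd.comp Computable.snd)
  have cN : Computable (fun z : List Bool × W => z.2.2.2.1) :=
    Computable.fst.comp (Computable.snd.comp (Computable.snd.comp Computable.snd))
  have cs : Computable (fun z : List Bool × W => z.2.2.2.2.1) :=
    Computable.fst.comp (Computable.snd.comp (Computable.snd.comp (Computable.snd.comp Computable.snd)))
  have cw : Computable (fun z : List Bool × W => z.2.2.2.2.2) :=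
    Computable.snd.comp (Computable.snd.comp (Computable.snd.comp (Computable.snd.comp Computable.snd)))
  have cblk : ∀ {f : List Bool × W → ℕ} {h : List Bool × W → List Bool}, Computable f → Computable h →
      Computable (fun z => blk (f z) (h z)) := fun hf hh => blk_primrec.to_comp.comp hf hh
  have clen : ∀ {h : List Bool × W → List Bool}, Computable h →
      Computable (fun z => (h z).length) := fun hh => Primrec.list_length.to_comp.comp hh
  have cval : ∀ {h : List Bool × W → List Bool}, Computable h →
      Computable (fun z => bval (h z)) := fun hh => bval_primrec.to_comp.comp hh
  have cadd : ∀ {f h : List Bool × W → ℕ}, Computable f → Computable h →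
      Computable (fun z => f z + h z) := fun hf hh => Primrec.nat_add.to_comp.comp hf hh
  have csub : ∀ {f h : List Bool × W → ℕ}, Computable f → Computable h →
      Computable (fun z => f z - h z) := fun hf hh => Primrec.nat_sub.to_comp.comp hf hh
  have cmul : ∀ {f h : List Bool × W → ℕ}, Computable f → Computable h →
      Computable (fun z => f z * h z) := fun hf hh => Primrec.nat_mul.to_comp.comp hf hh
  have cdiv : ∀ {f h : List Bool × W → ℕ}, Computable f → Computable h →
      Computable (fun z => f z / h z) := fun hf hh => Primrec.nat_div.to_comp.comp hf hh
  have cmod : ∀ {f h : List Bool × W → ℕ}, Computable f → Computable h →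
      Computable (fun z => f z % h z) := fun hf hh => Primrec.nat_mod.to_comp.comp hf hh
  have c0 : ∀ m : ℕ, Computable (fun _ : List Bool × W => m) := fun m => Computable.const m
  have cn := cadd (cmul cq cq) ce
  have cL := lengths_comp (S.compD.comp ck)
  have hP : Computable P :=
    and_comp (eq_comp Computable.fst (cblk cq (cblk ce (cblk cr cy)))) <|
    and_comp (eq_comp (clen cs) cn) <|
    and_comp (eq_comp (clen cy) (cadd (cdiv (cmul cn (c0 a)) (c0 b)) (c0 1))) <|
    and_comp (le_comp (c0 _) ck) <|
    and_comp (le_comp (cmul (cval cy) (pow_comp (c0 2) cN))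
      (cmul (pow_comp (c0 2) (clen cy)) (omN_comp cL cN))) <|
    and_comp (le_comp (c0 2) cw) <|
    and_comp (test1_comp cL (pow_comp (c0 2) (clen cs)) (cadd cw (c0 1)) cN (S.compg.comp cN)) <|
    and_comp (test2_comp cL (pow_comp (c0 2) (clen cs)) (csub cw (c0 1)) cN (S.compg.comp cN)) <|
    and_comp (le_comp (cval cs) cw) <|
    and_comp (le_comp cw (cadd (cval cs) (c0 Cc))) (eq_comp (cmod (cval cs) (c0 _)) cr)
  obtain ⟨φ, hφ, hφ1, hφ2⟩ := exists_selector hP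
  have hPiff : ∀ (x : List Bool) (q e r : ℕ) (y : List Bool) (k N : ℕ) (s : List Bool) (w : ℕ),
      P (x, ((q, e, r, y), (k, N, s, w))) = true ↔
      x = blk q (blk e (blk r y)) ∧ s.length = q * q + e ∧ y.length = (q * q + e) * a / b + 1 ∧
      S.K ≤ k ∧ bval y * 2 ^ N ≤ 2 ^ y.length * omN ((S.D k).map List.length) N ∧ 2 ≤ w ∧
      test1 ((S.D k).map List.length) (2 ^ s.length) (w + 1) N (S.g N) = true ∧
      test2 ((S.D k).map List.length) (2 ^ s.length) (w - 1) N (S.g N) = true ∧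
      bval s ≤ w ∧ w ≤ bval s + Cc ∧ bval s % (Cc + 1) = r := by
    intros
    simp only [P, Bool.and_eq_true, decide_eq_true_eq]
  clear_value P
  have hL : ∀ n : ℕ, (2:ℝ)⁻¹ ^ (n * a / b + 1) ≤ (2:ℝ) ^ (-((a:ℝ) / b * n)) := by
    intro n
    rw [← bw_one, bw]
    refine Real.rpow_le_rpow_of_exponent_le (by norm_num) (neg_le_neg ?_)
    have h1 : n * a < (n * a / b + 1) * b := by
      have h2 := Nat.div_add_mod (n * a) b
      have h3 := Nat.mod_lt (n * a) hb
      nlinarith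
    have hbR : (0:ℝ) < b := by exact_mod_cast hb
    have h2 : (n:ℝ) * a < ((n * a / b + 1 : ℕ) : ℝ) * b := by exact_mod_cast h1
    rw [one_mul, div_mul_eq_mul_div, div_le_iff₀ hbR]
    linarith
  choose m hm1 hm2 hm3 using fun n => omega_bits S (n * a / b + 1)
  choose y hy1 hy2 using fun n => exists_bval (n * a / b + 1) (m n) (hm1 n)
  -- the program for `T↾n`
  let pr : ℕ → List Bool := fun n =>
    blk (Nat.sqrt n) (blk (n - Nat.sqrt n * Nat.sqrt n) (blk (bval (firstBits T n) % (Cc + 1)) (y n)))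
  have hsq : ∀ n, Nat.sqrt n * Nat.sqrt n + (n - Nat.sqrt n * Nat.sqrt n) = n := fun n => by
    have := Nat.sqrt_le n; omega
  have hfl : ∀ n, bval (firstBits T n) = ⌊T * 2 ^ n⌋₊ := bval_firstBits hT0.le hT.2
  have sound : ∀ n z, z ∈ φ (pr n) → z.2.2.2.1 = firstBits T n := by
    rintro n ⟨⟨q, e, r, y'⟩, ⟨k, N, s, w⟩⟩ hz
    have hz' := (hPiff _ _ _ _ _ _ _ _ _).1 (hφ1 _ _ hz)
    obtain ⟨z1, z2, z3, z4, z5, z6, z7, z8, z9, z10, z11⟩ := hz'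
    obtain ⟨rfl, zA⟩ := blk_cancel (z1 ▸ List.prefix_refl _ : pr n <+: blk q (blk e (blk r y')))
    obtain ⟨rfl, zB⟩ := blk_cancel zA
    obtain ⟨rfl, zC⟩ := blk_cancel zB
    rw [hsq] at z2 z3
    have hyy : y n = y' := zC.eq_of_length (by rw [hy1, z3])
    subst hyy
    rw [hy1, hy2] at z5
    have t1 := (tests_spec (S.nodup k) (S.ne k z4) (2 ^ n) (j := w + 1) (by omega) S.hg).1 N (by rwa [z2] at z7)
    have t2 := (tests_spec (S.nodup k) (S.ne k z4) (2 ^ n) (j := w - 1) (by omega) S.hg).2.1 N (by rwa [z2] at z8)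
    rw [Nat.cast_pow, Nat.cast_ofNat] at t1 t2
    have htl := S.addU k z4 (C / 2 ^ n) (fun k' hk' =>
      htail n _ ((hm2 n k N z5 k' hk').trans (hL n)))
    obtain ⟨w1, w2⟩ := window_sound hT S hC z4 z6 htl t1 t2
    refine bval_inj (by rw [z2, firstBits_length]) ?_
    show bval s = _
    rw [hfl n] at z11 ⊢
    rw [← hCc] at w2
    generalize ⌊T * 2 ^ n⌋₊ = v at *
    have hmodeq : bval s ≡ v [MOD (Cc + 1)] := z11
    rcases le_total (bval s) v with h | h
    · have hd := (Nat.modEq_iff_dvd' h).1 hmodeq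
      have := Nat.eq_zero_of_dvd_of_lt hd (by omega)
      omega
    · have hd := (Nat.modEq_iff_dvd' h).1 hmodeq.symm
      have := Nat.eq_zero_of_dvd_of_lt hd (by omega)
      omega
  have hlarge : ∀ᶠ n : ℕ in atTop, (3:ℝ) ≤ T * 2 ^ n :=
    ((tendsto_pow_atTop_atTop_of_one_lt (by norm_num : (1:ℝ) < 2)).const_mul_atTop hT0).eventually_ge_atTop _
  obtain ⟨n0, hn0⟩ := eventually_atTop.1 hlarge
  have exist : ∀ n, n0 ≤ n → (φ (pr n)).Dom := by
    intro n hn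
    obtain ⟨k, hk1, hk2⟩ := ((hm3 n).and (eventually_ge_atTop S.K)).exists
    obtain ⟨w, hw2, t1, t2⟩ := window_exists hT S hk2 (hn0 n hn)
    have u1 := (tests_spec (S.nodup k) (S.ne k hk2) (2 ^ n) (j := w + 1) (by omega) S.hg).2.2.1
    have u2 := (tests_spec (S.nodup k) (S.ne k hk2) (2 ^ n) (j := w - 1) (by omega) S.hg).2.2.2
    rw [Nat.cast_pow, Nat.cast_ofNat] at u1 u2
    obtain ⟨N, hN1, hN2, hN3⟩ := (hk1.and ((u1 t1).and (u2 t2))).exists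
    have htl := S.addU k hk2 (C / 2 ^ n) (fun k' hk' =>
      htail n _ ((hm2 n k N hN1 k' hk').trans (hL n)))
    obtain ⟨w1, w2⟩ := window_sound hT S hC hk2 hw2 htl t1 t2
    refine hφ2 _ ((Nat.sqrt n, n - Nat.sqrt n * Nat.sqrt n, bval (firstBits T n) % (Cc + 1), y n),
      (k, N, firstBits T n, w)) ?_
    rw [hPiff, hsq, firstBits_length, hfl]
    exact ⟨by simp only [pr, hfl], rfl, hy1 n, hk2, by rw [hy1, hy2]; exact hN1, hw2, hN2, hN3, w1, w2, rfl⟩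
  let Cm : Computer :=
    { f := fun p => (φ p).map (fun z => z.2.2.2.1)
      partrec := hφ.map (Computable.fst.comp (Computable.snd.comp (Computable.snd.comp
        (Computable.snd.comp Computable.snd)))).to₂
      dom_nonempty := ⟨pr n0, exist n0 le_rfl⟩
      dom_prefixFree := by
        intro p hp q hq h
        obtain ⟨⟨⟨q1, e1, r1, y1⟩, ⟨k1, N1, s1, w1⟩⟩, hz1⟩ := Part.dom_iff_mem.1 (show (φ p).Dom from hp)
        obtain ⟨⟨⟨q2, e2, r2, y2⟩, ⟨k2, N2, s2, w2⟩⟩, hz2⟩ := Part.dom_iff_mem.1 (show (φ q).Dom from hq)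
        obtain ⟨a1, -, a3, -⟩ := (hPiff _ _ _ _ _ _ _ _ _).1 (hφ1 _ _ hz1)
        obtain ⟨b1, -, b3, -⟩ := (hPiff _ _ _ _ _ _ _ _ _).1 (hφ1 _ _ hz2)
        subst a1 b1
        obtain ⟨rfl, hA⟩ := blk_cancel h
        obtain ⟨rfl, hB⟩ := blk_cancel hA
        obtain ⟨rfl, hC'⟩ := blk_cancel hB
        rw [hC'.eq_of_length (by rw [a3, b3])] }
  obtain ⟨d, hd⟩ := hU Cm
  refine ⟨Cc + 4 + d, n0, fun n hn => ?_⟩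
  obtain ⟨q, hq, hql⟩ := hd (pr n) (exist n hn)
  obtain ⟨z, hz⟩ := Part.dom_iff_mem.1 (exist n hn)
  have hmem : firstBits T n ∈ U.f q := by
    rw [hq, ← sound n z hz]
    exact Part.mem_map (fun z : W => z.2.2.2.1) hz
  refine (complexity_le hmem).trans (hql.trans ?_)
  have hlen : (pr n).length = Nat.sqrt n + 1 + ((n - Nat.sqrt n * Nat.sqrt n) + 1 +
      (bval (firstBits T n) % (Cc + 1) + 1 + (n * a / b + 1))) := by
    simp only [pr, blk_length, hy1]
  rw [hlen]
  have h1 := Nat.mod_lt (bval (firstBits T n)) (show 0 < Cc + 1 by omega)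
  have h2 := Nat.sqrt_le_add n
  omega

theorem partB {U V : Computer} (hU : Optimal U) {T : ℝ}
    (hT : T ∈ Set.Ioo (0:ℝ) 1) (S : StageData V T) : TCompressible U T T := by
  refine ⟨fun n => max 0 ((complexity U (firstBits T n) : ℝ) - T * n), ?_, fun n _ => by
    linarith [le_max_right 0 ((complexity U (firstBits T n) : ℝ) - T * n)]⟩
  have hT0 := hT.1
  rw [Metric.tendsto_nhds]
  intro ε hε
  obtain ⟨r, hr1, hr2⟩ := exists_rat_btwn (lt_min hT.2 (show T < T + ε / 2 by linarith))
  have hr0 : 0 < r := by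
    have : (0:ℝ) < r := hT0.trans hr1
    exact_mod_cast this
  have hre : (r:ℝ) = (r.num.toNat : ℝ) / (r.den : ℝ) := by
    have h1 : ((r.num.toNat : ℤ)) = r.num := Int.toNat_of_nonneg (Rat.num_pos.2 hr0).le
    have h2 : (r.num.toNat : ℝ) = (r.num : ℝ) := by exact_mod_cast h1
    rw [h2]; exact Rat.cast_def r
  obtain ⟨c, n0, hn0⟩ := partB_step hU hT S r.num.toNat r.den r.den_pos (by rw [← hre]; exact hr1)
    (by rw [← hre]; exact hr2.trans_le (min_le_left _ _))
  have hlim : Tendsto (fun n : ℕ => 3 * (Real.sqrt n)⁻¹ + (c:ℝ) / n) atTop (𝓝 (3 * 0 + 0)) := by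
    refine Tendsto.add (Tendsto.const_mul 3 ?_) (tendsto_const_div_atTop_nhds_zero_nat _)
    exact tendsto_inv_atTop_zero.comp (Real.tendsto_sqrt_atTop.comp tendsto_natCast_atTop_atTop)
  have hev := hlim.eventually (gt_mem_nhds (show 3 * 0 + 0 < ε / 2 by linarith))
  filter_upwards [hev, eventually_ge_atTop n0, eventually_gt_atTop 0] with n h1 h2 h3
  have hnR : (0:ℝ) < n := by exact_mod_cast h3
  rw [Real.dist_eq, sub_zero, abs_of_nonneg (by positivity), div_lt_iff₀ hnR, max_lt_iff]
  refine ⟨by positivity, ?_⟩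
  have h4 : (complexity U (firstBits T n) : ℝ) ≤ 3 * Nat.sqrt n + c + ((n * r.num.toNat / r.den : ℕ) : ℝ) := by
    exact_mod_cast hn0 n h2
  have h5 : ((n * r.num.toNat / r.den : ℕ) : ℝ) ≤ n * r := by
    refine Nat.cast_div_le.trans ?_
    rw [hre]; push_cast; rw [mul_div_assoc]
  have h6 : (Nat.sqrt n : ℝ) ≤ Real.sqrt n := Real.nat_sqrt_le_real_sqrt
  have h7 : (n:ℝ) * r ≤ n * (T + ε / 2) :=
    mul_le_mul_of_nonneg_left (hr2.le.trans (min_le_right _ _)) hnR.le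
  have h8 := mul_lt_mul_of_pos_right h1 hnR
  have h9 : (3 * (Real.sqrt n)⁻¹ + (c:ℝ) / n) * n = 3 * Real.sqrt n + c := by
    have hs : 0 < Real.sqrt n := Real.sqrt_pos.2 hnR
    have e : (Real.sqrt n)⁻¹ * n = Real.sqrt n := by
      rw [inv_mul_eq_div, div_eq_iff hs.ne']; exact (Real.mul_self_sqrt hnR.le).symm
    rw [add_mul, mul_assoc, e, div_mul_cancel₀ _ hnR.ne']
  rw [h9] at h8
  linarith

/-- Fixed point theorem for `S`. If `V` is optimal, `T ∈ (0,1)`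
and `S_V(T)` is computable, then `T` is Chaitin `T`-random and
`T`-compressible. -/
theorem fixedPoint_of_entropy_computable
    (U : Computer) (hU : Optimal U) (V : Computer) (hV : Optimal V)
    (T : ℝ) (hT : T ∈ Set.Ioo (0 : ℝ) 1) (hS : ComputableReal (Sfun V T)) :
    ChaitinTRandom U T T ∧ TCompressible U T T := by
  obtain ⟨S⟩ := exists_stageData hV hT hS
  exact ⟨partA hU hV hT S, partB hU hT S⟩
end

section
/- Let V be an optimal computer. Then 𝒵(V) ∩ ℱ(V) = ∅; that is, there is no T ∈ (0,1) such that both Z_V(T) and F_V(T) are computable reals. -/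
open Filter Topology

open Encodable

namespace ZFProof

/-- Computable finite sums. -/
theorem comp_sum {α : Type*} [Primcodable α] {f : α → ℕ → ℕ} {g : α → ℕ}
    (hf : Computable₂ f) (hg : Computable g) :
    Computable fun a => ∑ i ∈ Finset.range (g a), f a i := by
  have h : Computable₂ (fun (a : α) (p : ℕ × ℕ) => p.2 + f a p.1) :=
    (Primrec.nat_add.to_comp.comp (Computable.snd.comp Computable.snd)
      (hf.comp Computable.fst (Computable.fst.comp Computable.snd))).to₂
  refine (Computable.nat_rec hg (Computable.const 0) h).of_eq fun a => ?_
  induction g a with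
  | zero => simp
  | succ n ih => simp only [ih, Finset.sum_range_succ]

theorem prim_pow : Primrec₂ (fun a b : ℕ => a ^ b) := by
  have h : Primrec₂ (fun (a : ℕ × ℕ) (p : ℕ × ℕ) => p.2 * a.1) :=
    (Primrec.nat_mul.comp (Primrec.snd.comp Primrec.snd) (Primrec.fst.comp Primrec.fst)).to₂
  refine (Primrec.nat_rec' (Primrec.snd (α := ℕ) (β := ℕ)) (Primrec.const 1) h).of_eq fun a => ?_
  induction a.2 with
  | zero => simp
  | succ n ih => simp only [ih, pow_succ]

/-- The code of a rational under the (non-denumerable) encoding. -/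
def oldEnc (q : ℚ) : ℕ := @encode ℚ Rat.instEncodable q

/-- The code of a rational under the denumerable encoding. -/
def newEnc (q : ℚ) : ℕ := @encode ℚ Primcodable.toEncodable q

theorem comp_newEnc : Computable newEnc := Computable.encode

theorem enc_eq (q : ℚ) : ∃ inst : DecidablePred (fun m => m ∈ Set.range oldEnc), newEnc q =
    (List.range (oldEnc q)).countP (fun m => @decide (m ∈ Set.range oldEnc) (inst m)) :=
  ⟨@decidableRangeEncode ℚ Rat.instEncodable, rfl⟩

theorem old_eq (q : ℚ) : oldEnc q = Nat.pair (if 0 ≤ q.num then 2 * q.num.natAbs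
    else 2 * (q.num.natAbs - 1) + 1) q.den := by
  rcases q with ⟨a | a, b, c, d⟩
  · simp; rfl
  · simp; rfl

theorem prim_dvd : PrimrecRel (fun a b : ℕ => a ∣ b) := by
  have : PrimrecRel (fun a b : ℕ => b % a = 0) :=
    Primrec.eq.comp₂ (Primrec.nat_mod.comp₂ Primrec₂.right Primrec₂.left) (Primrec₂.const 0)
  exact this.of_eq fun a b => (Nat.dvd_iff_mod_eq_zero).symm

/-- Valid codes of rationals. -/
def Valid (m : ℕ) : Prop := 0 < m.unpair.2 ∧ ((m.unpair.1 + 1) / 2).Coprime m.unpair.2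

theorem valid_iff (m : ℕ) : Valid m ↔ m ∈ Set.range oldEnc := by
  constructor
  · rintro ⟨h1, h2⟩
    rcases Nat.even_or_odd' m.unpair.1 with ⟨k, hk | hk⟩
    · rw [hk] at h2
      have e : (2 * k + 1) / 2 = k := by omega
      rw [e] at h2
      refine ⟨⟨(k : ℤ), m.unpair.2, h1.ne', by simpa using h2⟩, ?_⟩
      rw [old_eq]
      simp
      rw [← hk, Nat.pair_unpair]
    · rw [hk] at h2
      have e : (2 * k + 1 + 1) / 2 = k + 1 := by omega
      rw [e] at h2
      refine ⟨⟨Int.negSucc k, m.unpair.2, h1.ne', by simpa using h2⟩, ?_⟩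
      rw [old_eq]
      simp
      rw [← hk, Nat.pair_unpair]
  · rintro ⟨q, rfl⟩
    rw [Valid, old_eq]
    simp only [Nat.unpair_pair]
    refine ⟨q.den_pos, ?_⟩
    have := q.reduced
    split_ifs with h
    · have e : (2 * q.num.natAbs + 1) / 2 = q.num.natAbs := by omega
      rwa [e]
    · have e : (2 * (q.num.natAbs - 1) + 1 + 1) / 2 = q.num.natAbs := by omega
      rwa [e]

theorem coprime_iff (x d : ℕ) (hd : 0 < d) :
    x.Coprime d ↔ ∀ k < d + 1, (k ∣ x → k ∣ d → k = 1) := by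
  constructor
  · intro h k _ h1 h2
    exact Nat.eq_one_of_dvd_coprimes h h1 h2
  · intro h
    exact h _ (Nat.lt_succ_of_le (Nat.gcd_le_right _ hd)) (Nat.gcd_dvd_left _ _)
      (Nat.gcd_dvd_right _ _)

theorem prim_valid : PrimrecPred Valid := by
  have hx : Primrec (fun m : ℕ => (m.unpair.1 + 1) / 2) :=
    Primrec.nat_div.comp (Primrec.succ.comp (Primrec.fst.comp Primrec.unpair)) (Primrec.const 2)
  have hd : Primrec (fun m : ℕ => m.unpair.2) := Primrec.snd.comp Primrec.unpair
  have hR : PrimrecRel (fun k m : ℕ => ¬ (k ∣ (m.unpair.1 + 1) / 2) ∨ ¬ (k ∣ m.unpair.2) ∨ k = 1) := by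
    apply PrimrecPred.or
    · exact (prim_dvd.comp Primrec.fst (hx.comp Primrec.snd)).not
    · apply PrimrecPred.or
      · exact (prim_dvd.comp Primrec.fst (hd.comp Primrec.snd)).not
      · exact Primrec.eq.comp Primrec.fst (Primrec.const 1)
  have h2 := (PrimrecRel.forall_lt hR).comp (Primrec.succ.comp hd) Primrec.id
  have h1 : PrimrecPred (fun m : ℕ => 0 < m.unpair.2) := Primrec.nat_lt.comp (Primrec.const 0) hd
  refine (h1.and h2).of_eq fun m => ?_
  unfold Valid
  refine and_congr_right fun h => ?_
  rw [coprime_iff _ _ h]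
  simp only [id, Nat.succ_eq_add_one]
  exact forall_congr' fun k => forall_congr' fun _ => by tauto

open Classical in
/-- number of valid codes below -/
noncomputable def cnt (n : ℕ) : ℕ := ∑ i ∈ Finset.range n, if Valid i then 1 else 0

theorem enc_eq_cnt (q : ℚ) : newEnc q = cnt (oldEnc q) := by
  classical
  obtain ⟨inst, h⟩ := enc_eq q
  rw [h, cnt]
  clear h
  generalize oldEnc q = n
  induction n with
  | zero => simp
  | succ n ih =>
    rw [List.range_succ, List.countP_append, Finset.sum_range_succ, ih]
    congr 1
    simp only [List.countP_cons, List.countP_nil, zero_add]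
    simp only [valid_iff, decide_eq_true_eq]

theorem comp_cnt : Computable cnt := by
  classical
  have h : Computable (fun i : ℕ => if Valid i then 1 else 0) :=
    (Primrec.ite prim_valid (Primrec.const 1) (Primrec.const 0)).to_comp
  exact comp_sum (α := ℕ) (f := fun _ i => if Valid i then 1 else 0) (h.comp Computable.snd).to₂
    Computable.id

theorem cnt_mono {a b : ℕ} (h : a ≤ b) : cnt a ≤ cnt b := by
  classical
  exact Finset.sum_le_sum_of_subset (Finset.range_mono h)

theorem comp_oldEnc : Computable oldEnc := by
  have hp : Computable₂ (fun (q : ℚ) (m : ℕ) => decide (newEnc q < cnt (m + 1))) := by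
    have := (Primrec.nat_lt.decide).to_comp
    exact (this.comp (comp_newEnc.comp Computable.fst)
      (comp_cnt.comp (Computable.succ.comp Computable.snd))).to₂
  refine (Partrec.rfind hp.partrec₂).of_eq_tot fun q => ?_
  classical
  rw [Nat.mem_rfind]
  simp only [PFun.coe_val, Part.mem_some_iff, true_eq_decide_iff, false_eq_decide_iff, not_lt]
  rw [enc_eq_cnt]
  constructor
  · have : Valid (oldEnc q) := (valid_iff _).2 ⟨q, rfl⟩
    conv_rhs => rw [cnt, Finset.sum_range_succ, if_pos this]
    rw [cnt]; omega
  · intro m hm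
    exact cnt_mono hm

theorem comp_num : Computable (fun q : ℚ => q.num.toNat) := by
  have h : Primrec (fun m : ℕ => if m.unpair.1 % 2 = 0 then m.unpair.1 / 2 else 0) := by
    have h1 : Primrec (fun m : ℕ => m.unpair.1) := Primrec.fst.comp Primrec.unpair
    exact Primrec.ite (Primrec.eq.comp (Primrec.nat_mod.comp h1 (Primrec.const 2)) (Primrec.const 0))
      (Primrec.nat_div.comp h1 (Primrec.const 2)) (Primrec.const 0)
  refine (h.to_comp.comp comp_oldEnc).of_eq fun q => ?_
  rw [old_eq]
  simp only [Nat.unpair_pair]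
  split_ifs <;> omega

theorem comp_den : Computable (fun q : ℚ => q.den) := by
  refine ((Primrec.snd.comp Primrec.unpair).to_comp.comp comp_oldEnc).of_eq fun q => ?_
  rw [old_eq]
  simp only [Nat.unpair_pair]

/-- Lower and upper computable rational approximations. -/
theorem approx {α : ℝ} (h : ComputableReal α) (hα : 0 ≤ α) :
    ∃ lo hi den : ℕ → ℕ, Computable lo ∧ Computable hi ∧ Computable den ∧ (∀ n, 0 < den n) ∧
      (∀ n, (lo n : ℝ) / den n ≤ α) ∧ (∀ n, α < (hi n : ℝ) / den n) ∧
      Tendsto (fun n => (lo n : ℝ) / den n) atTop (𝓝 α) ∧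
      Tendsto (fun n => (hi n : ℝ) / den n) atTop (𝓝 α) := by
  obtain ⟨f, hf, hfa⟩ := h
  have hf' : Computable (fun n => f (n + 1)) := hf.comp Computable.succ
  have hA := comp_num.comp hf'
  have hB := comp_den.comp hf'
  set A : ℕ → ℕ := fun n => (f (n + 1)).num.toNat with hAd
  set B : ℕ → ℕ := fun n => (f (n + 1)).den with hBd
  have hBpos : ∀ n, 0 < B n := fun n => (f (n + 1)).den_pos
  have key : ∀ n : ℕ, |α - (A n : ℝ) / B n| < 1 / ((n : ℝ) + 1) := by
    intro n
    have h1 := hfa (n + 1) (Nat.succ_pos n)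
    push_cast at h1
    have h2 : ((A n : ℝ)) / B n = max (f (n + 1) : ℝ) 0 := by
      rcases le_total 0 (f (n + 1)) with h0 | h0
      · rw [max_eq_left (by exact_mod_cast h0)]
        have : ((A n : ℤ)) = (f (n + 1)).num := Int.toNat_of_nonneg (Rat.num_nonneg.2 h0)
        conv_rhs => rw [Rat.cast_def]
        rw [← this]; simp [hBd]
      · rw [max_eq_right (by exact_mod_cast h0)]
        have : A n = 0 := by
          have := Rat.num_nonpos.2 h0
          simp only [hAd]; omega
        rw [this]; simp
    rw [h2]
    rw [abs_lt] at h1 ⊢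
    rcases le_total 0 (f (n + 1) : ℝ) with h0 | h0
    · rw [max_eq_left h0]; exact h1
    · rw [max_eq_right h0]
      constructor <;> linarith [h1.1, h1.2]
  have hs : Computable (fun n : ℕ => n + 1) := Computable.succ
  have hmul : Computable₂ (fun a b : ℕ => a * b) := Primrec.nat_mul.to_comp
  have hadd : Computable₂ (fun a b : ℕ => a + b) := Primrec.nat_add.to_comp
  have hsub : Computable₂ (fun a b : ℕ => a - b) := Primrec.nat_sub.to_comp
  have hpos : ∀ n : ℕ, (0 : ℝ) < (B n : ℝ) := fun n => by exact_mod_cast hBpos n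
  have elo : ∀ n : ℕ, ((A n * (n + 1) - B n : ℕ) : ℝ) / ((B n * (n + 1) : ℕ) : ℝ)
      = max ((A n : ℝ) / B n - 1 / ((n : ℝ) + 1)) 0 := by
    intro n
    have hb := hpos n
    have hn : (0 : ℝ) < (n : ℝ) + 1 := by positivity
    have e : (A n : ℝ) / B n - 1 / ((n : ℝ) + 1) = ((A n : ℝ) * (n + 1) - B n) / (B n * (n + 1)) := by
      field_simp
    rcases le_total (B n) (A n * (n + 1)) with h | h
    · rw [e, max_eq_left]
      · push_cast [Nat.cast_sub h]; rfl
      · apply div_nonneg _ (by positivity)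
        have : (B n : ℝ) ≤ A n * (n + 1) := by exact_mod_cast h
        linarith
    · rw [e, max_eq_right]
      · rw [Nat.sub_eq_zero_of_le h]; simp
      · apply div_nonpos_of_nonpos_of_nonneg _ (by positivity)
        have : (A n : ℝ) * (n + 1) ≤ B n := by exact_mod_cast h
        linarith
  have ehi : ∀ n : ℕ, ((A n * (n + 1) + B n : ℕ) : ℝ) / ((B n * (n + 1) : ℕ) : ℝ)
      = (A n : ℝ) / B n + 1 / ((n : ℝ) + 1) := by
    intro n
    have hb := hpos n
    have hn : (0 : ℝ) < (n : ℝ) + 1 := by positivity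
    push_cast
    field_simp
  have t1 : Tendsto (fun n : ℕ => 1 / ((n : ℝ) + 1)) atTop (𝓝 0) :=
    tendsto_one_div_add_atTop_nhds_zero_nat
  have t2 : Tendsto (fun n : ℕ => (A n : ℝ) / B n) atTop (𝓝 α) := by
    rw [tendsto_iff_norm_sub_tendsto_zero]
    refine squeeze_zero (fun _ => norm_nonneg _) (fun n => ?_) t1
    rw [Real.norm_eq_abs, abs_sub_comm]
    exact (key n).le
  refine ⟨fun n => A n * (n + 1) - B n, fun n => A n * (n + 1) + B n, fun n => B n * (n + 1),
    hsub.comp (hmul.comp hA hs) hB, hadd.comp (hmul.comp hA hs) hB, hmul.comp hB hs,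
    fun n => Nat.mul_pos (hBpos n) (Nat.succ_pos n), fun n => ?_, fun n => ?_, ?_, ?_⟩
  · rw [elo]
    have := abs_lt.1 (key n)
    exact max_le (by linarith [this.1]) hα
  · rw [ehi]
    have := abs_lt.1 (key n)
    linarith [this.2]
  · simp only [elo]
    have := (t2.sub t1).max (tendsto_const_nhds (x := (0 : ℝ)))
    rwa [sub_zero, max_eq_left hα] at this
  · simp only [ehi]
    simpa using t2.add t1

/-! ### Kraft inequality -/

theorem uniquelyDecodable {S : Set (List Bool)} (h : PrefixFree S) (h0 : [] ∉ S) :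
    InformationTheory.UniquelyDecodable S := by
  intro L₁
  induction L₁ with
  | nil =>
    intro L₂ _ h2 he
    cases L₂ with
    | nil => rfl
    | cons b t =>
      exfalso
      simp only [List.flatten_nil, List.flatten_cons] at he
      have hb : b = [] := (List.append_eq_nil_iff.1 he.symm).1
      exact h0 (hb ▸ h2 b (by simp))
  | cons a s ih =>
    intro L₂ h1 h2 he
    cases L₂ with
    | nil =>
      exfalso
      simp only [List.flatten_nil, List.flatten_cons] at he
      have hb : a = [] := (List.append_eq_nil_iff.1 he).1
      exact h0 (hb ▸ h1 a (by simp))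
    | cons b t =>
      simp only [List.flatten_cons] at he
      have ha := h1 a (by simp)
      have hb := h2 b (by simp)
      have hab : a = b := by
        rcases List.prefix_or_prefix_of_prefix (List.prefix_append a s.flatten)
          (he ▸ List.prefix_append b t.flatten) with h' | h'
        · exact h a ha b hb h'
        · exact (h b hb a ha h').symm
      subst hab
      have := ih t (fun w hw => h1 w (by simp [hw])) (fun w hw => h2 w (by simp [hw]))
        (List.append_cancel_left he)
      rw [this]

theorem kraft_summable {S : Set (List Bool)} (h : PrefixFree S) (h0 : [] ∉ S) {x : ℝ}
    (hx0 : 0 < x) (hx : x < 1 / 2) :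
    Summable (fun p : S => x ^ p.1.length) ∧ ∑' p : S, x ^ p.1.length ≤ 2 * x := by
  have hb : ∀ u : Finset S, ∑ p ∈ u, x ^ p.1.length ≤ 2 * x := by
    intro u
    have hk := InformationTheory.kraft_mcmillan_inequality
      (S := u.map (Function.Embedding.subtype _)) (by
        refine uniquelyDecodable (fun p hp q hq => h p ?_ q ?_) (fun hn => h0 ?_)
        · simp at hp; exact hp.1
        · simp at hq; exact hq.1
        · simp at hn; exact hn.1)
    rw [Finset.sum_map] at hk
    simp only [Function.Embedding.subtype_apply, Fintype.card_bool] at hk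
    calc ∑ p ∈ u, x ^ p.1.length ≤ ∑ p ∈ u, (2 * x) * (1 / (2 : ℕ) : ℝ) ^ p.1.length := by
          apply Finset.sum_le_sum
          intro p _
          have hl : 1 ≤ p.1.length := by
            rcases hp : p.1 with _ | ⟨a, l⟩
            · exact absurd (hp ▸ p.2) h0
            · simp
          have e : x ^ p.1.length = (2 * x) ^ p.1.length * (1 / (2 : ℕ) : ℝ) ^ p.1.length := by
            rw [← mul_pow]; congr 1; push_cast; ring
          rw [e]
          gcongr
          calc (2 * x) ^ p.1.length ≤ (2 * x) ^ 1 :=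
                pow_le_pow_of_le_one (by linarith) (by linarith) hl
            _ = 2 * x := pow_one _
      _ = (2 * x) * ∑ p ∈ u, (1 / (2 : ℕ) : ℝ) ^ p.1.length := by rw [Finset.mul_sum]
      _ ≤ (2 * x) * 1 := by gcongr
      _ = 2 * x := mul_one _
  have hs := summable_of_sum_le (f := fun p : S => x ^ p.1.length) (fun p => by positivity) hb
  exact ⟨hs, hs.tsum_le_of_sum_le hb⟩

/-! ### Staged halting -/

section Stage

variable (c : Nat.Partrec.Code)

/-- length of the string coded by `i` if it equals `p` or is seen to halt by stage `s`. -/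
def lenOpt (p : List Bool) (s i : ℕ) : Option ℕ :=
  (decode₂ (List Bool) i).bind fun q =>
    if q = p ∨ (Nat.Partrec.Code.evaln s c i).isSome = true then some q.length else none

/-- integer term -/
def term (p : List Bool) (s k m i : ℕ) : ℕ :=
  ((lenOpt c p s i).map fun l => k ^ l * m ^ (s - l)).getD 0

/-- real weight -/
noncomputable def wt (p : List Bool) (s : ℕ) (r : ℝ) (i : ℕ) : ℝ :=
  ((lenOpt c p s i).map fun l => r ^ l).getD 0

theorem prim_lenOpt : Primrec (fun a : (List Bool × ℕ) × ℕ => lenOpt c a.1.1 a.1.2 a.2) := by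
  have hp : PrimrecPred (fun b : ((List Bool × ℕ) × ℕ) × List Bool =>
      b.2 = b.1.1.1 ∨ (Nat.Partrec.Code.evaln b.1.1.2 c b.1.2).isSome = true) := by
    apply PrimrecPred.or
    · exact Primrec.eq.comp Primrec.snd (Primrec.fst.comp (Primrec.fst.comp Primrec.fst))
    · refine Primrec.eq.comp (Primrec.option_isSome.comp
        (Nat.Partrec.Code.primrec_evaln.comp (Primrec.pair (Primrec.pair
          (Primrec.snd.comp (Primrec.fst.comp Primrec.fst)) (Primrec.const c))
          (Primrec.snd.comp Primrec.fst)))) (Primrec.const true)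
  have hb : Primrec₂ (fun (a : (List Bool × ℕ) × ℕ) (q : List Bool) =>
      if q = a.1.1 ∨ (Nat.Partrec.Code.evaln a.1.2 c a.2).isSome = true
        then some q.length else none) :=
    Primrec.ite hp (Primrec.option_some.comp (Primrec.list_length.comp Primrec.snd))
      (Primrec.const none)
  exact Primrec.option_bind (Primrec.decode₂.comp Primrec.snd) hb

theorem prim_term : Primrec (fun a : (List Bool × ℕ × ℕ × ℕ) × ℕ =>
    term c a.1.1 a.1.2.1 a.1.2.2.1 a.1.2.2.2 a.2) := by
  have h1 : Primrec (fun a : (List Bool × ℕ × ℕ × ℕ) × ℕ => lenOpt c a.1.1 a.1.2.1 a.2) :=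
    (prim_lenOpt c).comp (Primrec.pair (Primrec.pair (Primrec.fst.comp Primrec.fst)
      (Primrec.fst.comp (Primrec.snd.comp Primrec.fst))) Primrec.snd)
  have h2 : Primrec₂ (fun (a : (List Bool × ℕ × ℕ × ℕ) × ℕ) (l : ℕ) =>
      a.1.2.2.1 ^ l * a.1.2.2.2 ^ (a.1.2.1 - l)) := by
    have e1 : Primrec (fun b : ((List Bool × ℕ × ℕ × ℕ) × ℕ) × ℕ => b.1.1.2) :=
      Primrec.snd.comp (Primrec.fst.comp Primrec.fst)
    exact Primrec.nat_mul.comp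
      (prim_pow.comp (Primrec.fst.comp (Primrec.snd.comp e1)) Primrec.snd)
      (prim_pow.comp (Primrec.snd.comp (Primrec.snd.comp e1))
        (Primrec.nat_sub.comp (Primrec.fst.comp e1) Primrec.snd))
  exact Primrec.option_getD.comp (Primrec.option_map h1 h2) (Primrec.const 0)

/-- integer sum -/
def isum (p : List Bool) (s k m : ℕ) : ℕ := ∑ i ∈ Finset.range s, term c p s k m i

theorem comp_isum : Computable (fun a : List Bool × ℕ × ℕ × ℕ =>
    isum c a.1 a.2.1 a.2.2.1 a.2.2.2) :=
  comp_sum (prim_term c).to_comp.to₂ (Computable.fst.comp Computable.snd)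

theorem lenOpt_le {p : List Bool} {s i l : ℕ} (h : lenOpt c p s i = some l) : l ≤ i := by
  unfold lenOpt at h
  rw [Option.bind_eq_some_iff] at h
  obtain ⟨q, hq, h⟩ := h
  split_ifs at h
  have := mem_decode₂.1 hq
  simp only [Option.some.injEq] at h
  rw [← h, ← this]
  exact Encodable.length_le_encode q

theorem isum_eq (p : List Bool) (s k m : ℕ) (hm : 0 < m) :
    (isum c p s k m : ℝ) = (m : ℝ) ^ s * ∑ i ∈ Finset.range s, wt c p s ((k : ℝ) / m) i := by
  rw [isum, Finset.mul_sum]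
  push_cast
  apply Finset.sum_congr rfl
  intro i hi
  rw [Finset.mem_range] at hi
  unfold term wt
  cases h : lenOpt c p s i with
  | none => simp
  | some l =>
    have hl := lenOpt_le c h
    simp only [Option.map_some, Option.getD_some]
    push_cast
    have hm' : (m : ℝ) ≠ 0 := by positivity
    have e : (m : ℝ) ^ s = m ^ (s - l) * m ^ l := by rw [← pow_add]; congr 1; omega
    rw [e, div_pow]
    field_simp

end Stage

theorem exists_code_dom (V : Computer) : ∃ c : Nat.Partrec.Code, ∀ q : List Bool,
    q ∈ V.f.Dom ↔ ∃ s, (Nat.Partrec.Code.evaln s c (encode q)).isSome = true := by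
  obtain ⟨c, hc⟩ := Nat.Partrec.Code.exists_code.1 V.partrec
  refine ⟨c, fun q => ?_⟩
  have h1 : q ∈ V.f.Dom ↔ ∃ x, x ∈ c.eval (encode q) := by
    rw [hc]
    simp only [encodek, Part.coe_some, Part.bind_some, Part.mem_map_iff]
    rw [PFun.mem_dom]
    constructor
    · rintro ⟨y, hy⟩; exact ⟨_, y, hy, rfl⟩
    · rintro ⟨_, y, hy, _⟩; exact ⟨y, hy⟩
  rw [h1]
  simp only [Nat.Partrec.Code.evaln_complete, Option.isSome_iff_exists, Option.mem_def]
  exact exists_comm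

theorem halts_mono (c : Nat.Partrec.Code) {s t n : ℕ} (h : s ≤ t)
    (hs : (Nat.Partrec.Code.evaln s c n).isSome = true) :
    (Nat.Partrec.Code.evaln t c n).isSome = true := by
  obtain ⟨x, hx⟩ := Option.isSome_iff_exists.1 hs
  exact Option.isSome_iff_exists.2 ⟨x, Nat.Partrec.Code.evaln_mono h hx⟩

open Classical in
/-- limit weight -/
noncomputable def lw (V : Computer) (x : ℝ) (i : ℕ) : ℝ :=
  ((decode₂ (List Bool) i).map fun q => if q ∈ V.f.Dom then x ^ q.length else 0).getD 0

theorem lw_hasSum (V : Computer) {x Z : ℝ} (h : HasSum (fun p : V.f.Dom => x ^ p.1.length) Z) :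
    HasSum (lw V x) Z := by
  classical
  have hinj : Function.Injective (fun p : V.f.Dom => encode p.1) :=
    fun a b hab => Subtype.ext (encode_injective hab)
  refine (hinj.hasSum_iff ?_).1 ?_
  · intro i hi
    unfold lw
    cases hq : decode₂ (List Bool) i with
    | none => simp
    | some q =>
      simp only [Option.map_some, Option.getD_some]
      rw [if_neg]
      intro hd
      exact hi ⟨⟨q, hd⟩, mem_decode₂.1 hq⟩
  · convert h using 1
    funext p
    simp only [Function.comp, lw, decode₂_encode, Option.map_some, Option.getD_some, if_pos p.2]

theorem lw_nonneg (V : Computer) {x : ℝ} (hx : 0 ≤ x) (i : ℕ) : 0 ≤ lw V x i := by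
  classical
  unfold lw
  cases decode₂ (List Bool) i with
  | none => simp
  | some q =>
    simp only [Option.map_some, Option.getD_some]
    split_ifs <;> positivity

theorem wt_nonneg (c : Nat.Partrec.Code) (p : List Bool) (s i : ℕ) {x : ℝ} (hx : 0 ≤ x) :
    0 ≤ wt c p s x i := by
  unfold wt
  cases lenOpt c p s i with
  | none => simp
  | some q => simp only [Option.map_some, Option.getD_some]; positivity

theorem wt_mono (c : Nat.Partrec.Code) (p : List Bool) (s i : ℕ) {r x : ℝ} (hr : 0 ≤ r)
    (hx : r ≤ x) : wt c p s r i ≤ wt c p s x i := by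
  unfold wt
  cases lenOpt c p s i with
  | none => simp
  | some q => simp only [Option.map_some, Option.getD_some]; gcongr

theorem wt_cont (c : Nat.Partrec.Code) (p : List Bool) (s i : ℕ) :
    Continuous fun r => wt c p s r i := by
  unfold wt
  cases lenOpt c p s i with
  | none => simp only [Option.map_none, Option.getD_none]; fun_prop
  | some q => simp only [Option.map_some, Option.getD_some]; fun_prop

theorem wt_le_lw (V : Computer) (c : Nat.Partrec.Code)
    (hc : ∀ q : List Bool,
      q ∈ V.f.Dom ↔ ∃ s, (Nat.Partrec.Code.evaln s c (encode q)).isSome = true)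
    {p : List Bool} (hp : p ∈ V.f.Dom) (s i : ℕ) {x : ℝ} (hx : 0 ≤ x) :
    wt c p s x i ≤ lw V x i := by
  classical
  unfold wt lw lenOpt
  cases hq : decode₂ (List Bool) i with
  | none => simp
  | some q =>
    have hi := mem_decode₂.1 hq
    simp only [Option.map_some, Option.getD_some, Option.bind_some]
    by_cases h : q = p ∨ (Nat.Partrec.Code.evaln s c i).isSome = true
    · have : q ∈ V.f.Dom := by
        rcases h with h | h
        · exact h ▸ hp
        · rw [hc]; exact ⟨s, hi ▸ h⟩
      simp only [if_pos h, if_pos this, Option.map_some, Option.getD_some, le_refl]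
    · simp only [if_neg h, Option.map_none, Option.getD_none]
      split_ifs <;> positivity

theorem exists_stage (V : Computer) (c : Nat.Partrec.Code)
    (hc : ∀ q : List Bool,
      q ∈ V.f.Dom ↔ ∃ s, (Nat.Partrec.Code.evaln s c (encode q)).isSome = true)
    {p : List Bool} (hp : p ∉ V.f.Dom) {x Z : ℝ} (hx : 0 < x) (hZ : HasSum (lw V x) Z) :
    ∃ s, Z < ∑ i ∈ Finset.range s, wt c p s x i := by
  classical
  have hxp : 0 < x ^ p.length := by positivity
  obtain ⟨N, hN⟩ := (hZ.tendsto_sum_nat.eventually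
    (lt_mem_nhds (show Z - x ^ p.length < Z by linarith))).exists
  have hst : ∀ i, ∃ s, ∀ q ∈ decode₂ (List Bool) i, q ∈ V.f.Dom →
      (Nat.Partrec.Code.evaln s c i).isSome = true := by
    intro i
    by_cases h : ∃ q ∈ decode₂ (List Bool) i, q ∈ V.f.Dom
    · obtain ⟨q, hq, hd⟩ := h
      obtain ⟨s, hs⟩ := (hc q).1 hd
      exact ⟨s, fun _ _ _ => mem_decode₂.1 hq ▸ hs⟩
    · exact ⟨0, fun q hq hd => absurd ⟨q, hq, hd⟩ h⟩
  choose st hst using hst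
  let s := N + (encode p + 1) + ∑ i ∈ Finset.range N, st i
  have hs1 : N ≤ s := by simp only [s]; omega
  have hs2 : encode p < s := by simp only [s]; omega
  have hs3 : ∀ i < N, st i ≤ s := by
    intro i hi
    have : st i ≤ ∑ i ∈ Finset.range N, st i :=
      Finset.single_le_sum (f := st) (fun _ _ => Nat.zero_le _) (Finset.mem_range.2 hi)
    simp only [s]; omega
  refine ⟨s, ?_⟩
  have hpt : ∀ i, (if i < N then lw V x i else 0) + (if i = encode p then x ^ p.length else 0)
      ≤ wt c p s x i := by
    intro i
    by_cases hip : i = encode p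
    · subst hip
      have e1 : lw V x (encode p) = 0 := by
        simp only [lw, decode₂_encode, Option.map_some, Option.getD_some, if_neg hp]
      have e2 : wt c p s x (encode p) = x ^ p.length := by
        simp [wt, lenOpt, decode₂_encode]
      rw [e1, e2]; simp
    · rw [if_neg hip, add_zero]
      split_ifs with hiN
      · unfold wt lw lenOpt
        cases hq : decode₂ (List Bool) i with
        | none => simp
        | some q =>
          simp only [Option.map_some, Option.getD_some, Option.bind_some]
          by_cases hd : q ∈ V.f.Dom
          · have := halts_mono c (hs3 i hiN) (hst i q hq hd)
            simp only [if_pos hd, this, or_true, if_true, Option.map_some, Option.getD_some, le_refl]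
          · simp only [if_neg hd]
            split_ifs <;> (simp; try positivity)
      · exact wt_nonneg c p s i hx.le
  calc Z < ∑ i ∈ Finset.range N, lw V x i + x ^ p.length := by linarith
    _ = ∑ i ∈ Finset.range s, ((if i < N then lw V x i else 0)
          + (if i = encode p then x ^ p.length else 0)) := by
        rw [Finset.sum_add_distrib, Finset.sum_ite_eq', if_pos (Finset.mem_range.2 hs2)]
        congr 1
        rw [← Finset.sum_filter]
        congr 1
        ext i
        simp only [Finset.mem_range, Finset.mem_filter]
        omega
    _ ≤ _ := Finset.sum_le_sum fun i _ => hpt i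

theorem re_of_search {P : List Bool → Prop} {R : List Bool × ℕ → Bool} (hR : Computable R)
    (h : ∀ p, P p ↔ ∃ n, R (p, n) = true) : REPred P := by
  have h1 : Partrec fun p : List Bool => Nat.rfind ((fun n => R (p, n) : ℕ → Bool) : ℕ →. Bool) :=
    Partrec.rfind (p := fun p => ((fun n => R (p, n) : ℕ → Bool) : ℕ →. Bool))
      (Computable.partrec hR).to₂
  refine h1.dom_re.of_eq fun p => ?_
  rw [h]
  refine Iff.trans Nat.rfind_dom ?_
  constructor
  · rintro ⟨n, hn, _⟩
    exact ⟨n, (Part.mem_some_iff.1 hn).symm⟩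
  · rintro ⟨n, hn⟩
    exact ⟨n, Part.mem_some_iff.2 hn.symm, fun _ => trivial⟩

theorem comp_test {I : List Bool × ℕ × ℕ × ℕ → ℕ} {lo hi den C D : ℕ → ℕ} (cI : Computable I)
    (clo : Computable lo) (chi : Computable hi) (cden : Computable den) (cC : Computable C)
    (cD : Computable D) :
    Computable (fun a : List Bool × ℕ × ℕ × ℕ × ℕ =>
      (decide (0 < a.2.2.2.1) && decide (0 < C a.2.2.2.2)) &&
      (decide (a.2.2.1 ^ C a.2.2.2.2 * den a.2.2.2.2 ^ D a.2.2.2.2 ≤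
        lo a.2.2.2.2 ^ D a.2.2.2.2 * a.2.2.2.1 ^ C a.2.2.2.2) &&
      decide (hi a.2.2.2.2 * a.2.2.2.1 ^ a.2.1 ≤
        I (a.1, a.2.1, a.2.2.1, a.2.2.2.1) * den a.2.2.2.2))) := by
    have band : Computable₂ and := Primrec.and.to_comp
    have lt : Computable₂ (fun a b : ℕ => decide (a < b)) := Primrec.nat_lt.decide.to_comp
    have le : Computable₂ (fun a b : ℕ => decide (a ≤ b)) := Primrec.nat_le.decide.to_comp
    have pw : Computable₂ (fun a b : ℕ => a ^ b) := prim_pow.to_comp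
    have hmul : Computable₂ (fun a b : ℕ => a * b) := Primrec.nat_mul.to_comp
    have gp : Computable (fun a : List Bool × ℕ × ℕ × ℕ × ℕ => a.1) := Computable.fst
    have gs : Computable (fun a : List Bool × ℕ × ℕ × ℕ × ℕ => a.2.1) :=
      Computable.fst.comp Computable.snd
    have gk : Computable (fun a : List Bool × ℕ × ℕ × ℕ × ℕ => a.2.2.1) :=
      Computable.fst.comp (Computable.snd.comp Computable.snd)
    have gm : Computable (fun a : List Bool × ℕ × ℕ × ℕ × ℕ => a.2.2.2.1) :=
      Computable.fst.comp (Computable.snd.comp (Computable.snd.comp Computable.snd))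
    have gn : Computable (fun a : List Bool × ℕ × ℕ × ℕ × ℕ => a.2.2.2.2) :=
      Computable.snd.comp (Computable.snd.comp (Computable.snd.comp Computable.snd))
    have gi : Computable (fun a : List Bool × ℕ × ℕ × ℕ × ℕ =>
        I (a.1, a.2.1, a.2.2.1, a.2.2.2.1)) :=
      cI.comp (gp.pair (gs.pair (gk.pair gm)))
    have g0 : Computable (fun _ : List Bool × ℕ × ℕ × ℕ × ℕ => 0) := Computable.const 0
    exact band.comp (band.comp (lt.comp g0 gm) (lt.comp g0 (cC.comp gn)))
      (band.comp (le.comp (hmul.comp (pw.comp gk (cC.comp gn)) (pw.comp (cden.comp gn) (cD.comp gn)))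
        (hmul.comp (pw.comp (clo.comp gn) (cD.comp gn)) (pw.comp gm (cC.comp gn))))
        (le.comp (hmul.comp (chi.comp gn) (pw.comp gm gs)) (hmul.comp gi (cden.comp gn))))

theorem dom_computable (V : Computer) {x F Z : ℝ} (hx0 : 0 < x) (hx1 : x < 1)
    (hF0 : 0 < F) (hsum : HasSum (fun p : V.f.Dom => x ^ p.1.length) Z) (hxF : x ^ F = Z)
    (hZ : ComputableReal Z) (hF : ComputableReal F) :
    ComputablePred (fun p => p ∈ V.f.Dom) := by
  obtain ⟨c, hc⟩ := exists_code_dom V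
  have hlw := lw_hasSum V hsum
  have hZ0 : 0 < Z := hxF ▸ Real.rpow_pos_of_pos hx0 F
  obtain ⟨lo, hi, den, clo, chi, cden, den_pos, hlo, hhi, tlo, thi⟩ := approx hZ hZ0.le
  obtain ⟨C, _, D, cC, _, cD, D_pos, hC, _, tC, _⟩ := approx hF hF0.le
  refine ComputablePred.computable_iff_re_compl_re'.2 ⟨V.partrec.dom_re, ?_⟩
  let Q : List Bool → ℕ × ℕ × ℕ × ℕ → Prop := fun p w =>
    (0 < w.2.2.1 ∧ 0 < C w.2.2.2) ∧
    (w.2.1 ^ C w.2.2.2 * den w.2.2.2 ^ D w.2.2.2 ≤ lo w.2.2.2 ^ D w.2.2.2 * w.2.2.1 ^ C w.2.2.2 ∧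
    hi w.2.2.2 * w.2.2.1 ^ w.1 ≤ isum c p w.1 w.2.1 w.2.2.1 * den w.2.2.2)
  have cQ := comp_test (comp_isum c) clo chi cden cC cD
  have cR := cQ.comp (Computable.pair (Computable.fst (α := List Bool) (β := ℕ))
    ((Computable.ofNat (ℕ × ℕ × ℕ × ℕ)).comp Computable.snd))
  refine re_of_search cR fun p => ?_
  have hEx : (∃ w, Q p w) ↔ (∃ n, Q p (Denumerable.ofNat (ℕ × ℕ × ℕ × ℕ) n)) :=
    ⟨fun ⟨w, hw⟩ => ⟨encode w, by rwa [Denumerable.ofNat_encode]⟩, fun ⟨n, hn⟩ => ⟨_, hn⟩⟩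
  simp only [Bool.and_eq_true, decide_eq_true_eq]
  refine Iff.trans ?_ hEx
  constructor
  · -- completeness
    intro hp
    obtain ⟨s, hs⟩ := exists_stage V c hc hp hx0 hlw
    have hcont : Continuous (fun r => ∑ i ∈ Finset.range s, wt c p s r i) :=
      continuous_finsetSum _ fun i _ => wt_cont c p s i
    have hev := hcont.continuousAt.eventually (lt_mem_nhds hs)
    obtain ⟨l, hl, hl'⟩ := exists_Ioc_subset_of_mem_nhds hev ⟨0, hx0⟩
    obtain ⟨r, hr1, hr2⟩ := exists_rat_btwn (max_lt hl hx0)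
    have hr0 : (0 : ℝ) < r := lt_of_le_of_lt (le_max_right _ _) hr1
    have hrs : Z < ∑ i ∈ Finset.range s, wt c p s (r : ℝ) i :=
      hl' ⟨lt_of_le_of_lt (le_max_left _ _) hr1, hr2.le⟩
    have hrq : (0 : ℚ) < r := by exact_mod_cast hr0
    have hrk : ((r.num.toNat : ℕ) : ℝ) / r.den = r := by
      have : ((r.num.toNat : ℕ) : ℤ) = r.num := Int.toNat_of_nonneg (Rat.num_nonneg.2 hrq.le)
      have h' : ((r.num.toNat : ℕ) : ℝ) = (r.num : ℝ) := by
        rw [← Int.cast_natCast, this]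
      rw [h', ← Rat.cast_def]
    have hrF : (r : ℝ) ^ F < Z := hxF ▸ Real.rpow_lt_rpow hr0.le hr2 hF0
    have t1 : Tendsto (fun n => (r : ℝ) ^ ((C n : ℝ) / D n)) atTop (𝓝 ((r : ℝ) ^ F)) :=
      (Real.continuousAt_const_rpow hr0.ne').tendsto.comp tC
    have e1 := t1.eventually_lt tlo hrF
    have e2 := tC.eventually (lt_mem_nhds hF0)
    have e3 := thi.eventually (gt_mem_nhds hrs)
    obtain ⟨n, h1, h2, h3⟩ := (e1.and (e2.and e3)).exists
    have hDp : (0 : ℝ) < D n := by exact_mod_cast D_pos n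
    have hdp : (0 : ℝ) < den n := by exact_mod_cast den_pos n
    have hmp : (0 : ℝ) < (r.den : ℝ) := by exact_mod_cast r.den_pos
    refine ⟨(s, r.num.toNat, r.den, n), ⟨r.den_pos, ?_⟩, ?_, ?_⟩
    · rcases Nat.eq_zero_or_pos (C n) with h | h
      · rw [h] at h2; simp at h2
      · exact h
    · have h4 : (r : ℝ) ^ C n ≤ ((lo n : ℝ) / den n) ^ D n := by
        have := pow_le_pow_left₀ (by positivity) h1.le (D n)
        rwa [← Real.rpow_natCast, ← Real.rpow_mul hr0.le, div_mul_cancel₀ _ hDp.ne',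
          Real.rpow_natCast] at this
      rw [← hrk, div_pow, div_pow, div_le_div_iff₀ (by positivity) (by positivity)] at h4
      exact_mod_cast h4
    · have h5 : (hi n : ℝ) * (r.den : ℝ) ^ s ≤ isum c p s r.num.toNat r.den * den n := by
        rw [isum_eq c p s _ _ r.den_pos, hrk]
        rw [div_lt_iff₀ hdp] at h3
        nlinarith [pow_pos hmp s]
      exact_mod_cast h5
  · -- soundness
    rintro ⟨⟨s, k, m, n⟩, ⟨hm, hCn⟩, h4, h5⟩ hp
    simp only at hm hCn h4 h5
    have hDp : (0 : ℝ) < D n := by exact_mod_cast D_pos n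
    have hdp : (0 : ℝ) < den n := by exact_mod_cast den_pos n
    have hmp : (0 : ℝ) < (m : ℝ) := by exact_mod_cast hm
    have hr0 : (0 : ℝ) ≤ (k : ℝ) / m := by positivity
    have h4' : ((k : ℝ) / m) ^ C n ≤ ((lo n : ℝ) / den n) ^ D n := by
      rw [div_pow, div_pow, div_le_div_iff₀ (by positivity) (by positivity)]
      exact_mod_cast h4
    have h6 : ((lo n : ℝ) / den n) ^ D n ≤ x ^ C n := by
      calc ((lo n : ℝ) / den n) ^ D n ≤ Z ^ D n := pow_le_pow_left₀ (by positivity) (hlo n) _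
        _ = x ^ (F * D n) := by rw [← hxF, ← Real.rpow_natCast, ← Real.rpow_mul hx0.le]
        _ ≤ x ^ (C n : ℝ) := by
            apply Real.rpow_le_rpow_of_exponent_ge hx0 hx1.le
            have := hC n
            rwa [div_le_iff₀ hDp] at this
        _ = x ^ C n := Real.rpow_natCast _ _
    have hrx : (k : ℝ) / m ≤ x := le_of_pow_le_pow_left₀ hCn.ne' hx0.le (h4'.trans h6)
    have h7 : ∑ i ∈ Finset.range s, wt c p s ((k : ℝ) / m) i ≤ Z :=
      calc _ ≤ ∑ i ∈ Finset.range s, lw V x i := Finset.sum_le_sum fun i _ =>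
            (wt_mono c p s i hr0 hrx).trans (wt_le_lw V c hc hp s i hx0.le)
        _ ≤ Z := sum_le_hasSum _ (fun i _ => lw_nonneg V hx0.le i) hlw
    have h8 : (hi n : ℝ) * (m : ℝ) ^ s ≤ isum c p s k m * den n := by exact_mod_cast h5
    rw [isum_eq c p s _ _ hm] at h8
    have h9 := hhi n
    rw [lt_div_iff₀ hdp] at h9
    have hms := pow_pos hmp s
    have h10 : (m : ℝ) ^ s * (∑ i ∈ Finset.range s, wt c p s ((k : ℝ) / m) i) * den n
        ≤ (m : ℝ) ^ s * (Z * den n) := by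
      rw [mul_assoc]; gcongr
    nlinarith

/-! ### The diagonal machine -/

/-- bound on codes of strings of given length -/
def codeBound (n : ℕ) : ℕ := Nat.rec 1 (fun _ b => (b + 2) ^ 2 + 1) n

theorem comp_codeBound : Computable codeBound := by
  have h : Primrec₂ (fun (_ : ℕ) (p : ℕ × ℕ) => (p.2 + 2) ^ 2 + 1) :=
    Primrec.succ.comp (prim_pow.comp (Primrec.nat_add.comp (Primrec.snd.comp Primrec.snd)
      (Primrec.const 2)) (Primrec.const 2))
  exact (Primrec.nat_rec' (f := fun n : ℕ => n) Primrec.id (Primrec.const 1) h).to_comp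

theorem codeBound_succ (n : ℕ) : codeBound (n + 1) = (codeBound n + 2) ^ 2 + 1 := rfl

theorem codeBound_mono : Monotone codeBound := by
  refine monotone_nat_of_le_succ fun n => ?_
  rw [codeBound_succ]; nlinarith

theorem encode_lt_codeBound (l : List Bool) : encode l < codeBound l.length := by
  induction l with
  | nil => simp [codeBound]
  | cons b l ih =>
    rw [encode_list_cons, List.length_cons, codeBound_succ]
    have hb : encode b ≤ 1 := by cases b <;> simp
    have h := Nat.pair_lt_max_add_one_sq (encode b) (encode l)
    have h2 : max (encode b) (encode l) + 1 ≤ codeBound l.length + 2 := by omega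
    have h3 := Nat.pow_le_pow_left h2 2
    omega

theorem idxOf_eq_of_pre {p q : List Bool} (h : p <+: q) (hp : p.idxOf false + 1 = p.length)
    (hq : q.idxOf false + 1 = q.length) : p = q := by
  obtain ⟨t, rfl⟩ := h
  have hm : false ∈ p := List.idxOf_lt_length_iff.1 (by omega)
  rw [List.idxOf_append_of_mem hm, List.length_append] at hq
  have : t = [] := List.length_eq_zero_iff.1 (by omega)
  simp [this]

theorem not_computable_dom (V : Computer) (hV : Optimal V) :
    ¬ ComputablePred (fun p => p ∈ V.f.Dom) := by
  classical
  intro hD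
  have hdec : Computable (fun p => decide (p ∈ V.f.Dom)) :=
    computablePred_iff_computable_decide.1 hD
  let L : List Bool → ℕ := fun q => if h : q ∈ V.f.Dom then ((V.f q).get h).length else 0
  have hL : Computable L := by
    have h1 : Partrec (fun q => (V.f q).map List.length) :=
      V.partrec.map (Computable.list_length.comp Computable.snd).to₂
    have h2 : Partrec (fun _ : List Bool => (Part.some 0 : Part ℕ)) := Computable.const 0
    refine (Partrec.cond hdec h1 h2).of_eq_tot fun q => ?_
    by_cases h : q ∈ V.f.Dom
    · simp only [h, decide_true, cond_true, L, dif_pos]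
      exact Part.mem_map _ (Part.get_mem h)
    · simp only [h, decide_false, cond_false, L, dif_neg, not_false_eq_true]
      exact Part.mem_some _
  let W : ℕ → ℕ := fun k =>
    (∑ i ∈ Finset.range (codeBound (2 * k)), ((decode₂ (List Bool) i).map L).getD 0) + 1
  have hW : Computable W := by
    have h1 : Computable (fun i => ((decode₂ (List Bool) i).map L).getD 0) :=
      Computable.option_getD (Computable.option_map Primrec.decode₂.to_comp
        (hL.comp Computable.snd).to₂) (Computable.const 0)
    have h2 : Computable (fun k : ℕ => codeBound (2 * k)) :=
      comp_codeBound.comp (Primrec.nat_mul.comp (Primrec.const 2) Primrec.id).to_comp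
    exact Computable.succ.comp (comp_sum (h1.comp Computable.snd).to₂ h2)
  have hWL : ∀ k q, q.length ≤ 2 * k → L q < W k := by
    intro k q hq
    have h1 : encode q < codeBound (2 * k) :=
      (encode_lt_codeBound q).trans_le (codeBound_mono hq)
    have := Finset.single_le_sum (f := fun i => ((decode₂ (List Bool) i).map L).getD 0)
      (fun _ _ => Nat.zero_le _) (Finset.mem_range.2 h1)
    simp only [decode₂_encode, Option.map_some, Option.getD_some] at this
    simp only [W]; omega
  have hrep : Computable (fun n : ℕ => List.replicate n true) := by
    have h : Primrec₂ (fun (_ : ℕ) (p : ℕ × List Bool) => true :: p.2) :=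
      Primrec.list_cons.comp (Primrec.const true) (Primrec.snd.comp Primrec.snd)
    refine ((Primrec.nat_rec' (f := fun n : ℕ => n) Primrec.id
      (Primrec.const ([] : List Bool)) h).of_eq fun n => ?_).to_comp
    induction n with
    | zero => rfl
    | succ n ih => simp only [ih, List.replicate_succ]
  let f : List Bool →. List Bool := fun p =>
    cond (decide (p.idxOf false + 1 = p.length))
      (Part.some (List.replicate (W p.length) true)) Part.none
  have hfd : ∀ p, p ∈ f.Dom ↔ p.idxOf false + 1 = p.length := by
    intro p
    by_cases h : p.idxOf false + 1 = p.length
    · simp [f, PFun.mem_dom, h]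
    · simp [f, PFun.mem_dom, h]
  have hf : Partrec f := by
    have hc : Primrec (fun p : List Bool => decide (p.idxOf false + 1 = p.length)) :=
      (Primrec.eq.comp (Primrec.succ.comp (Primrec.list_idxOf.comp (Primrec.const false) Primrec.id))
        Primrec.list_length).decide
    exact Partrec.cond hc.to_comp (hrep.comp (hW.comp Computable.list_length)) Partrec.none
  have hrepd : ∀ d, List.replicate d true ++ [false] ∈ f.Dom := by
    intro d
    rw [hfd, List.idxOf_append_of_notMem (by simp)]
    simp
  obtain ⟨d, hd⟩ := hV ⟨f, hf, ⟨_, hrepd 0⟩, fun p hp q hq h =>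
    idxOf_eq_of_pre h ((hfd p).1 hp) ((hfd q).1 hq)⟩
  obtain ⟨q, hq, hql⟩ := hd _ (hrepd d)
  set p := List.replicate d true ++ [false] with hp
  have hpl : p.length = d + 1 := by simp [hp]
  have e : V.f q = Part.some (List.replicate (W p.length) true) := by
    have h1 := (hfd p).1 (hrepd d)
    rw [hq]
    simp only [f, h1, decide_true, cond_true]
  have hlt := hWL p.length q (by omega)
  have hdom : q ∈ V.f.Dom := by
    rw [PFun.mem_dom, e]; exact ⟨_, Part.mem_some _⟩
  have : L q = W p.length := by
    simp only [L, dif_pos hdom]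
    have := Part.get_mem (o := V.f q) hdom
    have h2 : (V.f q).get hdom = List.replicate (W p.length) true :=
      Part.get_eq_of_mem (by rw [e]; exact Part.mem_some _) _
    rw [h2, List.length_replicate]
  omega

theorem nil_notMem (V : Computer) (hV : Optimal V) : [] ∉ V.f.Dom := by
  intro h0
  let f : List Bool →. List Bool := fun p =>
    cond (decide (p.length = 1)) (Part.some p) Part.none
  have hfd : ∀ p, p ∈ f.Dom ↔ p.length = 1 := by
    intro p
    by_cases h : p.length = 1 <;> simp [f, PFun.mem_dom, h]
  have hf : Partrec f := by
    have hc : Primrec (fun p : List Bool => decide (p.length = 1)) :=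
      (Primrec.eq.comp Primrec.list_length (Primrec.const 1)).decide
    exact Partrec.cond hc.to_comp Computable.id Partrec.none
  obtain ⟨d, hd⟩ := hV ⟨f, hf, ⟨[true], (hfd _).2 rfl⟩, fun p hp q hq h =>
    h.eq_of_length (((hfd p).1 hp).trans ((hfd q).1 hq).symm)⟩
  have key : ∀ b : Bool, V.f [] = Part.some [b] := by
    intro b
    obtain ⟨q, hq, _⟩ := hd [b] ((hfd _).2 rfl)
    have e : V.f q = Part.some [b] := by rw [hq]; simp [f]
    have hdom : q ∈ V.f.Dom := by
      rw [PFun.mem_dom, e]; exact ⟨_, Part.mem_some _⟩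
    have : [] = q := V.dom_prefixFree _ h0 _ hdom (List.nil_prefix)
    subst this; exact e
  have := (key true).symm.trans (key false)
  simp at this

end ZFProof

/-- For optimal `V`, `𝒵(V) ∩ ℱ(V) = ∅`: no `T ∈ (0,1)` makes
both `Z_V(T)` and `F_V(T)` computable. -/
theorem zSet_inter_fSet_empty (V : Computer) (hV : Optimal V) :
    setZ V ∩ setF V = ∅ := by
  rw [Set.eq_empty_iff_forall_notMem]
  rintro T ⟨⟨⟨hT0, hT1⟩, hZ⟩, ⟨_, hF⟩⟩
  have h0 := ZFProof.nil_notMem V hV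
  set x : ℝ := (2 : ℝ) ^ (-1 / T) with hx
  have hx0 : 0 < x := Real.rpow_pos_of_pos two_pos _
  have hx1 : x < 1 / 2 := by
    have : (2 : ℝ) ^ (-1 / T) < (2 : ℝ) ^ (-1 : ℝ) := by
      apply Real.rpow_lt_rpow_of_exponent_lt one_lt_two
      rw [div_lt_iff₀ hT0]; linarith
    rw [Real.rpow_neg_one] at this
    rw [hx]; linarith
  have hb : ∀ p : List Bool, boltzmann T p = x ^ p.length := by
    intro p
    rw [boltzmann, hx, ← Real.rpow_natCast, ← Real.rpow_mul two_pos.le]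
    congr 1; ring
  obtain ⟨hs, hle⟩ := ZFProof.kraft_summable V.dom_prefixFree h0 hx0 hx1
  have hZe : Zfun V T = ∑' p : V.f.Dom, x ^ p.1.length := by
    simp only [Zfun, hb]
  have hsum : HasSum (fun p : V.f.Dom => x ^ p.1.length) (Zfun V T) := by
    rw [hZe]; exact hs.hasSum
  have hZ0 : 0 < Zfun V T := by
    obtain ⟨p, hp⟩ := V.dom_nonempty
    rw [hZe]
    exact hs.tsum_pos (fun _ => by positivity) ⟨p, hp⟩ (by positivity)
  have hZ1 : Zfun V T < 1 := by rw [hZe]; linarith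
  have hF0 : 0 < Ffun V T := by
    have := Real.logb_neg one_lt_two hZ0 hZ1
    rw [Ffun]; nlinarith
  have hxF : x ^ Ffun V T = Zfun V T := by
    rw [hx, ← Real.rpow_mul two_pos.le, Ffun]
    have : -1 / T * (-T * Real.logb 2 (Zfun V T)) = Real.logb 2 (Zfun V T) := by
      field_simp
    rw [this]
    exact Real.rpow_logb two_pos (by norm_num) hZ0
  exact ZFProof.not_computable_dom V hV
    (ZFProof.dom_computable V hx0 (by linarith) hF0 hsum hxF hZ hF)
end
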